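/- If the relation lengths l_0,…,l_r of a linear Nakayama algebra A_{n,(n_0,…,n_r)}^{(l_0,…,l_r)} with almost separate relations and of a linear Nakayama algebra A_{n',(n'_0,…,n'_s)}^{(l'_0,…,l'_s)} with almost separate relations give rise to the same quipu parameters — that is, s = r, n' = n, n'_0 = n_0, l'_i = l_i for all i, and n'_i + 1 − n'_{i−1} − l'_{i−1} = n_i + 1 − n_{i−1} − l_{i−1} for 1 ≤ i ≤ r — or, more generally, if the two quipus P_{(n_0, n_1+1−n_0−l_0, …, n+1−n_r−l_r)}^{(l_0−2,…,l_r−2)} and P_{(n'_0, n'_1+1−n'_0−l'_0, …, n'+1−n'_s−l'_s)}^{(l'_0−2,…,l'_s−2)} are isomorphic as graphs, then the two Nakayama algebras are derived equivalent. -/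

import Mathlib

open CategoryTheory

/-- A finite quiver: a finite vertex type, an arrow type, and source/target maps. -/
structure PreQuiver where
  V : Type
  A : Type
  [fintV : Fintype V]
  s : A → V
  t : A → V

attribute [instance] PreQuiver.fintV

/-- The defining relations presenting the path algebra of the quiver `Q` over `k`, together
with the zero relations given by the paths (lists of composable arrows) in `R`.  The
generators are the trivial paths `Sum.inl v` (one for each vertex) and the arrows
`Sum.inr a`; multiplication of generators corresponds to concatenation of paths, so that the
resulting algebra has as a basis the paths of `Q` (not passing through a relation of `R`). -/
inductive PathAlgRel (k : Type) [Field k] (Q : PreQuiver) (R : Set (List Q.A)) :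
    FreeAlgebra k (Q.V ⊕ Q.A) → FreeAlgebra k (Q.V ⊕ Q.A) → Prop
  | idem (v : Q.V) :
      PathAlgRel k Q R (FreeAlgebra.ι k (Sum.inl v) * FreeAlgebra.ι k (Sum.inl v))
        (FreeAlgebra.ι k (Sum.inl v))
  | orth (v w : Q.V) (h : v ≠ w) :
      PathAlgRel k Q R (FreeAlgebra.ι k (Sum.inl v) * FreeAlgebra.ι k (Sum.inl w)) 0
  | unit :
      PathAlgRel k Q R (∑ v : Q.V, FreeAlgebra.ι k (Sum.inl v)) 1
  | source (a : Q.A) :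
      PathAlgRel k Q R (FreeAlgebra.ι k (Sum.inl (Q.s a)) * FreeAlgebra.ι k (Sum.inr a))
        (FreeAlgebra.ι k (Sum.inr a))
  | target (a : Q.A) :
      PathAlgRel k Q R (FreeAlgebra.ι k (Sum.inr a) * FreeAlgebra.ι k (Sum.inl (Q.t a)))
        (FreeAlgebra.ι k (Sum.inr a))
  | zeroRel (p : List Q.A) (hp : p ∈ R) :
      PathAlgRel k Q R ((p.map fun a => FreeAlgebra.ι k (Sum.inr a)).prod) 0

/-- The path algebra of the quiver `Q` over the field `k`, modulo the two-sided ideal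
generated by the zero relations in `R`. -/
abbrev PathAlgebraRel (k : Type) [Field k] (Q : PreQuiver) (R : Set (List Q.A)) : Type :=
  RingQuot (PathAlgRel k Q R)

/-- The path algebra of the quiver `Q` over the field `k`. -/
abbrev PathAlgebra (k : Type) [Field k] (Q : PreQuiver) : Type :=
  PathAlgebraRel k Q ∅

noncomputable instance (C : Type*) [Category C] [Abelian C] : HasDerivedCategory C :=
  HasDerivedCategory.standard C

/-- Two `k`-algebras are *derived equivalent* if there is a triangulated equivalence between
the derived categories of their categories of right modules (i.e. of left modules over the
opposite rings). -/
def DerivedEquivalent (k : Type) [Field k] (A : Type) [Ring A] [Algebra k A]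
    (B : Type) [Ring B] [Algebra k B] : Prop :=
  ∃ (F : DerivedCategory (ModuleCat.{0} Aᵐᵒᵖ) ⥤ DerivedCategory (ModuleCat.{0} Bᵐᵒᵖ))
    (c : F.CommShift ℤ), haveI := c; (F.IsTriangulated ∧ F.IsEquivalence)

/-- The linearly ordered quiver `A_n` of Dynkin type `A`, with vertices `1, …, n`
(realized as `Fin n`) and an arrow from each vertex to the next one. -/
def linQuiver (n : ℕ) : PreQuiver where
  V := Fin n
  A := Fin (n - 1)
  s := fun a => ⟨a.1, by have := a.2; omega⟩
  t := fun a => ⟨a.1 + 1, by have := a.2; omega⟩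

/-- The path of length `l` in the quiver `A_n` starting at the (1-indexed) vertex `v`. -/
def linPath (n : ℕ) (v l : ℕ) : List (linQuiver n).A :=
  (List.range l).filterMap fun j =>
    if h : v - 1 + j < n - 1 then some ⟨v - 1 + j, h⟩ else none

/-- The linear Nakayama algebra `A_{n,(n_0,…,n_{t-1})}^{(l_0,…,l_{t-1})}`: the quotient of
the path algebra of `A_n` over `k` by the two-sided ideal generated, for each `i`, by the
path of length `ls i` starting at the vertex `ns i`. -/
abbrev NakayamaAlgebra (k : Type) [Field k] (n t : ℕ) (ns ls : Fin t → ℕ) : Type :=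
  PathAlgebraRel k (linQuiver n) {p | ∃ i : Fin t, p = linPath n (ns i) (ls i)}

/-- The hypotheses on the data of a linear Nakayama algebra
`A_{n,(n_0,…,n_{t-1})}^{(l_0,…,l_{t-1})}` with almost separate relations: each relation
starts at a vertex `ns i ≥ 1` and has length `ls i ≥ 2`, the start vertices are strictly
increasing, the end vertices `ns i + ls i` are strictly increasing and at most `n`, and the
overlap of two relations is at most one arrow (`ns j ≥ ns i + ls i - 1` for `i < j`). -/
structure IsASNakayama (n t : ℕ) (ns ls : Fin t → ℕ) : Prop where
  one_le : ∀ i, 1 ≤ ns i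
  two_le : ∀ i, 2 ≤ ls i
  start_lt : ∀ i j, i < j → ns i < ns j
  end_lt : ∀ i j, i < j → ns i + ls i < ns j + ls j
  end_le : ∀ i, ns i + ls i ≤ n
  almost_separate : ∀ i j, i < j → ns i + ls i ≤ ns j + 1

/-- The position on the main string (`0`-indexed) of the vertex `b i` of a quipu: there are
`k 0` vertices before `b 0`, then `k 1` vertices between `b 0` and `b 1`, and so on. -/
def bpos (r : ℕ) (kk : Fin (r + 2) → ℕ) (i : Fin (r + 1)) : ℕ :=
  i.1 + ∑ j : Fin (r + 2), if j.1 ≤ i.1 then kk j else 0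

/-- The vertex set of the quipu `P_{(k_0,…,k_{r+1})}^{(m_0,…,m_r)}`: the main string has
`r + 1 + ∑ k_i` vertices, and the `i`-th cord contributes `m i` further vertices. -/
abbrev QuipuV (r : ℕ) (kk : Fin (r + 2) → ℕ) (mm : Fin (r + 1) → ℕ) : Type :=
  Fin (r + 1 + ∑ i, kk i) ⊕ Σ i : Fin (r + 1), Fin (mm i)

/-- The quipu `P_{(k_0,…,k_{r+1})}^{(m_0,…,m_r)}` as a simple graph: a main string which is a
path containing, in order, `k 0` vertices, the vertex `b 0`, `k 1` vertices, the vertex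
`b 1`, …, the vertex `b r` and finally `k (r+1)` vertices, together with, for each `i`, a
path with `m i` edges (the `i`-th cord) attached to the vertex `b i`. -/
def quipuGraph (r : ℕ) (kk : Fin (r + 2) → ℕ) (mm : Fin (r + 1) → ℕ) :
    SimpleGraph (QuipuV r kk mm) :=
  SimpleGraph.fromRel fun x y =>
    match x, y with
    | Sum.inl v, Sum.inl w => w.1 = v.1 + 1
    | Sum.inl v, Sum.inr ⟨i, j⟩ => v.1 = bpos r kk i ∧ j.1 = 0
    | Sum.inr ⟨i, j⟩, Sum.inr ⟨i', j'⟩ => i.1 = i'.1 ∧ j'.1 = j.1 + 1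
    | Sum.inr _, Sum.inl _ => False

/-- The quipu parameters `(k_0, …, k_{t+1})` associated to the data of a linear Nakayama
algebra `A_{n,(n_0,…,n_t)}^{(l_0,…,l_t)}`: `k_0 = n_0`, `k_i = n_i + 1 - n_{i-1} - l_{i-1}`
for `1 ≤ i ≤ t`, and `k_{t+1} = n + 1 - n_t - l_t`. -/
def nakK (n t : ℕ) (ns ls : Fin (t + 1) → ℕ) : Fin (t + 2) → ℕ := fun i =>
  if h0 : i.1 = 0 then ns 0
  else if ht : i.1 ≤ t then
    ns ⟨i.1, by omega⟩ + 1 - ns ⟨i.1 - 1, by omega⟩ - ls ⟨i.1 - 1, by omega⟩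
  else n + 1 - ns (Fin.last t) - ls (Fin.last t)

section S1
open CategoryTheory Category Limits Pretriangulated

universe v₁ v₂ v₃ v₄ u₁ u₂ u₃ u₄

/-- Exact additive functors. -/
class ExF {C : Type u₁} [Category.{v₁} C] [Preadditive C] {D : Type u₂} [Category.{v₂} D]
    [Preadditive D] (F : C ⥤ D) : Prop where
  add : F.Additive
  lim : PreservesFiniteLimits F
  colim : PreservesFiniteColimits F

attribute [instance] ExF.add ExF.lim ExF.colim

section
variable {A : Type u₁} [Category.{v₁} A] [Preadditive A] {B : Type u₂} [Category.{v₂} B]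
  [Preadditive B] {C : Type u₃} [Category.{v₃} C] [Preadditive C]

instance ExF.idF : ExF (𝟭 A) := ⟨inferInstance, inferInstance, inferInstance⟩
instance ExF.compF (F : A ⥤ B) (G : B ⥤ C) [ExF F] [ExF G] : ExF (F ⋙ G) :=
  ⟨inferInstance, inferInstance, inferInstance⟩
end

variable {A : Type u₁} [Category.{v₁} A] [Abelian A] {B : Type u₂} [Category.{v₂} B]
  [Abelian B] {C : Type u₃} [Category.{v₃} C] [Abelian C]
  {D : Type u₄} [Category.{v₄} D] [Abelian D]

/-- The functor induced on derived categories. -/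
noncomputable abbrev dF (F : A ⥤ B) [ExF F] : DerivedCategory A ⥤ DerivedCategory B :=
  F.mapDerivedCategory

/-- The functor induced on complexes. -/
noncomputable abbrev cF (F : A ⥤ B) [ExF F] : CochainComplex A ℤ ⥤ CochainComplex B ℤ :=
  F.mapHomologicalComplex (ComplexShape.up ℤ)

/-- The factorization. -/
noncomputable abbrev dQ (F : A ⥤ B) [ExF F] (K : CochainComplex A ℤ) :
    (dF F).obj (DerivedCategory.Q.obj K) ≅ DerivedCategory.Q.obj ((cF F).obj K) :=
  F.mapDerivedCategoryFactors.app K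

lemma dQ_nat (F : A ⥤ B) [ExF F] {K L : CochainComplex A ℤ} (f : K ⟶ L) :
    (dF F).map (DerivedCategory.Q.map f) ≫ (dQ F L).hom =
      (dQ F K).hom ≫ DerivedCategory.Q.map ((cF F).map f) :=
  F.mapDerivedCategoryFactors.hom.naturality f

/-- The natural transformation induced on derived categories. -/
noncomputable def dN {F G : A ⥤ B} [ExF F] [ExF G] (θ : F ⟶ G) : dF F ⟶ dF G :=
  Localization.liftNatTrans DerivedCategory.Q (HomologicalComplex.quasiIso A (ComplexShape.up ℤ))
    (F.mapHomologicalComplex (ComplexShape.up ℤ) ⋙ DerivedCategory.Q)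
    (G.mapHomologicalComplex (ComplexShape.up ℤ) ⋙ DerivedCategory.Q) (dF F) (dF G)
    (Functor.whiskerRight (NatTrans.mapHomologicalComplex θ (ComplexShape.up ℤ))
      DerivedCategory.Q)

lemma dN_Q {F G : A ⥤ B} [ExF F] [ExF G] (θ : F ⟶ G) (K : CochainComplex A ℤ) :
    (dN θ).app (DerivedCategory.Q.obj K) = (dQ F K).hom ≫
      DerivedCategory.Q.map ((NatTrans.mapHomologicalComplex θ (ComplexShape.up ℤ)).app K) ≫
      (dQ G K).inv := by
  simp only [dN, Localization.liftNatTrans_app]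
  rfl

/-- every object is isomorphic to a Q object -/
lemma exists_Q (X : DerivedCategory A) : ∃ K : CochainComplex A ℤ,
    Nonempty (DerivedCategory.Q.obj K ≅ X) :=
  ⟨_, ⟨DerivedCategory.Q.objObjPreimageIso X⟩⟩

lemma cN_isIso {F G : A ⥤ B} [ExF F] [ExF G] (θ : F ⟶ G) (K : CochainComplex A ℤ)
    (h : ∀ i, IsIso (θ.app (K.X i))) :
    IsIso ((NatTrans.mapHomologicalComplex θ (ComplexShape.up ℤ)).app K) := by
  have : ∀ i, IsIso (((NatTrans.mapHomologicalComplex θ (ComplexShape.up ℤ)).app K).f i) := by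
    intro i; exact h i
  exact HomologicalComplex.Hom.isIso_of_components _

lemma dN_isIso {F G : A ⥤ B} [ExF F] [ExF G] (θ : F ⟶ G) [IsIso θ] (X : DerivedCategory A) :
    IsIso ((dN θ).app X) := by
  obtain ⟨K, ⟨e⟩⟩ := exists_Q X
  rw [← NatTrans.isIso_app_iff_of_iso _ e, dN_Q]
  have := cN_isIso θ K (fun i => inferInstance)
  infer_instance

/-- composition -/
noncomputable def dComp (F : A ⥤ B) (G : B ⥤ C) [ExF F] [ExF G] :
    dF F ⋙ dF G ≅ dF (F ⋙ G) :=
  letI : Localization.Lifting DerivedCategory.Q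
      (HomologicalComplex.quasiIso A (ComplexShape.up ℤ)) ((cF F ⋙ cF G) ⋙ DerivedCategory.Q)
      (dF F ⋙ dF G) :=
    ⟨(Functor.associator _ _ _).symm ≪≫ Functor.isoWhiskerRight F.mapDerivedCategoryFactors _ ≪≫
      Functor.associator _ _ _ ≪≫ Functor.isoWhiskerLeft _ G.mapDerivedCategoryFactors ≪≫
      (Functor.associator _ _ _).symm⟩
  Localization.liftNatIso DerivedCategory.Q (HomologicalComplex.quasiIso A (ComplexShape.up ℤ))
    ((cF F ⋙ cF G) ⋙ DerivedCategory.Q) (cF (F ⋙ G) ⋙ DerivedCategory.Q) _ _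
    (Functor.isoWhiskerRight (Functor.mapHomologicalComplexCompIso (Iso.refl (F ⋙ G)) _) _)

/-- identity -/
noncomputable def dId : 𝟭 (DerivedCategory A) ≅ dF (𝟭 A) :=
  Localization.liftNatIso DerivedCategory.Q (HomologicalComplex.quasiIso A (ComplexShape.up ℤ))
    DerivedCategory.Q (cF (𝟭 A) ⋙ DerivedCategory.Q) _ _
    ((Functor.leftUnitor _).symm ≪≫
      Functor.isoWhiskerRight (Functor.mapHomologicalComplexIdIso A _).symm _)

/-- an exact functor with zero values is zero on derived categories -/
lemma dF_isZero (F : A ⥤ B) [ExF F] (h : ∀ X, IsZero (F.obj X)) (X : DerivedCategory A) :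
    IsZero ((dF F).obj X) := by
  obtain ⟨K, ⟨e⟩⟩ := exists_Q X
  have hz : IsZero ((cF F).obj K) := by
    rw [IsZero.iff_id_eq_zero]
    ext i
    exact (h (K.X i)).eq_of_src _ _
  refine IsZero.of_iso ?_ ((dF F).mapIso e.symm ≪≫ dQ F K)
  exact DerivedCategory.Q.map_isZero hz

/-- the adjunction on complexes -/
noncomputable def cAdj {F : A ⥤ B} {G : B ⥤ A} [ExF F] [ExF G] (adj : F ⊣ G) :
    cF F ⊣ cF G :=
  Adjunction.mkOfUnitCounit
    { unit := { app := fun K => { f := fun i => adj.unit.app (K.X i)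
                                  comm' := fun i j _ => (adj.unit.naturality (K.d i j)).symm }
                naturality := fun K L f => by
                  ext i; exact adj.unit.naturality (f.f i) }
      counit := { app := fun K => { f := fun i => adj.counit.app (K.X i)
                                    comm' := fun i j _ => (adj.counit.naturality (K.d i j)).symm }
                  naturality := fun K L f => by
                    ext i; exact adj.counit.naturality (f.f i) }
      left_triangle := by
        ext K i
        simp only [NatTrans.comp_app, HomologicalComplex.comp_f]
        change F.map (adj.unit.app (K.X i)) ≫ 𝟙 _ ≫ adj.counit.app (F.obj (K.X i)) = 𝟙 _
        simp
      right_triangle := by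
        ext K i
        simp only [NatTrans.comp_app, HomologicalComplex.comp_f]
        change adj.unit.app (G.obj (K.X i)) ≫ 𝟙 _ ≫ G.map (adj.counit.app (K.X i)) = 𝟙 _
        simp }

noncomputable instance dSq (F : A ⥤ B) [ExF F] :
    CatCommSq (cF F) DerivedCategory.Q DerivedCategory.Q (dF F) :=
  ⟨F.mapDerivedCategoryFactors.symm⟩

/-- the adjunction on derived categories -/
noncomputable def dAdj {F : A ⥤ B} {G : B ⥤ A} [ExF F] [ExF G] (adj : F ⊣ G) :
    dF F ⊣ dF G :=
  (cAdj adj).localization DerivedCategory.Q (HomologicalComplex.quasiIso A (ComplexShape.up ℤ))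
    DerivedCategory.Q (HomologicalComplex.quasiIso B (ComplexShape.up ℤ)) (dF F) (dF G)

lemma dAdj_unit_isIso {F : A ⥤ B} {G : B ⥤ A} [ExF F] [ExF G] (adj : F ⊣ G)
    (h : ∀ X, IsIso (adj.unit.app X)) (X : DerivedCategory A) : IsIso ((dAdj adj).unit.app X) := by
  obtain ⟨K, ⟨e⟩⟩ := exists_Q X
  rw [← NatTrans.isIso_app_iff_of_iso _ e, dAdj, Adjunction.localization_unit_app]
  have : IsIso ((cAdj adj).unit.app K) := by
    have : ∀ i, IsIso (((cAdj adj).unit.app K).f i) := fun i => h _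
    exact HomologicalComplex.Hom.isIso_of_components _
  infer_instance

lemma dAdj_counit_isIso {F : A ⥤ B} {G : B ⥤ A} [ExF F] [ExF G] (adj : F ⊣ G)
    (h : ∀ X, IsIso (adj.counit.app X)) (X : DerivedCategory B) :
    IsIso ((dAdj adj).counit.app X) := by
  obtain ⟨K, ⟨e⟩⟩ := exists_Q X
  rw [← NatTrans.isIso_app_iff_of_iso _ e, dAdj, Adjunction.localization_counit_app]
  have : IsIso ((cAdj adj).counit.app K) := by
    have : ∀ i, IsIso (((cAdj adj).counit.app K).f i) := fun i => h _
    exact HomologicalComplex.Hom.isIso_of_components _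
  infer_instance

/-- a mixed isomorphism criterion -/
lemma dN_mid_isIso (H₁ : A ⥤ B) {P R : B ⥤ C} (θ : P ⟶ R) (H₂ : C ⥤ D) [ExF H₁] [ExF P] [ExF R]
    [ExF H₂] (h : ∀ X, IsIso (H₂.map (θ.app (H₁.obj X)))) (X : DerivedCategory A) :
    IsIso ((dF H₂).map ((dN θ).app ((dF H₁).obj X))) := by
  obtain ⟨K, ⟨e⟩⟩ := exists_Q X
  have key : IsIso ((dF H₂).map ((dN θ).app (DerivedCategory.Q.obj ((cF H₁).obj K)))) := by
    rw [dN_Q, Functor.map_comp, Functor.map_comp]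
    have h1 : IsIso ((cF H₂).map
        ((NatTrans.mapHomologicalComplex θ (ComplexShape.up ℤ)).app ((cF H₁).obj K))) := by
      have : ∀ i, IsIso (((cF H₂).map
        ((NatTrans.mapHomologicalComplex θ (ComplexShape.up ℤ)).app ((cF H₁).obj K))).f i) :=
        fun i => h _
      exact HomologicalComplex.Hom.isIso_of_components _
    have h2 := dQ_nat H₂
      ((NatTrans.mapHomologicalComplex θ (ComplexShape.up ℤ)).app ((cF H₁).obj K))
    rw [← Iso.eq_comp_inv] at h2
    rw [h2]
    infer_instance
  have e' : DerivedCategory.Q.obj ((cF H₁).obj K) ≅ (dF H₁).obj X :=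
    (dQ H₁ K).symm ≪≫ (dF H₁).mapIso e
  have := NatTrans.isIso_app_iff_of_iso (Functor.whiskerRight (dN θ) (dF H₂)) e'
  exact this.1 key

/-- short exact sequences of exact functors give triangles -/
lemma dTri {F G H : A ⥤ B} [ExF F] [ExF G] [ExF H] (α : F ⟶ G) (β : G ⟶ H)
    (w : ∀ X, α.app X ≫ β.app X = 0)
    (hS : ∀ X, (ShortComplex.mk (α.app X) (β.app X) (w X)).ShortExact) (X : DerivedCategory A) :
    ∃ δ, Triangle.mk ((dN α).app X) ((dN β).app X) δ ∈ distTriang (DerivedCategory B) := by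
  obtain ⟨K, ⟨e⟩⟩ := exists_Q X
  let S : ShortComplex (CochainComplex B ℤ) :=
    ShortComplex.mk ((NatTrans.mapHomologicalComplex α (ComplexShape.up ℤ)).app K)
      ((NatTrans.mapHomologicalComplex β (ComplexShape.up ℤ)).app K) (by ext i; exact w _)
  have hS' : S.ShortExact := by
    apply HomologicalComplex.shortExact_of_degreewise_shortExact
    intro i
    exact hS (K.X i)
  have hT := DerivedCategory.triangleOfSES_distinguished hS'
  let e₁ : (dF F).obj X ≅ DerivedCategory.Q.obj S.X₁ := (dF F).mapIso e.symm ≪≫ dQ F K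
  let e₂ : (dF G).obj X ≅ DerivedCategory.Q.obj S.X₂ := (dF G).mapIso e.symm ≪≫ dQ G K
  let e₃ : (dF H).obj X ≅ DerivedCategory.Q.obj S.X₃ := (dF H).mapIso e.symm ≪≫ dQ H K
  refine ⟨e₃.hom ≫ DerivedCategory.triangleOfSESδ hS' ≫ (e₁.inv)⟦(1:ℤ)⟧', ?_⟩
  refine isomorphic_distinguished _ hT _ (Triangle.isoMk _ _ e₁ e₂ e₃ ?_ ?_ ?_)
  · have h1 := (dN α).naturality e.inv
    have h2 := dN_Q α K
    change (dN α).app X ≫ (dF G).map e.inv ≫ (dQ G K).hom =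
      ((dF F).map e.inv ≫ (dQ F K).hom) ≫
        DerivedCategory.Q.map ((NatTrans.mapHomologicalComplex α (ComplexShape.up ℤ)).app K)
    rw [← reassoc_of% h1, h2]
    simp only [assoc, Iso.inv_hom_id, comp_id]
  · have h1 := (dN β).naturality e.inv
    have h2 := dN_Q β K
    change (dN β).app X ≫ (dF H).map e.inv ≫ (dQ H K).hom =
      ((dF G).map e.inv ≫ (dQ G K).hom) ≫
        DerivedCategory.Q.map ((NatTrans.mapHomologicalComplex β (ComplexShape.up ℤ)).app K)
    rw [← reassoc_of% h1, h2]
    simp only [assoc, Iso.inv_hom_id, comp_id]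
  · change (e₃.hom ≫ DerivedCategory.triangleOfSESδ hS' ≫ (e₁.inv)⟦(1:ℤ)⟧') ≫ (e₁.hom)⟦(1:ℤ)⟧' =
      e₃.hom ≫ DerivedCategory.triangleOfSESδ hS'
    rw [assoc, assoc, ← Functor.map_comp, e₁.inv_hom_id, CategoryTheory.Functor.map_id, comp_id]

end S1

section S2
open CategoryTheory Category Limits Pretriangulated

universe w v₁ v₂ v₃ v₄ u₁ u₂ u₃ u₄

/-- Abelian categories from jointly conservative families of kernel and cokernel preserving
functors. -/
@[reducible] noncomputable def abelianOfJointly {C : Type u₁} [Category.{v₁} C] [Preadditive C]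
    [HasFiniteProducts C] [HasKernels C] [HasCokernels C] {ι : Type w} {A : ι → Type u₂}
    [∀ i, Category.{v₂} (A i)] [∀ i, Abelian (A i)] (ev : ∀ i, C ⥤ A i)
    [∀ i, (ev i).PreservesZeroMorphisms]
    [∀ i, PreservesLimitsOfShape WalkingParallelPair (ev i)]
    [∀ i, PreservesColimitsOfShape WalkingParallelPair (ev i)]
    (hi : ∀ {X Y : C} (f : X ⟶ Y), (∀ i, IsIso ((ev i).map f)) → IsIso f) : Abelian C := by
  have : ∀ {X Y : C} (f : X ⟶ Y), IsIso (Abelian.coimageImageComparison f) := by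
    intro X Y f
    apply hi
    intro i
    have := Arrow.isIso_iff_isIso_of_isIso
      (Abelian.PreservesCoimageImageComparison.iso (ev i) f).hom
    exact this.2 inferInstance
  exact Abelian.ofCoimageImageComparisonIsIso

namespace CommaAb

section Pre
variable {A : Type u₁} [Category.{v₁} A] [Preadditive A] {B : Type u₂} [Category.{v₂} B]
  [Preadditive B] {T : Type u₃} [Category.{v₃} T] [Preadditive T] (L : A ⥤ T) (R : B ⥤ T)
  [L.Additive] [R.Additive]

variable {L R}
instance (X Y : Comma L R) : Zero (X ⟶ Y) := ⟨{ left := 0, right := 0, w := by simp }⟩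
instance (X Y : Comma L R) : Add (X ⟶ Y) :=
  ⟨fun f g => { left := f.left + g.left, right := f.right + g.right,
                w := by simp [Functor.map_add, Preadditive.add_comp, Preadditive.comp_add] }⟩
instance (X Y : Comma L R) : Neg (X ⟶ Y) :=
  ⟨fun f => { left := -f.left, right := -f.right,
              w := by simp [Functor.map_neg, Preadditive.neg_comp, Preadditive.comp_neg] }⟩
instance (X Y : Comma L R) : Sub (X ⟶ Y) :=
  ⟨fun f g => { left := f.left - g.left, right := f.right - g.right,
                w := by simp [Functor.map_sub, Preadditive.sub_comp, Preadditive.comp_sub] }⟩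
instance (X Y : Comma L R) : SMul ℕ (X ⟶ Y) :=
  ⟨fun n f => { left := n • f.left, right := n • f.right,
                w := by simp [Functor.map_nsmul, Preadditive.nsmul_comp, Preadditive.comp_nsmul] }⟩
instance (X Y : Comma L R) : SMul ℤ (X ⟶ Y) :=
  ⟨fun n f => { left := n • f.left, right := n • f.right,
                w := by simp [Functor.map_zsmul, Preadditive.zsmul_comp, Preadditive.comp_zsmul] }⟩

/-- components -/
def pr {X Y : Comma L R} (f : X ⟶ Y) : (X.left ⟶ Y.left) × (X.right ⟶ Y.right) :=
  (f.left, f.right)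

lemma pr_inj {X Y : Comma L R} : Function.Injective (pr (X := X) (Y := Y)) := by
  intro f g h
  simp only [pr, Prod.mk.injEq] at h
  ext
  · exact h.1
  · exact h.2

instance (X Y : Comma L R) : AddCommGroup (X ⟶ Y) :=
  pr_inj.addCommGroup _ rfl (fun _ _ => rfl) (fun _ => rfl) (fun _ _ => rfl) (fun _ _ => rfl)
    (fun _ _ => rfl)

@[simp] lemma add_left {X Y : Comma L R} (f g : X ⟶ Y) : (f + g).left = f.left + g.left := rfl
@[simp] lemma add_right {X Y : Comma L R} (f g : X ⟶ Y) : (f + g).right = f.right + g.right := rfl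
@[simp] lemma zero_left {X Y : Comma L R} : (0 : X ⟶ Y).left = 0 := rfl
@[simp] lemma zero_right {X Y : Comma L R} : (0 : X ⟶ Y).right = 0 := rfl

instance : Preadditive (Comma L R) where
  add_comp := by intros; ext <;> simp
  comp_add := by intros; ext <;> simp

instance : (Comma.fst L R).Additive := ⟨fun {_ _} {_ _} => rfl⟩
instance : (Comma.snd L R).Additive := ⟨fun {_ _} {_ _} => rfl⟩
end Pre

variable {A : Type u₁} [Category.{v₁} A] [Abelian A] {B : Type u₂} [Category.{v₂} B]
  [Abelian B] {T : Type u₃} [Category.{v₃} T] [Abelian T] (L : A ⥤ T) (R : B ⥤ T)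
  [ExF L] [ExF R]

lemma isIso_of {X Y : Comma L R} (f : X ⟶ Y) (h1 : IsIso f.left) (h2 : IsIso f.right) :
    IsIso f := by
  have : f = (Comma.isoMk (asIso f.left) (asIso f.right) f.w).hom := by ext <;> rfl
  rw [this]; infer_instance

instance pl1 (J : Type) [SmallCategory J] [FinCategory J] :
    PreservesLimitsOfShape J (Comma.fst L R) where
  preservesLimit {K} := preservesLimit_of_preserves_limit_cone
    (Comma.coneOfPreservesIsLimit K (limit.isLimit _) (limit.isLimit _)) (limit.isLimit _)
instance pl2 (J : Type) [SmallCategory J] [FinCategory J] :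
    PreservesLimitsOfShape J (Comma.snd L R) where
  preservesLimit {K} := preservesLimit_of_preserves_limit_cone
    (Comma.coneOfPreservesIsLimit K (limit.isLimit _) (limit.isLimit _)) (limit.isLimit _)
instance pc1 (J : Type) [SmallCategory J] [FinCategory J] :
    PreservesColimitsOfShape J (Comma.fst L R) where
  preservesColimit {K} := preservesColimit_of_preserves_colimit_cocone
    (Comma.coconeOfPreservesIsColimit K (colimit.isColimit _) (colimit.isColimit _))
    (colimit.isColimit _)
instance pc2 (J : Type) [SmallCategory J] [FinCategory J] :
    PreservesColimitsOfShape J (Comma.snd L R) where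
  preservesColimit {K} := preservesColimit_of_preserves_colimit_cocone
    (Comma.coconeOfPreservesIsColimit K (colimit.isColimit _) (colimit.isColimit _))
    (colimit.isColimit _)

instance : ExF (Comma.fst L R) :=
  ⟨inferInstance, ⟨fun J => inferInstance⟩, ⟨fun J => inferInstance⟩⟩
instance : ExF (Comma.snd L R) :=
  ⟨inferInstance, ⟨fun J => inferInstance⟩, ⟨fun J => inferInstance⟩⟩

noncomputable instance : Abelian (Comma L R) := by
  have : ∀ {X Y : Comma L R} (f : X ⟶ Y), IsIso (Abelian.coimageImageComparison f) := by
    intro X Y f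
    apply isIso_of
    · have := Arrow.isIso_iff_isIso_of_isIso
        (Abelian.PreservesCoimageImageComparison.iso (Comma.fst L R) f).hom
      exact this.2 inferInstance
    · have := Arrow.isIso_iff_isIso_of_isIso
        (Abelian.PreservesCoimageImageComparison.iso (Comma.snd L R) f).hom
      exact this.2 inferInstance
  exact Abelian.ofCoimageImageComparisonIsIso

variable {L R}
lemma exF {X : Type u₄} [Category.{v₄} X] [Preadditive X] (H : X ⥤ Comma L R)
    (h1 : ExF (H ⋙ Comma.fst L R)) (h2 : ExF (H ⋙ Comma.snd L R)) : ExF H where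
  add := ⟨fun {a b f g} => by
    ext
    · exact (H ⋙ Comma.fst L R).map_add
    · exact (H ⋙ Comma.snd L R).map_add⟩
  lim := ⟨fun J _ _ => ⟨fun {K} => ⟨fun {c} hc => ⟨by
    refine Comma.fstSndJointlyReflectLimit ?_ ?_
    · exact isLimitOfPreserves (H ⋙ Comma.fst L R) hc
    · exact isLimitOfPreserves (H ⋙ Comma.snd L R) hc⟩⟩⟩⟩
  colim := ⟨fun J _ _ => ⟨fun {K} => ⟨fun {c} hc => ⟨by
    refine Comma.fstSndJointlyReflectColimit ?_ ?_
    · exact isColimitOfPreserves (H ⋙ Comma.fst L R) hc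
    · exact isColimitOfPreserves (H ⋙ Comma.snd L R) hc⟩⟩⟩⟩

lemma isZero_of {X : Comma L R} (h1 : IsZero X.left) (h2 : IsZero X.right) : IsZero X := by
  rw [IsZero.iff_id_eq_zero]
  ext
  · exact h1.eq_of_src _ _
  · exact h2.eq_of_src _ _

lemma shortExact_of (S : ShortComplex (Comma L R)) (h1 : (S.map (Comma.fst L R)).ShortExact)
    (h2 : (S.map (Comma.snd L R)).ShortExact) : S.ShortExact where
  exact := by
    rw [ShortComplex.exact_iff_isZero_homology]
    apply isZero_of
    · have := (ShortComplex.exact_iff_isZero_homology _).1 h1.exact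
      exact this.of_iso (S.mapHomologyIso (Comma.fst L R)).symm
    · have := (ShortComplex.exact_iff_isZero_homology _).1 h2.exact
      exact this.of_iso (S.mapHomologyIso (Comma.snd L R)).symm
  mono_f := by
    have m1 := h1.mono_f
    have m2 := h2.mono_f
    refine ⟨fun {Z} g h e => ?_⟩
    ext
    · exact m1.right_cancellation _ _ (congrArg CommaMorphism.left e)
    · exact m2.right_cancellation _ _ (congrArg CommaMorphism.right e)
  epi_g := by
    have m1 := h1.epi_g
    have m2 := h2.epi_g
    refine ⟨fun {Z} g h e => ?_⟩
    ext
    · exact m1.left_cancellation _ _ (congrArg CommaMorphism.left e)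
    · exact m2.left_cancellation _ _ (congrArg CommaMorphism.right e)

end CommaAb
end S2

section S3
open CategoryTheory Category Limits Pretriangulated

universe v₁ v₂ v₃ v₄ u₁ u₂ u₃ u₄

/-- A Bousfield type localization lemma. -/
lemma bousfield {U : Type u₁} [Category.{v₁} U] [HasZeroObject U] [HasShift U ℤ] [Preadditive U]
    [∀ n : ℤ, (shiftFunctor U n).Additive] [Pretriangulated U]
    {T : Type u₂} [Category.{v₂} T] [HasZeroObject T] [HasShift T ℤ] [Preadditive T]
    [∀ n : ℤ, (shiftFunctor T n).Additive] [Pretriangulated T]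
    (i : U ⥤ T) [i.CommShift ℤ] [i.IsTriangulated] [i.Full] [i.Faithful]
    (V : T ⥤ T) (ζ : 𝟭 T ⟶ V)
    (h1 : ∀ (N : U) (E : T) (f : i.obj N ⟶ V.obj E), f = 0)
    (h2 : ∀ E : T, ∃ (N : U) (z : i.obj N ⟶ E) (δ : V.obj E ⟶ (i.obj N)⟦(1 : ℤ)⟧),
      Triangle.mk z (ζ.app E) δ ∈ distTriang T) :
    ∃ (G : T ⥤ U) (_ : G.CommShift ℤ) (_ : G.IsTriangulated) (ε : G ⋙ i ⟶ 𝟭 T)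
      (δ : V ⟶ (G ⋙ i) ⋙ shiftFunctor T (1 : ℤ)),
      ∀ E, Triangle.mk (ε.app E) (ζ.app E) (δ.app E) ∈ distTriang T := by
  choose C z d hd using h2
  have h1' : ∀ (N : U) (E : T) (f : (i.obj N)⟦(1 : ℤ)⟧ ⟶ V.obj E), f = 0 := by
    intro N E f
    have := h1 (N⟦(1 : ℤ)⟧) E ((i.commShiftIso (1 : ℤ)).hom.app N ≫ f)
    rwa [Preadditive.IsIso.comp_left_eq_zero] at this
  have h1'' : ∀ (N : U) (E : T) (f : i.obj N ⟶ (V.obj E)⟦(-1 : ℤ)⟧), f = 0 := by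
    intro N E f
    let e : ((V.obj E)⟦(-1 : ℤ)⟧)⟦(1 : ℤ)⟧ ≅ V.obj E :=
      (shiftFunctorCompIsoId T (-1 : ℤ) 1 (by simp)).app _
    have := h1' N E (f⟦(1 : ℤ)⟧' ≫ e.hom)
    rw [Preadditive.IsIso.comp_right_eq_zero] at this
    rwa [Functor.map_eq_zero_iff] at this
  have bij : ∀ N E, Function.Bijective (fun g : N ⟶ C E => i.map g ≫ z E) := by
    intro N E
    constructor
    · intro g g' h
      have h' : i.map (g - g') ≫ z E = 0 := by
        rw [Functor.map_sub, Preadditive.sub_comp, sub_eq_zero]; exact h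
      obtain ⟨y, hy⟩ := Triangle.coyoneda_exact₁ _ (hd E) ((i.map (g - g'))⟦(1 : ℤ)⟧')
        (by erw [← Functor.map_comp, h', Functor.map_zero])
      have hy0 : y = 0 := h1' _ _ _
      rw [hy0, zero_comp] at hy
      have hy1 : i.map (g - g') = 0 := (Functor.map_eq_zero_iff (shiftFunctor T (1 : ℤ))).1 hy
      rw [Functor.map_eq_zero_iff, sub_eq_zero] at hy1
      exact hy1
    · intro f
      obtain ⟨y, hy⟩ := Triangle.coyoneda_exact₂ _ (hd E) f (h1 _ _ _)
      exact ⟨i.preimage y, by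
        change i.map (i.preimage y) ≫ z E = f
        erw [i.map_preimage]; exact hy.symm⟩
  let e : ∀ N E, (i.obj N ⟶ E) ≃ (N ⟶ C E) := fun N E => (Equiv.ofBijective _ (bij N E)).symm
  have he : ∀ N N' E (f : N' ⟶ N) (g : i.obj N ⟶ E), e N' E (i.map f ≫ g) = f ≫ e N E g := by
    intro N N' E f g
    apply (bij N' E).1
    have ha := (Equiv.ofBijective _ (bij N' E)).apply_symm_apply (i.map f ≫ g)
    have hb := (Equiv.ofBijective _ (bij N E)).apply_symm_apply g
    simp only [Equiv.ofBijective_apply] at ha hb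
    simp only [e]
    rw [ha, Functor.map_comp, assoc, hb]
  let G : T ⥤ U := Adjunction.rightAdjointOfEquiv e (by intro X' X Y f g; exact he X X' Y f g)
  let adj : i ⊣ G := Adjunction.adjunctionOfEquivRight e (by intro X' X Y f g; exact he X X' Y f g)
  have hcounit : ∀ E, adj.counit.app E = z E := by
    intro E
    have : adj.counit.app E = (e (C E) E).symm (𝟙 (C E)) := by
      simp only [adj, Adjunction.adjunctionOfEquivRight, Adjunction.mkOfHomEquiv_counit_app]
      rfl
    rw [this]
    simp [e]
  letI : G.CommShift ℤ := adj.rightAdjointCommShift ℤ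
  haveI : adj.CommShift ℤ := adj.commShift_of_leftAdjoint ℤ
  haveI : G.IsTriangulated := adj.isTriangulated_rightAdjoint
  have nat : ∀ {E E' : T} (g : E ⟶ E'),
      V.map g ≫ d E' = d E ≫ (i.map (G.map g))⟦(1 : ℤ)⟧' := by
    intro E E' g
    have hc : z E ≫ g = i.map (G.map g) ≫ z E' := by
      rw [← hcounit, ← hcounit]; exact (adj.counit.naturality g).symm
    obtain ⟨c, hc1, hc2⟩ : ∃ c : V.obj E ⟶ V.obj E', ζ.app E ≫ c = g ≫ ζ.app E' ∧
        d E ≫ (i.map (G.map g))⟦(1 : ℤ)⟧' = c ≫ d E' := complete_distinguished_triangle_morphism _ _ (hd E) (hd E')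
      (i.map (G.map g)) g hc
    have hz : c = V.map g := by
      rw [← sub_eq_zero]
      have hn := ζ.naturality g
      simp only [Functor.id_map] at hn
      obtain ⟨y, hy⟩ := Triangle.yoneda_exact₃ _ (hd E) (c - V.map g) (by
        change ζ.app E ≫ (c - V.map g) = 0
        rw [Preadditive.comp_sub, hc1, hn, sub_self])
      have hy0 : y = 0 := h1' _ _ _
      rw [hy, hy0]; exact comp_zero
    rw [← hz]; exact hc2.symm
  refine ⟨G, inferInstance, inferInstance, adj.counit,
    { app := d, naturality := fun E E' g => nat g }, fun E => ?_⟩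
  rw [hcounit]
  exact hd E

end S3

section S4
open CategoryTheory Category Limits Pretriangulated ZeroObject

universe v₁ v₂ v₃ v₄ u₁ u₂ u₃ u₄

lemma ExF.ofZero {A : Type u₁} [Category.{v₁} A] [Preadditive A] {B : Type u₂} [Category.{v₂} B]
    [Preadditive B] (F : A ⥤ B) (h : ∀ X, IsZero (F.obj X)) : ExF F where
  add := ⟨fun {_ _ _ _} => (h _).eq_of_src _ _⟩
  lim := ⟨fun J _ _ => ⟨fun {K} => ⟨fun {c} _ => ⟨
    { lift := fun s => 0
      fac := fun s j => (h _).eq_of_tgt _ _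
      uniq := fun s m _ => (h _).eq_of_tgt _ _ }⟩⟩⟩⟩
  colim := ⟨fun J _ _ => ⟨fun {K} => ⟨fun {c} _ => ⟨
    { desc := fun s => 0
      fac := fun s j => (h _).eq_of_src _ _
      uniq := fun s m _ => (h _).eq_of_src _ _ }⟩⟩⟩⟩

lemma ExF.ofIso {A : Type u₁} [Category.{v₁} A] [Preadditive A] {B : Type u₂} [Category.{v₂} B]
    [Preadditive B] {F G : A ⥤ B} (e : F ≅ G) [ExF F] : ExF G where
  add := Functor.additive_of_iso e
  lim := preservesFiniteLimits_of_natIso e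
  colim := preservesFiniteColimits_of_natIso e

variable {L : Type u₁} [Category.{v₁} L] [Abelian L] {M : Type u₂} [Category.{v₂} M] [Abelian M]

lemma zeroF (F : L ⥤ M) (h : F = (Functor.const L).obj 0) : ExF F :=
  ExF.ofZero _ (fun _ => by subst h; exact isZero_zero _)

namespace DD
variable (G : L ⥤ M) [ExF G]

/-- `W → GX`. -/
abbrev Ob := Comma (𝟭 M) G
/-- the vertex `W` -/
abbrev evW : Ob G ⥤ M := Comma.fst _ _
/-- the vertex `X` -/
abbrev evX : Ob G ⥤ L := Comma.snd _ _
/-- `GX = GX` -/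
@[simps] def rho : L ⥤ Ob G where
  obj X := ⟨G.obj X, X, 𝟙 _⟩
  map f := { left := G.map f, right := f }
/-- `W → 0` -/
@[simps] noncomputable def tau : M ⥤ Ob G where
  obj W := ⟨W, 0, 0⟩
  map f := { left := f, right := 0 }
/-- `0 → GX` -/
@[simps] noncomputable def u : L ⥤ Ob G where
  obj X := ⟨0, X, 0⟩
  map f := { left := 0, right := f }

instance : ExF (rho G) := CommaAb.exF _ (inferInstanceAs (ExF G)) (inferInstanceAs (ExF (𝟭 L)))
instance : ExF (tau G) := CommaAb.exF _ (inferInstanceAs (ExF (𝟭 M)))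
  (ExF.ofZero _ (fun _ => isZero_zero _))
instance : ExF (u G) := CommaAb.exF _ (ExF.ofZero _ (fun _ => isZero_zero _))
  (inferInstanceAs (ExF (𝟭 L)))

/-- unit -/
@[simps] def etaRho (E : Ob G) : E ⟶ (rho G).obj E.right where
  left := E.hom
  right := 𝟙 _
  w := by
    change E.hom ≫ 𝟙 _ = E.hom ≫ G.map (𝟙 _)
    rw [CategoryTheory.Functor.map_id]
/-- unit -/
@[simps] noncomputable def etaTau (E : Ob G) : E ⟶ (tau G).obj E.left where
  left := 𝟙 _
  right := 0
  w := by
    change (𝟙 E.left) ≫ 0 = E.hom ≫ G.map 0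
    rw [Functor.map_zero, comp_zero, comp_zero]
/-- counit -/
@[simps] noncomputable def epsU (E : Ob G) : (u G).obj E.right ⟶ E where
  left := 0
  right := 𝟙 _
  w := (isZero_zero M).eq_of_src _ _

/-- adjunction -/
def adjRho : evX G ⊣ rho G where
  unit := { app := etaRho G, naturality := fun X Y f => by
              ext
              · exact f.w
              · exact (comp_id f.right).trans (id_comp f.right).symm }
  counit := { app := fun X => 𝟙 X, naturality := fun _ _ f => (comp_id f).trans (id_comp f).symm }
  left_triangle_components := fun E => comp_id (𝟙 E.right)
  right_triangle_components := fun E => by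
    ext
    · change 𝟙 _ ≫ G.map (𝟙 E) = 𝟙 (G.obj E)
      rw [CategoryTheory.Functor.map_id, comp_id]
    · exact comp_id _
/-- adjunction -/
noncomputable def adjTau : evW G ⊣ tau G where
  unit := { app := etaTau G, naturality := fun X Y f => by
              ext
              · exact (comp_id f.left).trans (id_comp f.left).symm
              · exact (isZero_zero L).eq_of_tgt _ _ }
  counit := { app := fun X => 𝟙 X, naturality := fun _ _ f => (comp_id f).trans (id_comp f).symm }
  left_triangle_components := fun E => comp_id (𝟙 E.left)
  right_triangle_components := fun E => by
    ext
    · exact comp_id _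
    · exact (isZero_zero L).eq_of_tgt _ _
/-- adjunction -/
noncomputable def adjU : u G ⊣ evX G where
  unit := { app := fun X => 𝟙 X, naturality := fun _ _ f => (comp_id f).trans (id_comp f).symm }
  counit := { app := epsU G, naturality := fun X Y f => by
                ext
                · exact (isZero_zero M).eq_of_src _ _
                · exact (comp_id f.right).trans (id_comp f.right).symm }
  left_triangle_components := fun E => by
    ext
    · exact (isZero_zero M).eq_of_src _ _
    · exact comp_id _
  right_triangle_components := fun E => comp_id (𝟙 E.right)

lemma adjTau_counit (X : M) : IsIso ((adjTau G).counit.app X) := by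
  change IsIso (𝟙 X); infer_instance
lemma adjRho_counit (X : L) : IsIso ((adjRho G).counit.app X) := by
  change IsIso (𝟙 X); infer_instance
lemma adjU_unit (X : L) : IsIso ((adjU G).unit.app X) := by
  change IsIso (𝟙 X); infer_instance

instance tauFull : (dF (tau G)).Full := by
  have : ∀ X, IsIso ((dAdj (adjTau G)).counit.app X) := dAdj_counit_isIso _ (adjTau_counit G)
  have := NatIso.isIso_of_isIso_app (dAdj (adjTau G)).counit
  exact (dAdj (adjTau G)).fullyFaithfulROfIsIsoCounit.full
instance tauFaithful : (dF (tau G)).Faithful := by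
  have : ∀ X, IsIso ((dAdj (adjTau G)).counit.app X) := dAdj_counit_isIso _ (adjTau_counit G)
  have := NatIso.isIso_of_isIso_app (dAdj (adjTau G)).counit
  exact (dAdj (adjTau G)).fullyFaithfulROfIsIsoCounit.faithful

lemma se_left {C : Type*} [Category C] [Abelian C] (X Y Z : C) (f : X ⟶ Y) (g : Y ⟶ Z) (w)
    (h : IsZero X) (hg : IsIso g) :
    (ShortComplex.mk f g w).ShortExact := by
  have hs : (ShortComplex.mk f g w).Splitting :=
    { r := 0, s := inv g, f_r := h.eq_of_src _ _, s_g := by simp,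
      id := by simp }
  exact hs.shortExact
lemma se_right {C : Type*} [Category C] [Abelian C] (X Y Z : C) (f : X ⟶ Y) (g : Y ⟶ Z) (w)
    (h : IsZero Z) (hg : IsIso f) :
    (ShortComplex.mk f g w).ShortExact := by
  have hs : (ShortComplex.mk f g w).Splitting :=
    { r := inv f, s := 0, s_g := h.eq_of_src _ _, f_r := by simp,
      id := by simp }
  exact hs.shortExact

lemma tri (D : DerivedCategory (Ob G)) : ∃ δ, Triangle.mk
    ((dN ((adjU G).counit)).app D) ((dN ((adjTau G).unit)).app D) δ ∈
      distTriang (DerivedCategory (Ob G)) := by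
  refine dTri _ _ (fun X => ?_) (fun X => ?_) D
  · ext
    · exact (isZero_zero M).eq_of_src _ _
    · exact (isZero_zero L).eq_of_tgt _ _
  · apply CommaAb.shortExact_of
    · refine se_left _ _ _ _ _ _ (isZero_zero M) ?_
      change IsIso (𝟙 _); infer_instance
    · refine se_right _ _ _ _ _ _ (isZero_zero L) ?_
      change IsIso (𝟙 _); infer_instance

/-- vanishing of `evW` -/
lemma iso_u (D : DerivedCategory (Ob G)) (h : IsZero ((dF (evW G)).obj D)) :
    ∃ Y, Nonempty (D ≅ (dF (u G)).obj Y) := by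
  obtain ⟨δ, hδ⟩ := tri G D
  have hz : IsZero ((dF (evW G ⋙ tau G)).obj D) :=
    ((dF (tau G)).map_isZero h).of_iso ((dComp (evW G) (tau G)).app D).symm
  have : IsIso ((dN ((adjU G).counit)).app D) :=
    (Triangle.isZero₃_iff_isIso₁ _ hδ).1 hz
  exact ⟨_, ⟨dId.app D ≪≫ (asIso ((dN ((adjU G).counit)).app D)).symm ≪≫
    ((dComp (evX G) (u G)).app D).symm⟩⟩
lemma iso_tau (D : DerivedCategory (Ob G)) (h : IsZero ((dF (evX G)).obj D)) :
    ∃ Y, Nonempty (D ≅ (dF (tau G)).obj Y) := by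
  obtain ⟨δ, hδ⟩ := tri G D
  have hz : IsZero ((dF (evX G ⋙ u G)).obj D) :=
    ((dF (u G)).map_isZero h).of_iso ((dComp (evX G) (u G)).app D).symm
  have : IsIso ((dN ((adjTau G).unit)).app D) :=
    (Triangle.isZero₁_iff_isIso₂ _ hδ).1 hz
  exact ⟨_, ⟨dId.app D ≪≫ asIso ((dN ((adjTau G).unit)).app D) ≪≫
    ((dComp (evW G) (tau G)).app D).symm⟩⟩

lemma X_tau (N : DerivedCategory M) : IsZero ((dF (evX G)).obj ((dF (tau G)).obj N)) :=
  (dF_isZero (tau G ⋙ evX G) (fun _ => isZero_zero L) N).of_iso ((dComp _ _).app N)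
lemma W_u (N : DerivedCategory L) : IsZero ((dF (evW G)).obj ((dF (u G)).obj N)) :=
  (dF_isZero (u G ⋙ evW G) (fun _ => isZero_zero M) N).of_iso ((dComp _ _).app N)

lemma hom_tau_rho (N : DerivedCategory M) (X : DerivedCategory L)
    (f : (dF (tau G)).obj N ⟶ (dF (rho G)).obj X) : f = 0 := by
  have e := ((dAdj (adjRho G)).homEquiv ((dF (tau G)).obj N) X)
  apply e.symm.injective
  exact (X_tau G N).eq_of_src _ _

end DD
end S4

section S5
open CategoryTheory Category Limits Pretriangulated ZeroObject

universe v₁ v₂ v₃ v₄ u₁ u₂ u₃ u₄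

lemma tri_iso {T : Type u₂} [Category.{v₂} T] [HasZeroObject T] [HasShift T ℤ] [Preadditive T]
    [∀ n : ℤ, (shiftFunctor T n).Additive] [Pretriangulated T] {X Y Z X' Y' Z' : T}
    {f : X ⟶ Y} {g : Y ⟶ Z} {h : Z ⟶ X⟦(1 : ℤ)⟧} {f' : X' ⟶ Y'} {g' : Y' ⟶ Z'}
    {h' : Z' ⟶ X'⟦(1 : ℤ)⟧} (hT : Triangle.mk f g h ∈ distTriang T)
    (a : X' ≅ X) (b : Y' ≅ Y) (c : Z' ≅ Z) (h1 : f' ≫ b.hom = a.hom ≫ f)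
    (h2 : g' ≫ c.hom = b.hom ≫ g) (h3 : h' ≫ a.hom⟦(1 : ℤ)⟧' = c.hom ≫ h) :
    Triangle.mk f' g' h' ∈ distTriang T :=
  isomorphic_distinguished _ hT _ (Triangle.isoMk _ _ a b c h1 h2 h3)

lemma tri_transport {S : Type u₁} [Category.{v₁} S]
    {T : Type u₂} [Category.{v₂} T] [HasZeroObject T] [HasShift T ℤ] [Preadditive T]
    [∀ n : ℤ, (shiftFunctor T n).Additive] [Pretriangulated T]
    {F P R F' P' R' : S ⥤ T} (a : F ≅ F') (p : P' ≅ P) (q : R' ≅ R)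
    (ι : F' ⟶ P') (ψ : P' ⟶ R') (δ : R' ⟶ F' ⋙ shiftFunctor T (1 : ℤ))
    (h : ∀ E, Triangle.mk (ι.app E) (ψ.app E) (δ.app E) ∈ distTriang T) (E : S) :
    Triangle.mk ((a.hom ≫ ι ≫ p.hom).app E) ((p.inv ≫ ψ ≫ q.hom).app E)
      ((q.inv ≫ δ ≫ Functor.whiskerRight a.inv (shiftFunctor T (1 : ℤ))).app E) ∈ distTriang T := by
  refine tri_iso (h E) (a.app E) (p.symm.app E) (q.symm.app E) ?_ ?_ ?_
  · simp
  · simp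
  · simp [← Functor.map_comp]

variable {C : Type u₁} [Category.{v₁} C] [Abelian C] {D : Type u₂} [Category.{v₂} D] [Abelian D]

lemma dN_map_isIso {B : Type u₃} [Category.{v₃} B] [Abelian B] {P R : C ⥤ D} [ExF P] [ExF R]
    (θ : P ⟶ R) (H₂ : D ⥤ B) [ExF H₂] (h : ∀ X, IsIso (H₂.map (θ.app X)))
    (X : DerivedCategory C) : IsIso ((dF H₂).map ((dN θ).app X)) := by
  have := dN_mid_isIso (𝟭 C) θ H₂ h X
  change IsIso ((Functor.whiskerRight (dN θ) (dF H₂)).app X)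
  exact (NatTrans.isIso_app_iff_of_iso _ (dId.app X)).2 this

/-- the arrow object functor -/
@[simps] def arrF {P R : C ⥤ D} (θ : P ⟶ R) : C ⥤ DD.Ob (𝟭 D) where
  obj E := ⟨P.obj E, R.obj E, θ.app E⟩
  map f := { left := P.map f, right := R.map f, w := θ.naturality f }

instance {P R : C ⥤ D} [h1 : ExF P] [h2 : ExF R] (θ : P ⟶ R) : ExF (arrF θ) :=
  CommaAb.exF _ h1 h2

lemma exists_cocone : ∃ (G : DerivedCategory (DD.Ob (𝟭 D)) ⥤ DerivedCategory D)
    (_ : G.CommShift ℤ) (_ : G.IsTriangulated) (ε : G ⋙ dF (DD.tau (𝟭 D)) ⟶ 𝟭 _)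
    (δ : dF (DD.evX (𝟭 D) ⋙ DD.rho (𝟭 D)) ⟶ (G ⋙ dF (DD.tau (𝟭 D))) ⋙ shiftFunctor _ (1 : ℤ)),
    ∀ E, Triangle.mk (ε.app E) ((dId.hom ≫ dN (DD.adjRho (𝟭 D)).unit).app E) (δ.app E) ∈
      distTriang _ := by
  apply bousfield
  · intro N E f
    have := DD.hom_tau_rho (𝟭 D) N ((dF (DD.evX (𝟭 D))).obj E)
      (f ≫ (dComp (DD.evX (𝟭 D)) (DD.rho (𝟭 D))).inv.app E)
    rwa [Preadditive.IsIso.comp_right_eq_zero] at this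
  · intro E
    obtain ⟨Z, f, h, hT⟩ := distinguished_cocone_triangle₁
      ((dId.hom ≫ dN (DD.adjRho (𝟭 D)).unit).app E)
    have hT' := (dF (DD.evX (𝟭 D))).map_distinguished _ hT
    have hi : IsIso ((dF (DD.evX (𝟭 D))).map ((dId.hom ≫ dN (DD.adjRho (𝟭 D)).unit).app E)) := by
      rw [NatTrans.comp_app, Functor.map_comp]
      have := dN_map_isIso (DD.adjRho (𝟭 D)).unit (DD.evX (𝟭 D))
        (fun X => by change IsIso (𝟙 _); infer_instance) E
      infer_instance
    have hz : IsZero ((dF (DD.evX (𝟭 D))).obj Z) := (Triangle.isZero₁_iff_isIso₂ _ hT').2 hi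
    obtain ⟨Y, ⟨e⟩⟩ := DD.iso_tau (𝟭 D) Z hz
    refine ⟨Y, e.inv ≫ f, h ≫ (e.hom)⟦(1 : ℤ)⟧', ?_⟩
    refine tri_iso hT e.symm (Iso.refl _) (Iso.refl _) ?_ ?_ ?_
    · exact comp_id _
    · exact (comp_id _).trans (id_comp _).symm
    · rw [Iso.symm_hom, assoc, ← Functor.map_comp, Iso.hom_inv_id,
        CategoryTheory.Functor.map_id, comp_id]
      exact (id_comp _).symm

lemma exists_fib {A : Type u₃} [Category.{v₃} A] [Abelian A] {B : Type u₄} [Category.{v₄} B]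
    [Abelian B] {P R : C ⥤ D} [ExF P] [ExF R] (θ : P ⟶ R) (H₁ : A ⥤ C) (H₂ : D ⥤ B) [ExF H₁]
    [ExF H₂] (hH : ∀ X, IsIso (H₂.map (θ.app (H₁.obj X)))) :
    ∃ (F : DerivedCategory C ⥤ DerivedCategory D) (_ : F.CommShift ℤ) (_ : F.IsTriangulated)
      (ι : F ⟶ dF P) (ψ : dF P ⟶ dF R) (δ : dF R ⟶ F ⋙ shiftFunctor _ (1 : ℤ)),
      (∀ E, Triangle.mk (ι.app E) (ψ.app E) (δ.app E) ∈ distTriang _) ∧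
      ∀ X, IsIso ((dF H₂).map (ψ.app ((dF H₁).obj X))) := by
  obtain ⟨G, hG1, hG2, ε, δ, h⟩ := exists_cocone (D := D)
  let W := DD.evW (𝟭 D)
  let I := arrF θ
  let V := DD.evX (𝟭 D) ⋙ DD.rho (𝟭 D)
  let ζ := dId.hom ≫ dN (DD.adjRho (𝟭 D)).unit
  have hc : ∀ X, IsIso ((dAdj (DD.adjTau (𝟭 D))).counit.app X) :=
    dAdj_counit_isIso _ (DD.adjTau_counit _)
  have hc' := NatIso.isIso_of_isIso_app (dAdj (DD.adjTau (𝟭 D))).counit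
  let a : dF I ⋙ G ≅ dF I ⋙ (G ⋙ dF (DD.tau (𝟭 D))) ⋙ dF W :=
    Functor.isoWhiskerLeft (dF I) (Functor.isoWhiskerLeft G
      (asIso (dAdj (DD.adjTau (𝟭 D))).counit).symm)
  let p : dF I ⋙ dF W ≅ dF P := dComp I W
  let q : dF I ⋙ dF V ⋙ dF W ≅ dF R :=
    Functor.isoWhiskerLeft (dF I) (dComp V W) ≪≫ dComp I (V ⋙ W)
  let ι' : dF I ⋙ (G ⋙ dF (DD.tau (𝟭 D))) ⋙ dF W ⟶ dF I ⋙ dF W :=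
    { app := fun E => (dF W).map (ε.app ((dF I).obj E))
      naturality := fun X Y f => by
        have := ε.naturality ((dF I).map f)
        exact ((dF W).map_comp _ _).symm.trans ((congrArg (dF W).map this).trans
          ((dF W).map_comp _ _)) }
  let ψ' : dF I ⋙ dF W ⟶ dF I ⋙ dF V ⋙ dF W :=
    { app := fun E => (dF W).map (ζ.app ((dF I).obj E))
      naturality := fun X Y f => by
        have := ζ.naturality ((dF I).map f)
        exact ((dF W).map_comp _ _).symm.trans ((congrArg (dF W).map this).trans
          ((dF W).map_comp _ _)) }
  let δ' : dF I ⋙ dF V ⋙ dF W ⟶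
      (dF I ⋙ (G ⋙ dF (DD.tau (𝟭 D))) ⋙ dF W) ⋙ shiftFunctor _ (1 : ℤ) :=
    { app := fun E => (dF W).map (δ.app ((dF I).obj E)) ≫
        ((dF W).commShiftIso (1 : ℤ)).hom.app _
      naturality := fun X Y f => by
        have h1 := δ.naturality ((dF I).map f)
        have h2 := ((dF W).commShiftIso (1 : ℤ)).hom.naturality
          ((dF (DD.tau (𝟭 D))).map (G.map ((dF I).map f)))
        have h3 := ((dF W).map_comp _ _).symm.trans ((congrArg (dF W).map h1).trans
          ((dF W).map_comp _ _))
        refine (assoc _ _ _).symm.trans ((congrArg (· ≫ _) h3).trans ?_)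
        refine (assoc _ _ _).trans ((congrArg (_ ≫ ·) h2).trans (assoc _ _ _).symm) }
  refine ⟨dF I ⋙ G, inferInstance, inferInstance, a.hom ≫ ι' ≫ p.hom, p.inv ≫ ψ' ≫ q.hom,
    q.inv ≫ δ' ≫ Functor.whiskerRight a.inv (shiftFunctor _ (1 : ℤ)), ?_, ?_⟩
  · refine tri_transport a p q ι' ψ' δ' (fun E => ?_)
    exact (dF W).map_distinguished _ (h ((dF I).obj E))
  · intro X
    rw [NatTrans.comp_app, NatTrans.comp_app, Functor.map_comp, Functor.map_comp]
    have key : IsIso ((dF H₂).map (ψ'.app ((dF H₁).obj X))) := by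
      change IsIso ((dF H₂).map ((dF W).map (dId.hom.app _ ≫
        (dN (DD.adjRho (𝟭 D)).unit).app ((dF I).obj ((dF H₁).obj X)))))
      rw [Functor.map_comp, Functor.map_comp]
      have : IsIso ((dF H₂).map ((dF W).map ((dN (DD.adjRho (𝟭 D)).unit).app
          ((dF I).obj ((dF H₁).obj X))))) := by
        have h1 := dN_mid_isIso (H₁ ⋙ I) (DD.adjRho (𝟭 D)).unit (W ⋙ H₂) hH X
        have h2 : IsIso ((dF (W ⋙ H₂)).map ((dN (DD.adjRho (𝟭 D)).unit).app
          ((dF I).obj ((dF H₁).obj X)))) :=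
          (NatTrans.isIso_app_iff_of_iso (Functor.whiskerRight (dN (DD.adjRho (𝟭 D)).unit)
            (dF (W ⋙ H₂))) ((dComp H₁ I).app X)).2 h1
        exact (NatIso.isIso_map_iff (dComp W H₂) _).2 h2
      infer_instance
    infer_instance

end S5

section S6
open CategoryTheory Category Limits Pretriangulated ZeroObject

universe v₁ v₂ v₃ v₄ u₁ u₂ u₃ u₄

/-- The functor `F` is bijective on morphisms out of `A`. -/
def Good {S : Type u₁} [Category.{v₁} S] {T : Type u₂} [Category.{v₂} T] (F : S ⥤ T) (A : S) :
    Prop := ∀ E, Function.Bijective (fun f : A ⟶ E => F.map f)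

section basic
variable {S : Type u₁} [Category.{v₁} S] {T : Type u₂} [Category.{v₂} T]

lemma bij_congr {α β : Type*} {f g : α → β} (h : Function.Bijective f) (hg : ∀ x, g x = f x) :
    Function.Bijective g := by
  rw [show g = f from funext hg]; exact h

lemma bij_pre {A B E : T} (e : A ≅ B) : Function.Bijective (fun f : B ⟶ E => e.hom ≫ f) :=
  ⟨fun f g h => by simpa using h, fun f => ⟨e.inv ≫ f, by simp⟩⟩
lemma bij_post {A B E : T} (e : A ≅ B) : Function.Bijective (fun f : E ⟶ A => f ≫ e.hom) :=
  ⟨fun f g h => by simpa using h, fun f => ⟨f ≫ e.inv, by simp⟩⟩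

lemma Good.of_iso {F : S ⥤ T} {A B : S} (e : A ≅ B) (h : Good F A) : Good F B := by
  intro E
  have h1 := (bij_pre (E := F.obj E) (F.mapIso e)).of_comp_iff' (fun f : B ⟶ E => F.map f)
  rw [← h1]
  have h2 := (h E).comp (bij_pre (E := E) e)
  convert h2 using 1
  funext f
  simp

lemma Good.of_natIso {F G : S ⥤ T} (α : F ≅ G) {A : S} (h : Good F A) : Good G A := by
  intro E
  have h2 : (fun f : A ⟶ E => G.map f) =
      (fun f => (α.app A).symm.hom ≫ f) ∘ (fun f => f ≫ (α.app E).hom) ∘ (fun f => F.map f) := by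
    funext f
    simp
  rw [h2]
  exact (bij_pre _).comp ((bij_post _).comp (h E))

lemma Good.of_comp {U : Type u₃} [Category.{v₃} U] {F : S ⥤ T} {G : T ⥤ U} {A : S}
    (h : Good (F ⋙ G) A) (h' : Good G (F.obj A)) : Good F A := by
  intro E
  rw [← (h' (F.obj E)).of_comp_iff' (fun f : A ⟶ E => F.map f)]
  exact h E

lemma Good.comp {U : Type u₃} [Category.{v₃} U] {F : S ⥤ T} {G : T ⥤ U} {A : S}
    (h : Good F A) (h' : Good G (F.obj A)) : Good (F ⋙ G) A := by
  intro E
  exact (h' (F.obj E)).comp (h E)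

lemma good_of_ff (F : S ⥤ T) [F.Full] [F.Faithful] (A : S) : Good F A :=
  fun _ => ⟨F.map_injective, F.map_surjective⟩

lemma good_of_adj {L : S ⥤ T} {R : T ⥤ S} (adj : L ⊣ R) (a : S) (h : IsIso (adj.unit.app a)) :
    Good R (L.obj a) := by
  intro E
  rw [← (bij_pre (E := R.obj E) (asIso (adj.unit.app a))).of_comp_iff'
    (fun f : L.obj a ⟶ E => R.map f)]
  refine bij_congr (adj.homEquiv a E).bijective (fun f => ?_)
  rw [adj.homEquiv_unit]
  rfl
end basic

section tri
variable {S : Type u₁} [Category.{v₁} S] [HasZeroObject S] [HasShift S ℤ] [Preadditive S]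
    [∀ n : ℤ, (shiftFunctor S n).Additive] [Pretriangulated S]
  {T : Type u₂} [Category.{v₂} T] [HasZeroObject T] [HasShift T ℤ] [Preadditive T]
    [∀ n : ℤ, (shiftFunctor T n).Additive] [Pretriangulated T]
  (F : S ⥤ T) [F.CommShift ℤ] [F.IsTriangulated]

variable {F}
lemma Good.shift {A : S} (h : Good F A) : Good F (A⟦(1 : ℤ)⟧) := by
  intro E
  let E' := E⟦(-1 : ℤ)⟧
  let e : E'⟦(1 : ℤ)⟧ ≅ E := (shiftFunctorCompIsoId S (-1 : ℤ) 1 (by simp)).app _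
  have hk : Function.Bijective (fun x : A ⟶ E' => x⟦(1 : ℤ)⟧' ≫ e.hom) :=
    (bij_post e).comp (good_of_ff (shiftFunctor S (1 : ℤ)) A E')
  rw [← Function.Bijective.of_comp_iff _ hk]
  let c : ∀ X, F.obj (X⟦(1 : ℤ)⟧) ≅ (F.obj X)⟦(1 : ℤ)⟧ := fun X => (F.commShiftIso (1 : ℤ)).app X
  have nat : ∀ {X Y : S} (f : X ⟶ Y), F.map (f⟦(1 : ℤ)⟧') ≫ (c Y).hom =
    (c X).hom ≫ (F.map f)⟦(1 : ℤ)⟧' := fun f => (F.commShiftIso (1 : ℤ)).hom.naturality f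
  have h2 := (bij_pre (c A)).comp ((bij_post ((c E').symm ≪≫ F.mapIso e)).comp
      ((good_of_ff (shiftFunctor T (1 : ℤ)) (F.obj A) (F.obj E')).comp (h E')))
  refine bij_congr h2 (fun f => ?_)
  have := nat f
  simp only [Function.comp_apply, Functor.map_comp, Iso.trans_hom, Iso.symm_hom,
    Functor.mapIso_hom]
  rw [← assoc, ← assoc, ← this]
  simp

lemma Good.cone (Tr : Triangle S) (hT : Tr ∈ distTriang S) (h1 : Good F Tr.obj₁)
    (h2 : Good F Tr.obj₂) : Good F Tr.obj₃ := by
  have h1' := h1.shift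
  have h2' := h2.shift
  have hR := rot_of_distTriang _ hT
  have hR2 := rot_of_distTriang _ hR
  have m1 := F.map_distinguished _ hT
  have m2 := F.map_distinguished _ hR
  have m3 := F.map_distinguished _ hR2
  intro E
  constructor
  · intro f f' hf
    have hf0 : F.map (f - f') = 0 := by
      rw [Functor.map_sub, sub_eq_zero]; exact hf
    rw [← sub_eq_zero]
    set d := f - f' with hd
    have e1 : Tr.mor₂ ≫ d = 0 := by
      apply (h2 E).1
      change F.map _ = F.map _
      rw [Functor.map_comp, hf0, comp_zero, Functor.map_zero]
    obtain ⟨y, hy⟩ := Triangle.yoneda_exact₃ _ hT d e1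
    have e2 : F.map Tr.mor₃ ≫ F.map y = 0 := by rw [← Functor.map_comp, ← hy, hf0]
    obtain ⟨w, hw⟩ := Triangle.yoneda_exact₂ _ m3 (F.map y) e2
    obtain ⟨w', rfl⟩ := (h2' E).2 w
    have e3 : y = (-Tr.mor₁⟦(1 : ℤ)⟧') ≫ w' := by
      apply (h1' E).1
      refine hw.trans (F.map_comp _ _).symm
    rw [hy, e3, Preadditive.neg_comp, Preadditive.comp_neg, ← assoc,
      comp_distTriang_mor_zero₃₁ _ hT, zero_comp, neg_zero]
  · intro φ
    obtain ⟨b, hb⟩ := (h2 E).2 (F.map Tr.mor₂ ≫ φ)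
    have e1 : Tr.mor₁ ≫ b = 0 := by
      apply (h1 E).1
      change F.map _ = F.map _
      change F.map b = _ at hb
      rw [Functor.map_comp, hb, ← assoc, ← Functor.map_comp, comp_distTriang_mor_zero₁₂ _ hT,
        Functor.map_zero, zero_comp, Functor.map_zero]
    obtain ⟨c, hc⟩ := Triangle.yoneda_exact₂ _ hT b e1
    have e2 : F.map Tr.mor₂ ≫ (φ - F.map c) = 0 := by
      rw [Preadditive.comp_sub, ← Functor.map_comp, ← hc, sub_eq_zero]; exact hb.symm
    obtain ⟨w, hw⟩ := Triangle.yoneda_exact₂ _ m2 (φ - F.map c) e2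
    obtain ⟨w', rfl⟩ := (h1' E).2 w
    refine ⟨c + Tr.mor₃ ≫ w', ?_⟩
    change F.map _ = _
    rw [Functor.map_add, Functor.map_comp, add_comm, ← eq_sub_iff_add_eq]
    exact hw.symm

lemma good_iff_shift {A : S} : Good F (A⟦(1 : ℤ)⟧) → Good F A := by
  intro h E
  have h0 := h (E⟦(1 : ℤ)⟧)
  have hs := good_of_ff (shiftFunctor S (1 : ℤ)) A E
  have ht := good_of_ff (shiftFunctor T (1 : ℤ)) (F.obj A) (F.obj E)
  rw [← ht.of_comp_iff' (fun f : A ⟶ E => F.map f)]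
  let c : ∀ X, F.obj (X⟦(1 : ℤ)⟧) ≅ (F.obj X)⟦(1 : ℤ)⟧ := fun X => (F.commShiftIso (1 : ℤ)).app X
  have nat : ∀ {X Y : S} (f : X ⟶ Y), F.map (f⟦(1 : ℤ)⟧') ≫ (c Y).hom =
    (c X).hom ≫ (F.map f)⟦(1 : ℤ)⟧' := fun f => (F.commShiftIso (1 : ℤ)).hom.naturality f
  have h2 := (bij_pre (c A).symm).comp ((bij_post (c E)).comp (h0.comp hs))
  refine bij_congr h2 (fun f => ?_)
  have := nat f
  simp [this]

lemma Good.mid (Tr : Triangle S) (hT : Tr ∈ distTriang S) (h1 : Good F Tr.obj₁)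
    (h2 : Good F Tr.obj₃) : Good F Tr.obj₂ := by
  apply good_iff_shift
  exact Good.cone _ (rot_of_distTriang _ (rot_of_distTriang _ hT)) h2 h1.shift

lemma essImage_mid [F.Full] (Tr : Triangle T) (hT : Tr ∈ distTriang T) (h1 : F.essImage Tr.obj₁)
    (h3 : F.essImage Tr.obj₃) : F.essImage Tr.obj₂ := by
  obtain ⟨a, ⟨ea⟩⟩ := h1
  obtain ⟨c, ⟨ec⟩⟩ := h3
  let ea' : F.obj (a⟦(1 : ℤ)⟧) ≅ Tr.obj₁⟦(1 : ℤ)⟧ :=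
    (F.commShiftIso (1 : ℤ)).app a ≪≫ (shiftFunctor T (1 : ℤ)).mapIso ea
  let h' : c ⟶ a⟦(1 : ℤ)⟧ := F.preimage (ec.hom ≫ Tr.mor₃ ≫ ea'.inv)
  obtain ⟨b, g, k, hb⟩ := distinguished_cocone_triangle h'
  have m1 := F.map_distinguished _ hb
  have m2 := rot_of_distTriang _ (rot_of_distTriang _ hT)
  let i := isoTriangleOfIso₁₂ _ _ m1 m2 ec ea' (by
    change F.map h' ≫ ea'.hom = ec.hom ≫ Tr.mor₃
    simp [h'])
  let j : F.obj b ≅ Tr.obj₂⟦(1 : ℤ)⟧ := Triangle.π₃.mapIso i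
  exact ⟨b⟦(-1 : ℤ)⟧, ⟨(F.commShiftIso (-1 : ℤ)).app b ≪≫ (shiftFunctor T (-1 : ℤ)).mapIso j ≪≫
    (shiftFunctorCompIsoId T (1 : ℤ) (-1) (by simp)).app _⟩⟩
end tri
end S6

section S7
open CategoryTheory Category Limits Pretriangulated ZeroObject

universe v₁ v₂ v₃ v₄ u₁ u₂ u₃ u₄

/-- Triangulated equivalence of derived categories. -/
def DEq (A : Type u₁) [Category.{v₁} A] [Abelian A] (B : Type u₂) [Category.{v₂} B]
    [Abelian B] : Prop :=
  ∃ (F : DerivedCategory A ⥤ DerivedCategory B) (c : F.CommShift ℤ), haveI := c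
    (F.IsTriangulated ∧ F.IsEquivalence)

section
variable {A : Type u₁} [Category.{v₁} A] [Abelian A] {B : Type u₂} [Category.{v₂} B]
    [Abelian B] {C : Type u₃} [Category.{v₃} C] [Abelian C]

variable (A) in
lemma DEq.refl : DEq A A := ⟨𝟭 _, inferInstance, inferInstance, inferInstance⟩

lemma DEq.trans (h : DEq A B) (h' : DEq B C) : DEq A C := by
  obtain ⟨F, c, h1, h2⟩ := h
  obtain ⟨F', c', h1', h2'⟩ := h'
  exact ⟨F ⋙ F', inferInstance, inferInstance, inferInstance⟩

lemma DEq.symm (h : DEq A B) : DEq B A := by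
  obtain ⟨F, c, h1, h2⟩ := h
  let adj := F.asEquivalence.toAdjunction
  letI : F.asEquivalence.functor.CommShift ℤ := c
  haveI : F.asEquivalence.functor.IsTriangulated := h1
  letI : F.asEquivalence.inverse.CommShift ℤ := adj.rightAdjointCommShift ℤ
  haveI : adj.CommShift ℤ := adj.commShift_of_leftAdjoint ℤ
  haveI : F.asEquivalence.inverse.IsTriangulated := adj.isTriangulated_rightAdjoint
  exact ⟨F.asEquivalence.inverse, inferInstance, inferInstance, inferInstance⟩

lemma DEq.of_equiv (e : A ≌ B) [he : e.functor.Additive] : DEq A B := by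
  haveI : ExF e.functor := ⟨inferInstance, inferInstance, inferInstance⟩
  haveI : ExF e.inverse := ⟨e.inverse_additive, inferInstance, inferInstance⟩
  have h1 : ∀ X, IsIso ((dAdj e.toAdjunction).unit.app X) := dAdj_unit_isIso _ (fun X => by
    change IsIso (e.unit.app X); infer_instance)
  have h2 : ∀ X, IsIso ((dAdj e.toAdjunction).counit.app X) := dAdj_counit_isIso _ (fun X => by
    change IsIso (e.counit.app X); infer_instance)
  haveI := NatIso.isIso_of_isIso_app (dAdj e.toAdjunction).unit
  haveI := NatIso.isIso_of_isIso_app (dAdj e.toAdjunction).counit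
  exact ⟨dF e.functor, inferInstance, inferInstance, 
    (dAdj e.toAdjunction).toEquivalence.isEquivalence_functor⟩
end

variable {L : Type u₁} [Category.{v₁} L] [Abelian L] {M : Type u₂} [Category.{v₂} M] [Abelian M]

namespace CC
variable (G : L ⥤ M) [ExF G]

/-- `GX → M`. -/
abbrev Ob := Comma G (𝟭 M)
/-- the vertex `X` -/
abbrev evL : Ob G ⥤ L := Comma.fst _ _
/-- the vertex `M` -/
abbrev evM : Ob G ⥤ M := Comma.snd _ _
/-- `GX = GX` -/
@[simps] def lam : L ⥤ Ob G where
  obj X := ⟨X, G.obj X, 𝟙 _⟩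
  map f := { left := f, right := G.map f }
/-- `0 → M` -/
@[simps] noncomputable def s : M ⥤ Ob G where
  obj W := ⟨0, W, 0⟩
  map f := { left := 0, right := f }
/-- `GX → 0` -/
@[simps] noncomputable def t : L ⥤ Ob G where
  obj X := ⟨X, 0, 0⟩
  map f := { left := f, right := 0 }

instance : ExF (lam G) := CommaAb.exF _ (inferInstanceAs (ExF (𝟭 L))) (inferInstanceAs (ExF G))
instance : ExF (s G) := CommaAb.exF _ (ExF.ofZero _ (fun _ => isZero_zero _))
  (inferInstanceAs (ExF (𝟭 M)))
instance : ExF (t G) := CommaAb.exF _ (inferInstanceAs (ExF (𝟭 L)))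
  (ExF.ofZero _ (fun _ => isZero_zero _))

/-- counit -/
@[simps] def epsLam (E : Ob G) : (lam G).obj E.left ⟶ E where
  left := 𝟙 _
  right := E.hom
  w := by
    change G.map (𝟙 _) ≫ E.hom = 𝟙 _ ≫ E.hom
    rw [CategoryTheory.Functor.map_id]

lemma isZero_G0 : IsZero (G.obj (0 : L)) := G.map_isZero (isZero_zero L)

/-- counit -/
@[simps] noncomputable def epsS (E : Ob G) : (s G).obj E.right ⟶ E where
  left := 0
  right := 𝟙 _
  w := (isZero_G0 G).eq_of_src _ _

/-- quotient -/
@[simps] noncomputable def etaT (E : Ob G) : E ⟶ (t G).obj E.left where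
  left := 𝟙 _
  right := 0
  w := (isZero_zero M).eq_of_tgt _ _

/-- adjunction -/
def adjLam : lam G ⊣ evL G where
  unit := { app := fun X => 𝟙 X, naturality := fun _ _ f => (comp_id f).trans (id_comp f).symm }
  counit := { app := epsLam G, naturality := fun X Y f => by
                ext
                · exact (comp_id f.left).trans (id_comp f.left).symm
                · exact f.w }
  left_triangle_components := fun E => by
    ext
    · exact comp_id _
    · change G.map (𝟙 E) ≫ 𝟙 _ = 𝟙 (G.obj E)
      rw [CategoryTheory.Functor.map_id, comp_id]
  right_triangle_components := fun E => comp_id (𝟙 E.left)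
/-- adjunction -/
noncomputable def adjS : s G ⊣ evM G where
  unit := { app := fun X => 𝟙 X, naturality := fun _ _ f => (comp_id f).trans (id_comp f).symm }
  counit := { app := epsS G, naturality := fun X Y f => by
                ext
                · exact (isZero_zero L).eq_of_src _ _
                · exact (comp_id f.right).trans (id_comp f.right).symm }
  left_triangle_components := fun E => by
    ext
    · exact (isZero_zero L).eq_of_src _ _
    · exact comp_id _
  right_triangle_components := fun E => comp_id (𝟙 E.right)

/-- quotient transformation -/
noncomputable def quoT : 𝟭 (Ob G) ⟶ evL G ⋙ t G where
  app := etaT G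
  naturality := fun X Y f => by
    ext
    · exact (comp_id f.left).trans (id_comp f.left).symm
    · exact (isZero_zero M).eq_of_tgt _ _

lemma tri (D : DerivedCategory (Ob G)) : ∃ δ, Triangle.mk
    ((dN ((adjS G).counit)).app D) ((dN (quoT G)).app D) δ ∈
      distTriang (DerivedCategory (Ob G)) := by
  refine dTri _ _ (fun X => ?_) (fun X => ?_) D
  · ext
    · exact (isZero_zero L).eq_of_src _ _
    · exact (isZero_zero M).eq_of_tgt _ _
  · apply CommaAb.shortExact_of
    · refine DD.se_left _ _ _ _ _ _ (isZero_zero L) ?_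
      change IsIso (𝟙 _); infer_instance
    · refine DD.se_right _ _ _ _ _ _ (isZero_zero M) ?_
      change IsIso (𝟙 _); infer_instance

/-- the basic transformation -/
noncomputable def theta : evL G ⋙ DD.rho G ⟶ evM G ⋙ DD.tau G where
  app := fun E => { left := E.hom, right := 0, w := by
                      change E.hom ≫ 0 = 𝟙 _ ≫ G.map 0
                      rw [Functor.map_zero, comp_zero, comp_zero] }
  naturality := fun X Y f => by
    ext
    · exact f.w
    · exact (isZero_zero L).eq_of_tgt _ _

lemma good_dev {T : Type u₃} [Category.{v₃} T] [HasZeroObject T] [HasShift T ℤ] [Preadditive T]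
    [∀ n : ℤ, (shiftFunctor T n).Additive] [Pretriangulated T]
    (F : DerivedCategory (Ob G) ⥤ T) [F.CommShift ℤ] [F.IsTriangulated]
    (h1 : ∀ X, Good F ((dF (lam G)).obj X)) (h2 : ∀ X, Good F ((dF (s G)).obj X)) (E) :
    Good F E := by
  have h3 : ∀ E, Good F ((dF (evM G ⋙ s G)).obj E) := fun E =>
    (h2 ((dF (evM G)).obj E)).of_iso ((dComp (evM G) (s G)).app E)
  have h4 : ∀ X, Good F ((dF (t G)).obj X) := by
    intro X
    obtain ⟨δ, hδ⟩ := tri G ((dF (lam G)).obj X)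
    have := Good.cone _ hδ (h3 _) ((h1 X).of_iso (dId.app _))
    refine this.of_iso ?_
    have hu : IsIso ((dAdj (adjLam G)).unit.app X) := dAdj_unit_isIso _ (fun X => by
      change IsIso (𝟙 X); infer_instance) X
    exact ((dComp (evL G) (t G)).app _).symm ≪≫
      (dF (t G)).mapIso (asIso ((dAdj (adjLam G)).unit.app X)).symm
  obtain ⟨δ, hδ⟩ := tri G E
  have := Good.mid _ hδ (h3 _) ((h4 ((dF (evL G)).obj E)).of_iso ((dComp (evL G) (t G)).app E))
  exact this.of_iso (dId.app E).symm

end CC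

open CC DD in
theorem thmT (G : L ⥤ M) [ExF G] : DEq (CC.Ob G) (DD.Ob G) := by
  obtain ⟨F, hF1, hF2, ι, ψ, δ, hT, hψ⟩ := exists_fib (theta G) (lam G) (evW G) (fun X => by
    change IsIso (𝟙 _); infer_instance)
  -- evX F ≅ evL
  have hXR : ∀ E, IsZero ((dF (evX G)).obj ((dF (evM G ⋙ tau G)).obj E)) := fun E =>
    (X_tau G _).of_iso ((dF (evX G)).mapIso ((dComp (evM G) (tau G)).app E).symm)
  have hι : ∀ E, IsIso ((dF (evX G)).map (ι.app E)) := fun E =>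
    (Triangle.isZero₃_iff_isIso₁ _ ((dF (evX G)).map_distinguished _ (hT E))).1 (hXR E)
  have hι' : ∀ E, IsIso ((Functor.whiskerRight ι (dF (evX G))).app E) := hι
  have := NatIso.isIso_of_isIso_app (Functor.whiskerRight ι (dF (evX G)))
  let α : F ⋙ dF (evX G) ≅ dF (evL G) := asIso (Functor.whiskerRight ι (dF (evX G))) ≪≫
    dComp (evL G ⋙ rho G) (evX G)
  have hlamu : ∀ X, IsIso ((dAdj (adjLam G)).unit.app X) := dAdj_unit_isIso _ (fun X => by
      change IsIso (𝟙 X); infer_instance)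
  have hsu : ∀ X, IsIso ((dAdj (adjS G)).unit.app X) := dAdj_unit_isIso _ (fun X => by
      change IsIso (𝟙 X); infer_instance)
  have huu : ∀ X, IsIso ((dAdj (adjU G)).unit.app X) := dAdj_unit_isIso _ (adjU_unit G)
  have hFl : ∀ X, IsZero ((dF (evW G)).obj (F.obj ((dF (lam G)).obj X))) := fun X =>
    (Triangle.isZero₁_iff_isIso₂ _ ((dF (evW G)).map_distinguished _ (hT _))).2 (hψ X)
  have good1 : ∀ X, Good F ((dF (lam G)).obj X) := by
    intro X
    have g1 : Good (dF (evL G)) ((dF (lam G)).obj X) := good_of_adj (dAdj (adjLam G)) X (hlamu X)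
    have g2 : Good (F ⋙ dF (evX G)) ((dF (lam G)).obj X) := g1.of_natIso α.symm
    refine g2.of_comp ?_
    obtain ⟨Y, ⟨e⟩⟩ := iso_u G _ (hFl X)
    exact (good_of_adj (dAdj (adjU G)) Y (huu Y)).of_iso e.symm
  have hPs : ∀ N, IsZero ((dF (evL G ⋙ rho G)).obj ((dF (s G)).obj N)) := fun N =>
    (dF_isZero (s G ⋙ evL G ⋙ rho G)
      (fun X => (rho G).map_isZero (isZero_zero L)) N).of_iso ((dComp _ _).app N)
  have hδ : ∀ N, IsIso (δ.app ((dF (s G)).obj N)) := fun N =>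
    (Triangle.isZero₂_iff_isIso₃ _ (hT _)).1 (hPs N)
  -- vanishing
  have van0 : ∀ N E (f : (dF (tau G)).obj N ⟶ (dF (evL G ⋙ rho G)).obj E), f = 0 := by
    intro N E f
    have := hom_tau_rho G N _ (f ≫ (dComp (evL G) (rho G)).inv.app E)
    rwa [Preadditive.IsIso.comp_right_eq_zero] at this
  let es : ∀ N, (dF (evM G ⋙ tau G)).obj ((dF (s G)).obj N) ≅ (dF (tau G)).obj N := fun N =>
    ((dComp (evM G) (tau G)).app _).symm ≪≫
      (dF (tau G)).mapIso (asIso ((dAdj (adjS G)).unit.app N)).symm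
  have van1 : ∀ N E (f : (dF (evM G ⋙ tau G)).obj ((dF (s G)).obj N) ⟶
      (dF (evL G ⋙ rho G)).obj E), f = 0 := by
    intro N E f
    have := van0 N E ((es N).inv ≫ f)
    rwa [Preadditive.IsIso.comp_left_eq_zero] at this
  have van2 : ∀ N E (f : (dF (evM G ⋙ tau G)).obj ((dF (s G)).obj N) ⟶
      ((dF (evL G ⋙ rho G)).obj E)⟦(1 : ℤ)⟧), f = 0 := by
    intro N E f
    have := van1 N _ (f ≫ ((dF (evL G ⋙ rho G)).commShiftIso (1 : ℤ)).inv.app E)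
    rwa [Preadditive.IsIso.comp_right_eq_zero] at this
  have good2 : ∀ N, Good F ((dF (s G)).obj N) := by
    intro N E
    set A := (dF (s G)).obj N with hA
    have gR : Good (dF (evM G ⋙ tau G)) A :=
      Good.of_natIso (dComp (evM G) (tau G))
        ((good_of_adj (dAdj (adjS G)) N (hsu N)).comp (good_of_ff (dF (tau G)) _))
    have hpost : Function.Bijective
        (fun f : (dF (evM G ⋙ tau G)).obj A ⟶ (dF (evM G ⋙ tau G)).obj E => f ≫ δ.app E) := by
      constructor
      · intro f g hfg
        rw [← sub_eq_zero]
        obtain ⟨y, hy⟩ := Triangle.coyoneda_exact₃ _ (hT E) (f - g) (by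
          change (f - g) ≫ δ.app E = 0
          rw [Preadditive.sub_comp, sub_eq_zero]; exact hfg)
        have y0 : y = 0 := van1 N E y
        rw [hy, y0]; exact zero_comp
      · intro f
        obtain ⟨y, hy⟩ := Triangle.coyoneda_exact₁ _ (hT E) f (van2 N E _)
        exact ⟨y, hy.symm⟩
    have hcomp := hpost.comp (gR E)
    have hsh := good_of_ff (shiftFunctor (DerivedCategory (DD.Ob G)) (1 : ℤ)) (F.obj A) (F.obj E)
    have hpre := bij_pre (E := (F.obj E)⟦(1 : ℤ)⟧) (@asIso _ _ _ _ (δ.app A) (hδ N))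
    have hpp := hpre.comp hsh
    rw [← hpp.of_comp_iff' (fun f : A ⟶ E => F.map f)]
    exact bij_congr hcomp (fun f => (δ.naturality f).symm)
  have good := good_dev G F good1 good2
  have : F.Full := ⟨fun {X Y} f => (good X Y).2 f⟩
  have : F.Faithful := ⟨fun {X Y} {f g} h => (good X Y).1 h⟩
  have hu : ∀ X, F.essImage ((dF (u G)).obj X) := by
    intro X
    obtain ⟨Y, ⟨e⟩⟩ := iso_u G _ (hFl X)
    let i1 : X ≅ Y := asIso ((dAdj (adjLam G)).unit.app X) ≪≫ (α.app _).symm ≪≫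
      (dF (evX G)).mapIso e ≪≫ (asIso ((dAdj (adjU G)).unit.app Y)).symm
    exact ⟨(dF (lam G)).obj X, ⟨e ≪≫ (dF (u G)).mapIso i1.symm⟩⟩
  have ht : ∀ X, F.essImage ((dF (tau G)).obj X) := by
    intro N
    have := hδ N
    exact ⟨((dF (s G)).obj N)⟦(1 : ℤ)⟧, ⟨(F.commShiftIso (1 : ℤ)).app _ ≪≫
      (asIso (δ.app ((dF (s G)).obj N))).symm ≪≫ es N⟩⟩
  have : F.EssSurj := ⟨fun D => by
    obtain ⟨d, hd⟩ := DD.tri G D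
    have h1 : F.essImage ((dF (evX G ⋙ u G)).obj D) :=
      (F.essImage.prop_iff_of_iso ((dComp (evX G) (u G)).app D)).1 (hu _)
    have h3 : F.essImage ((dF (evW G ⋙ tau G)).obj D) :=
      (F.essImage.prop_iff_of_iso ((dComp (evW G) (tau G)).app D)).1 (ht _)
    have h2 := essImage_mid _ hd h1 h3
    exact (F.essImage.prop_iff_of_iso (dId.app D)).2 h2⟩
  exact ⟨F, hF1, hF2, {}⟩

end S7

section S8
open CategoryTheory Category Limits

/-- Representations of a quiver without relations. -/
structure PreRep (k : Type) [Field k] (V : Type) (E : V → V → Prop) where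
  X : V → Type
  [acg : ∀ v, AddCommGroup (X v)]
  [mod : ∀ v, Module k (X v)]
  map : ∀ u v, E u v → X u →ₗ[k] X v

attribute [instance] PreRep.acg PreRep.mod

/-- `y` is obtained from `x` by moving along a path. -/
inductive PreRep.Reach {k : Type} [Field k] {V : Type} {E : V → V → Prop} (R : PreRep k V E)
    {u : V} (x : R.X u) : ∀ v, R.X v → Prop
  | refl : PreRep.Reach R x u x
  | step (v w : V) (y : R.X v) (h : E v w) : PreRep.Reach R x v y →
      PreRep.Reach R x w (R.map v w h y)

/-- Representations of a quiver with zero relations `Z`. -/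
structure QRep (k : Type) [Field k] (V : Type) (E Z : V → V → Prop) extends PreRep k V E where
  rel : ∀ u v, Z u v → ∀ (x : X u) (y : X v), toPreRep.Reach x v y → y = 0

namespace QRep
variable {k : Type} [Field k] {V : Type} {E Z : V → V → Prop}

/-- Morphisms. -/
@[ext] structure RHom (R S : QRep k V E Z) where
  app : ∀ v, R.X v →ₗ[k] S.X v
  comm : ∀ u v h x, app v (R.map u v h x) = S.map u v h (app u x)

instance : Category (QRep k V E Z) where
  Hom R S := RHom R S
  id R := ⟨fun _ => LinearMap.id, fun _ _ _ _ => rfl⟩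
  comp f g := ⟨fun v => (g.app v).comp (f.app v), fun u v h x => by
    simp [f.comm, g.comm]⟩

@[ext] lemma hom_ext {R S : QRep k V E Z} {f g : R ⟶ S} (h : ∀ v x, f.app v x = g.app v x) :
    f = g := by
  apply RHom.ext
  funext v
  ext x
  exact h v x

@[simp] lemma id_app (R : QRep k V E Z) (v) (x) : RHom.app (𝟙 R) v x = x := rfl
@[simp] lemma comp_app {R S T : QRep k V E Z} (f : R ⟶ S) (g : S ⟶ T) (v) (x) :
    RHom.app (f ≫ g) v x = g.app v (f.app v x) := rfl

variable {R S : QRep k V E Z}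

lemma reach_app (f : R ⟶ S) {u v : V} {x : R.X u} {y : R.X v} (h : R.Reach x v y) :
    S.Reach (f.app u x) v (f.app v y) := by
  induction h with
  | refl => exact .refl
  | step v w y h _ ih => rw [f.comm]; exact .step _ _ _ _ ih

instance : Zero (RHom R S) := ⟨⟨fun _ => 0, by intros; simp⟩⟩
instance : Add (RHom R S) := ⟨fun f g => ⟨fun v => f.app v + g.app v, by
  intros; simp [f.comm, g.comm]⟩⟩
instance : Neg (RHom R S) := ⟨fun f => ⟨fun v => -f.app v, by intros; simp [f.comm]⟩⟩
instance : Sub (RHom R S) := ⟨fun f g => ⟨fun v => f.app v - g.app v, by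
  intros; simp [f.comm, g.comm]⟩⟩
instance : SMul ℕ (RHom R S) := ⟨fun n f => ⟨fun v => n • f.app v, by intros; simp [f.comm]⟩⟩
instance : SMul ℤ (RHom R S) := ⟨fun n f => ⟨fun v => n • f.app v, by intros; simp [f.comm]⟩⟩

lemma app_inj : Function.Injective (RHom.app : RHom R S → _) := fun _ _ h => RHom.ext h

instance : AddCommGroup (RHom R S) :=
  app_inj.addCommGroup _ rfl (fun _ _ => rfl) (fun _ => rfl) (fun _ _ => rfl) (fun _ _ => rfl)
    (fun _ _ => rfl)

instance : AddCommGroup (R ⟶ S) := inferInstanceAs (AddCommGroup (RHom R S))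

@[simp] lemma add_app (f g : R ⟶ S) (v) (x) : RHom.app (f + g) v x = f.app v x + g.app v x := rfl
@[simp] lemma zero_app (v) (x) : RHom.app (0 : R ⟶ S) v x = 0 := rfl

instance : Preadditive (QRep k V E Z) where
  add_comp := by intros; ext v x; simp
  comp_add := by intros; ext v x; simp

/-- evaluation -/
@[simps] def ev (v : V) : QRep k V E Z ⥤ ModuleCat.{0} k where
  obj R := ModuleCat.of k (R.X v)
  map f := ModuleCat.ofHom (f.app v)

instance (v : V) : (ev (k := k) (E := E) (Z := Z) v).Additive := ⟨rfl⟩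

lemma isIso_of_bij (f : R ⟶ S) (h : ∀ v, Function.Bijective (f.app v)) : IsIso f := by
  let e : ∀ v, R.X v ≃ₗ[k] S.X v := fun v => LinearEquiv.ofBijective (f.app v) (h v)
  refine ⟨⟨fun v => ((e v).symm : S.X v →ₗ[k] R.X v), fun u v hh x => ?_⟩, ?_, ?_⟩
  · apply (h v).1
    rw [f.comm]
    have h1 : ∀ w y, f.app w ((e w).symm y) = y := fun w y => (e w).apply_symm_apply y
    erw [h1, h1]
  · ext v x; exact (e v).symm_apply_apply x
  · ext v x; exact (e v).apply_symm_apply x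

/-- build isomorphisms -/
def mkIso (e : ∀ v, R.X v ≃ₗ[k] S.X v) (h : ∀ u v hh x, e v (R.map u v hh x) =
    S.map u v hh (e u x)) : R ≅ S where
  hom := ⟨fun v => e v, h⟩
  inv := ⟨fun v => (e v).symm, fun u v hh x => by
    apply (e v).injective
    change e v ((e v).symm _) = e v (R.map u v hh ((e u).symm x))
    rw [h, LinearEquiv.apply_symm_apply, LinearEquiv.apply_symm_apply]⟩
  hom_inv_id := by ext v x; exact (e v).symm_apply_apply x
  inv_hom_id := by ext v x; exact (e v).apply_symm_apply x

/-- the kernel -/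
def kerP (f : R ⟶ S) : PreRep k V E where
  X v := LinearMap.ker (f.app v)
  map u v h := (R.map u v h).restrict (fun x hx => by
    rw [LinearMap.mem_ker, f.comm, LinearMap.mem_ker.1 hx, map_zero])

/-- the kernel -/
def ker (f : R ⟶ S) : QRep k V E Z where
  toPreRep := kerP f
  rel u v h x y hxy := by
    have : ∀ w (y : (kerP f).X w), (kerP f).Reach x w y →
        R.Reach (Subtype.val x : R.X u) w (Subtype.val y : R.X w) := by
      intro w y hy
      induction hy with
      | refl => exact .refl
      | step v w y h _ ih => exact .step _ _ _ _ ih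
    exact Subtype.ext (R.rel u v h _ _ (this _ _ hxy))

/-- kernel inclusion -/
def kerι (f : R ⟶ S) : ker f ⟶ R := ⟨fun v => (LinearMap.ker (f.app v)).subtype,
  fun _ _ _ _ => rfl⟩

/-- the kernel is a kernel -/
def kerLim (f : R ⟶ S) : IsLimit (KernelFork.ofι (kerι f) (by
    ext v x; exact x.2) : KernelFork f) :=
  KernelFork.IsLimit.ofι _ _
    (fun {T} g hg => ⟨fun v => (g.app v).codRestrict _ (fun x => by
        exact congrArg (fun (z : T ⟶ S) => z.app v x) hg), fun u v h x => by
        apply Subtype.ext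
        exact g.comm u v h x⟩)
    (fun g hg => rfl) (fun g hg m hm => by
      ext v x
      apply Subtype.ext
      exact congrArg (fun z => RHom.app z v x) hm)

/-- the cokernel -/
def cokerP (f : R ⟶ S) : PreRep k V E where
  X v := S.X v ⧸ LinearMap.range (f.app v)
  map u v h := Submodule.mapQ _ _ (S.map u v h) (by
    rintro _ ⟨x, rfl⟩
    exact ⟨R.map u v h x, f.comm u v h x⟩)

/-- the cokernel -/
def coker (f : R ⟶ S) : QRep k V E Z where
  toPreRep := cokerP f
  rel u v h x y hxy := by
    obtain ⟨x', rfl⟩ := Submodule.mkQ_surjective _ x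
    have : ∀ w (y : (cokerP f).X w), (cokerP f).Reach (Submodule.mkQ _ x') w y →
        ∃ y', y = Submodule.mkQ (LinearMap.range (f.app w)) y' ∧ S.Reach x' w y' := by
      intro w y hy
      induction hy with
      | refl => exact ⟨x', rfl, .refl⟩
      | step v w y h _ ih =>
        obtain ⟨y', rfl, hy'⟩ := ih
        exact ⟨_, rfl, .step _ _ _ h hy'⟩
    obtain ⟨y', rfl, hy'⟩ := this _ _ hxy
    rw [S.rel u v h _ _ hy']
    exact map_zero _

/-- projection -/
def cokerπ (f : R ⟶ S) : S ⟶ coker f := ⟨fun v => (LinearMap.range (f.app v)).mkQ,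
  fun _ _ _ _ => rfl⟩

/-- the cokernel is a cokernel -/
def cokerColim (f : R ⟶ S) : IsColimit (CokernelCofork.ofπ (cokerπ f) (by
    ext v x
    exact (Submodule.Quotient.mk_eq_zero _).2 ⟨x, rfl⟩) : CokernelCofork f) :=
  CokernelCofork.IsColimit.ofπ _ _
    (fun {T} g hg => ⟨fun v => Submodule.liftQ _ (g.app v) (by
        rintro _ ⟨x, rfl⟩
        exact congrArg (fun (z : R ⟶ T) => z.app v x) hg), fun u v h x => by
        obtain ⟨x, rfl⟩ := Submodule.mkQ_surjective _ x
        exact g.comm u v h x⟩)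
    (fun g hg => rfl) (fun g hg m hm => by
      ext v x
      obtain ⟨x, rfl⟩ := Submodule.mkQ_surjective _ x
      exact congrArg (fun z => RHom.app z v x) hm)

/-- products -/
def prodP {J : Type} (f : J → QRep k V E Z) : PreRep k V E where
  X v := ∀ j, (f j).X v
  map u v h := LinearMap.pi (fun j => ((f j).map u v h).comp (LinearMap.proj j))

/-- products -/
def prod {J : Type} (f : J → QRep k V E Z) : QRep k V E Z where
  toPreRep := prodP f
  rel u v h x y hxy := by
    funext j
    have : ∀ w (y : (prodP f).X w), (prodP f).Reach x w y → (f j).Reach (x j) w (y j) := by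
      intro w y hy
      induction hy with
      | refl => exact .refl
      | step v w y h _ ih => exact .step _ _ _ _ ih
    exact (f j).rel u v h _ _ (this _ _ hxy)

instance : HasKernels (QRep k V E Z) := ⟨fun f => ⟨⟨_, kerLim f⟩⟩⟩
instance : HasCokernels (QRep k V E Z) := ⟨fun f => ⟨⟨_, cokerColim f⟩⟩⟩
instance : HasFiniteProducts (QRep k V E Z) where
  out n := ⟨fun F => by
    have : HasProduct (fun j : Fin n => F.obj ⟨j⟩) := by
      refine ⟨⟨Fan.mk (prod (fun j => F.obj ⟨j⟩))
        (fun j => ⟨fun v => LinearMap.proj j, fun _ _ _ _ => rfl⟩), ?_⟩⟩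
      refine mkFanLimit _ (fun s => ⟨fun v => LinearMap.pi (fun j => RHom.app (s.proj j) v),
        fun u v h x => ?_⟩) (fun s j => rfl) (fun s m hm => ?_)
      · funext j; exact RHom.comm (s.proj j) u v h x
      · ext v x
        funext j
        exact congrArg (fun z => RHom.app z v x) (hm j)
    have h2 : HasLimit (Discrete.functor (F.obj ∘ Discrete.mk)) := this
    exact hasLimit_of_iso Discrete.natIsoFunctor.symm⟩
instance : HasBinaryBiproducts (QRep k V E Z) :=
  HasBinaryBiproducts.of_hasBinaryProducts

instance (v : V) : PreservesLimitsOfShape WalkingParallelPair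
    (ev (k := k) (E := E) (Z := Z) v) := by
  have : ∀ {R S : QRep k V E Z} (f : R ⟶ S), PreservesLimit (parallelPair f 0)
      (ev (k := k) (E := E) (Z := Z) v) := by
    intro R S f
    refine preservesLimit_of_preserves_limit_cone (kerLim f) ?_
    refine (KernelFork.isLimitMapConeEquiv _ _).symm ?_
    exact ModuleCat.kernelIsLimit (ModuleCat.ofHom (f.app v))
  exact Functor.preservesEqualizers_of_preservesKernels _

instance (v : V) : PreservesColimitsOfShape WalkingParallelPair
    (ev (k := k) (E := E) (Z := Z) v) := by
  have : ∀ {R S : QRep k V E Z} (f : R ⟶ S), PreservesColimit (parallelPair f 0)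
      (ev (k := k) (E := E) (Z := Z) v) := by
    intro R S f
    refine preservesColimit_of_preserves_colimit_cocone (cokerColim f) ?_
    refine (CokernelCofork.isColimitMapCoconeEquiv _ _).symm ?_
    exact ModuleCat.cokernelIsColimit (ModuleCat.ofHom (f.app v))
  exact Functor.preservesCoequalizers_of_preservesCokernels _

noncomputable instance : Abelian (QRep k V E Z) :=
  abelianOfJointly (ev (k := k) (E := E) (Z := Z)) (fun f h => isIso_of_bij f (fun v => by
    have := h v
    exact (ConcreteCategory.isIso_iff_bijective _).1 this))

instance (v : V) : ExF (ev (k := k) (E := E) (Z := Z) v) where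
  add := inferInstance
  lim := Functor.preservesFiniteLimits_of_preservesKernels _
  colim := Functor.preservesFiniteColimits_of_preservesCokernels _

end QRep
end S8

section S9
open CategoryTheory Category Limits

namespace QRep
variable {k : Type} [Field k] {V : Type} {E Z : V → V → Prop}

lemma isZero_of (R : QRep k V E Z) (h : ∀ v, Subsingleton (R.X v)) : IsZero R := by
  rw [IsZero.iff_id_eq_zero]
  ext v x
  exact (h v).elim _ _

lemma shortExact_of (S : ShortComplex (QRep k V E Z))
    (hi : ∀ v, Function.Injective (RHom.app S.f v))
    (hs : ∀ v, Function.Surjective (RHom.app S.g v))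
    (he : ∀ v x, RHom.app S.g v x = 0 → ∃ y, RHom.app S.f v y = x) : S.ShortExact where
  exact := by
    rw [ShortComplex.exact_iff_isZero_homology]
    apply isZero_of
    intro v
    have h1 : (S.map (ev v)).Exact := by
      rw [ShortComplex.moduleCat_exact_iff]
      intro x hx
      exact he v x hx
    have := ((ShortComplex.exact_iff_isZero_homology _).1 h1).of_iso (S.mapHomologyIso (ev v)).symm
    exact ModuleCat.subsingleton_of_isZero this
  mono_f := ⟨fun {T} g h e => by
    ext v x
    apply hi v
    exact congrArg (fun z => RHom.app z v x) e⟩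
  epi_g := ⟨fun {T} g h e => by
    ext v x
    obtain ⟨x, rfl⟩ := hs v x
    exact congrArg (fun z => RHom.app z v x) e⟩

lemma shortExact_elim (S : ShortComplex (QRep k V E Z)) (h : S.ShortExact) (v : V) :
    Function.Injective (RHom.app S.f v) ∧ Function.Surjective (RHom.app S.g v) ∧
    ∀ x, RHom.app S.g v x = 0 → ∃ y, RHom.app S.f v y = x := by
  have h1 : (S.map (ev v)).ShortExact := h.map_of_exact (ev v)
  refine ⟨h1.moduleCat_injective_f, h1.moduleCat_surjective_g, ?_⟩
  have := h1.exact
  rw [ShortComplex.moduleCat_exact_iff] at this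
  exact this

lemma exF_of {V' : Type} {E' Z' : V' → V' → Prop} (G : QRep k V E Z ⥤ QRep k V' E' Z')
    [G.Additive] (h : ∀ S : ShortComplex (QRep k V E Z), S.ShortExact → (S.map G).ShortExact) :
    ExF G := by
  have := (Functor.exact_tfae G).out 0 3
  obtain ⟨h1, h2⟩ := this.1 h
  exact ⟨inferInstance, h1, h2⟩

end QRep

/-- edges of the glued quiver -/
def cE {VL VM : Type} (EL : VL → VL → Prop) (EM : VM → VM → Prop) (Q : VL → VM → Prop) :
    VL ⊕ VM → VL ⊕ VM → Prop
  | .inl u, .inl v => EL u v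
  | .inl u, .inr j => Q u j
  | .inr _, .inl _ => False
  | .inr i, .inr j => EM i j

/-- edges of the glued quiver -/
def dE {VL VM : Type} (EL : VL → VL → Prop) (EM : VM → VM → Prop) (Q : VL → VM → Prop) :
    VL ⊕ VM → VL ⊕ VM → Prop
  | .inl u, .inl v => EL u v
  | .inl _, .inr _ => False
  | .inr j, .inl u => Q u j
  | .inr i, .inr j => EM i j

namespace Glue
variable {k : Type} [Field k] {VL VM : Type} {EL ZL : VL → VL → Prop} {EM ZM : VM → VM → Prop}
  (P : VL → VM → Prop) (hE : ∀ i j, EM i j → ∀ u, P u j → P u i)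
  (hZ : ∀ i j, ZM i j → ∀ u, ¬ P u j)

/-- The gluing functor on objects. -/
def Gp (R : QRep k VL EL ZL) : PreRep k VM EM where
  X j := ∀ u : {u // P u j}, R.X u.1
  map i j h := LinearMap.pi (fun u => LinearMap.proj (⟨u.1, hE i j h u.1 u.2⟩ : {u // P u i}))

/-- The gluing functor. -/
def G : QRep k VL EL ZL ⥤ QRep k VM EM ZM where
  obj R :=
    { toPreRep := Gp P hE R
      rel := fun i j h x y _ => by
        funext u
        exact absurd u.2 (hZ i j h u.1) }
  map f :=
    { app := fun j => LinearMap.pi (fun u => (f.app u.1).comp (LinearMap.proj u))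
      comm := fun _ _ _ _ => rfl }

instance : (G (k := k) (EL := EL) (ZL := ZL) P hE hZ).Additive := ⟨rfl⟩

instance : ExF (G (k := k) (EL := EL) (ZL := ZL) P hE hZ) := by
  apply QRep.exF_of
  intro S hS
  have h := fun v => QRep.shortExact_elim S hS v
  apply QRep.shortExact_of
  · intro j x y hxy
    funext u
    exact (h u.1).1 (congrFun hxy u)
  · intro j y
    choose x hx using fun u : {u // P u j} => (h u.1).2.1 (y u)
    exact ⟨x, funext hx⟩
  · intro j y hy
    choose x hx using fun u : {u // P u j} => (h u.1).2.2 (y u) (congrFun hy u)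
    exact ⟨x, funext hx⟩

variable (Q : VL → VM → Prop) (hQ : ∀ u j, Q u j → P u j) (ZZ : VL → VM → Prop)
  (hZZ : ∀ u j, ZZ u j → ∀ u, ¬ P u j)

open Classical in
/-- crossing map -/
noncomputable def cX (A : CC.Ob (G (k := k) (EL := EL) (ZL := ZL) P hE hZ)) (u : VL) (j : VM)
    (h : P u j) : A.left.X u →ₗ[k] A.right.X j :=
  (QRep.RHom.app A.hom j).comp
        (LinearMap.single k (fun u : {u // P u j} => A.left.X u.1) ⟨u, h⟩)

/-- glueing data -/
noncomputable def cPre (A : CC.Ob (G (k := k) (EL := EL) (ZL := ZL) P hE hZ)) :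
    PreRep k (VL ⊕ VM) (cE EL EM Q) where
  X := Sum.elim A.left.X A.right.X
  acg v := match v with
    | .inl u => A.left.acg u
    | .inr j => A.right.acg j
  mod v := match v with
    | .inl u => A.left.mod u
    | .inr j => A.right.mod j
  map u v h := match u, v, h with
    | .inl u, .inl v, h => A.left.map u v h
    | .inl u, .inr j, h => cX P hE hZ A u j (hQ u j h)
    | .inr i, .inr j, h => A.right.map i j h

/-- glueing data -/
noncomputable def cRep (A : CC.Ob (G (k := k) (EL := EL) (ZL := ZL) P hE hZ)) :
    QRep k (VL ⊕ VM) (cE EL EM Q) (cE ZL ZM ZZ) where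
  toPreRep := cPre P hE hZ Q hQ A
  rel u v h x y hxy := by
    match u, v, h with
    | .inl u, .inl v, h =>
      have : ∀ w y, (cPre P hE hZ Q hQ A).Reach (u := .inl u) x w y → 
          ∀ w' (e : w = .inl w'), A.left.Reach x w' (e ▸ y : (cPre P hE hZ Q hQ A).X (.inl w')) := by
        intro w y hy
        induction hy with
        | refl => intro w' e; cases e; exact .refl
        | step v w y h _ ih =>
          rintro w' rfl
          match v, h with
          | .inl v, h => exact .step _ _ _ _ (ih v rfl)
      exact A.left.rel u v h _ _ (this _ _ hxy _ rfl)
    | .inr u, .inr v, h => 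
      have : ∀ w y, (cPre P hE hZ Q hQ A).Reach (u := .inr u) x w y → 
          ∃ w' , ∃ e : w = .inr w', A.right.Reach x w' (e ▸ y : (cPre P hE hZ Q hQ A).X (.inr w')) := by
        intro w y hy
        induction hy with
        | refl => exact ⟨_, rfl, .refl⟩
        | step v w y h _ ih =>
          obtain ⟨v', rfl, ih⟩ := ih
          match w, h with
          | .inr w, h => exact ⟨w, rfl, .step _ _ _ _ ih⟩
      obtain ⟨w', e, hh⟩ := this _ _ hxy
      cases e
      exact A.right.rel u v h _ _ hh
    | .inl u, .inr v, h => 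
      have : ∀ w y, (cPre P hE hZ Q hQ A).Reach (u := .inl u) x w y → 
          ∀ w' (e : w = .inr w'), ∃ z, QRep.RHom.app A.hom w' z = (e ▸ y : (cPre P hE hZ Q hQ A).X (.inr w')) := by
        intro w y hy
        induction hy with
        | refl => rintro w' ⟨⟩
        | step v w y h _ ih =>
          rintro w' rfl
          match v, h with
          | .inl v, h => exact ⟨_, rfl⟩
          | .inr v, h =>
            obtain ⟨z, hz⟩ := ih _ rfl
            refine ⟨_, (QRep.RHom.comm A.hom v w' h z).trans ?_⟩
            rw [hz]; rfl
      obtain ⟨z, hz⟩ := this _ _ hxy _ rfl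
      have : z = 0 := funext fun u => absurd u.2 (hZZ _ _ h u.1)
      rw [this, map_zero] at hz
      exact hz.symm

end Glue
end S9

section S10
open CategoryTheory Category Limits

namespace Glue
variable {k : Type} [Field k] {VL VM : Type} {EL ZL : VL → VL → Prop} {EM ZM : VM → VM → Prop}
  (P : VL → VM → Prop) (hE : ∀ i j, EM i j → ∀ u, P u j → P u i)
  (hZ : ∀ i j, ZM i j → ∀ u, ¬ P u j)
  (Q : VL → VM → Prop) (hQ : ∀ u j, Q u j → P u j) (ZZ : VL → VM → Prop)
  (hZZ : ∀ u j, ZZ u j → ∀ u, ¬ P u j)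

lemma cX_nat {A B : CC.Ob (G (k := k) (EL := EL) (ZL := ZL) P hE hZ)} (f : A ⟶ B) (u j h x) :
    QRep.RHom.app f.right j (cX P hE hZ A u j h x) =
      cX P hE hZ B u j h (QRep.RHom.app f.left u x) := by
  classical
  have := congrArg (fun z => QRep.RHom.app z j
    (Pi.single (M := fun u : {u // P u j} => A.left.X u.1) ⟨u, h⟩ x)) f.w
  refine Eq.trans this.symm ?_
  change QRep.RHom.app B.hom j _ = QRep.RHom.app B.hom j _
  congr 1
  funext w
  change QRep.RHom.app f.left w.1
    (Pi.single (M := fun u : {u // P u j} => A.left.X u.1) ⟨u, h⟩ x w) =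
    Pi.single (M := fun u : {u // P u j} => B.left.X u.1) ⟨u, h⟩ (QRep.RHom.app f.left u x) w
  by_cases hw : w = ⟨u, h⟩
  · subst hw
    rw [Pi.single_eq_same, Pi.single_eq_same]
  · rw [Pi.single_eq_of_ne hw, Pi.single_eq_of_ne hw]
    exact map_zero _

/-- glueing functor -/
noncomputable def cF : CC.Ob (G (k := k) (EL := EL) (ZL := ZL) P hE hZ) ⥤
    QRep k (VL ⊕ VM) (cE EL EM Q) (cE ZL ZM ZZ) where
  obj A := cRep P hE hZ Q hQ ZZ hZZ A
  map {A B} f :=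
    { app := fun v => match v with
        | .inl u => QRep.RHom.app f.left u
        | .inr j => QRep.RHom.app f.right j
      comm := fun u v h x => match u, v, h with
        | .inl u, .inl v, h => QRep.RHom.comm f.left u v h x
        | .inl u, .inr j, h => cX_nat P hE hZ f u j (hQ u j h) x
        | .inr i, .inr j, h => QRep.RHom.comm f.right i j h x }
  map_id A := by
    apply QRep.hom_ext
    rintro (v | v) x <;> rfl
  map_comp f g := by
    apply QRep.hom_ext
    rintro (v | v) x <;> rfl

instance : (cF (k := k) (EL := EL) (ZL := ZL) P hE hZ Q hQ ZZ hZZ).Additive := ⟨by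
  intro A B f g
  apply QRep.hom_ext
  rintro (v | v) x <;> rfl⟩

instance : (cF (k := k) (EL := EL) (ZL := ZL) P hE hZ Q hQ ZZ hZZ).Faithful := ⟨by
  intro A B f g h
  ext v x
  · exact congrArg (fun z => QRep.RHom.app z (.inl v) x) h
  · exact congrArg (fun z => QRep.RHom.app z (.inr v) x) h⟩

lemma cF_full (H : ∀ A B (f : (cF (k := k) (EL := EL) (ZL := ZL) P hE hZ Q hQ ZZ hZZ).obj A ⟶
    (cF (k := k) (EL := EL) (ZL := ZL) P hE hZ Q hQ ZZ hZZ).obj B) (j : VM)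
    (x : ∀ u : {u // P u j}, A.left.X u.1),
    (QRep.RHom.app f (.inr j) (QRep.RHom.app A.hom j x) : B.right.X j) =
      QRep.RHom.app B.hom j (fun u => (QRep.RHom.app f (.inl u.1) (x u) : B.left.X u.1))) :
    (cF (k := k) (EL := EL) (ZL := ZL) P hE hZ Q hQ ZZ hZZ).Full := ⟨by
  intro A B f
  let l : A.left ⟶ B.left := ⟨fun u => QRep.RHom.app f (.inl u),
    fun u v h x => QRep.RHom.comm f (.inl u) (.inl v) h x⟩
  let r : A.right ⟶ B.right := ⟨fun u => QRep.RHom.app f (.inr u),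
    fun u v h x => QRep.RHom.comm f (.inr u) (.inr v) h x⟩
  refine ⟨{ left := l, right := r, w := ?_ }, ?_⟩
  · apply QRep.hom_ext
    intro j x
    exact (H A B f j x).symm
  · apply QRep.hom_ext
    rintro (v | v) x <;> rfl⟩

lemma cF_essSurj (H : ∀ R : QRep k (VL ⊕ VM) (cE EL EM Q) (cE ZL ZM ZZ),
    ∃ φ : ∀ j, (∀ u : {u // P u j}, R.X (.inl u.1)) →ₗ[k] R.X (.inr j),
    (∀ i j (h : EM i j) x, φ j (fun u => x ⟨u.1, hE i j h u.1 u.2⟩) =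
      R.map (.inr i) (.inr j) h (φ i x)) ∧
    (∀ u j (h : Q u j) x y, y ⟨u, hQ u j h⟩ = x → (∀ w, w.1 ≠ u → y w = 0) →
      φ j y = R.map (.inl u) (.inr j) h x)) :
    (cF (k := k) (EL := EL) (ZL := ZL) P hE hZ Q hQ ZZ hZZ).EssSurj := ⟨fun R => by
  classical
  obtain ⟨φ, h1, h2⟩ := H R
  let l' : PreRep k VL EL := ⟨fun u => R.X (.inl u), fun u v h => R.map (.inl u) (.inl v) h⟩
  let r' : PreRep k VM EM := ⟨fun u => R.X (.inr u), fun u v h => R.map (.inr u) (.inr v) h⟩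
  let l : QRep k VL EL ZL := ⟨l', fun u v h x y hxy => R.rel (.inl u) (.inl v) h x y (by
    clear h
    induction hxy with
    | refl => exact .refl
    | step v w y h _ ih => exact .step _ _ _ _ ih)⟩
  let r : QRep k VM EM ZM := ⟨r', fun u v h x y hxy => R.rel (.inr u) (.inr v) h x y (by
    clear h
    induction hxy with
    | refl => exact .refl
    | step v w y h _ ih => exact .step _ _ _ _ ih)⟩
  let A : CC.Ob (G (k := k) (EL := EL) (ZL := ZL) P hE hZ) := ⟨l, r, ⟨φ, h1⟩⟩
  refine ⟨A, ⟨QRep.mkIso (fun v => match v with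
        | .inl u => LinearEquiv.refl k (R.X (.inl u))
        | .inr j => LinearEquiv.refl k (R.X (.inr j)))
        (fun u v h x => ?_)⟩⟩
  rcases u with u | i <;> rcases v with v | j
  · rfl
  · refine h2 u j h x (Pi.single (M := fun u : {u // P u j} => R.X (.inl u.1)) ⟨u, hQ u j h⟩ x)
      (Pi.single_eq_same _ _) ?_
    intro w hw
    exact Pi.single_eq_of_ne (fun e => hw (by rw [e])) _
  · exact h.elim
  · rfl⟩

/-- glueing data -/
noncomputable def dPre (A : DD.Ob (G (k := k) (EL := EL) (ZL := ZL) P hE hZ)) :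
    PreRep k (VL ⊕ VM) (dE EL EM Q) where
  X := Sum.elim A.right.X A.left.X
  acg v := match v with
    | .inl u => A.right.acg u
    | .inr j => A.left.acg j
  mod v := match v with
    | .inl u => A.right.mod u
    | .inr j => A.left.mod j
  map u v h := match u, v, h with
    | .inl u, .inl v, h => A.right.map u v h
    | .inr j, .inl u, h => LinearMap.comp (M₁ := A.left.X j) (M₃ := A.right.X u)
        (LinearMap.proj (φ := fun u : {u // P u j} => A.right.X u.1) ⟨u, hQ u j h⟩)
        (QRep.RHom.app A.hom j)
    | .inr i, .inr j, h => A.left.map i j h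

/-- glueing data -/
noncomputable def dRep (A : DD.Ob (G (k := k) (EL := EL) (ZL := ZL) P hE hZ)) :
    QRep k (VL ⊕ VM) (dE EL EM Q) (dE ZL ZM (fun _ _ => False)) where
  toPreRep := dPre P hE hZ Q hQ A
  rel u v h x y hxy := by
    match u, v, h with
    | .inr u, .inr v, h =>
      have : ∀ w y, (dPre P hE hZ Q hQ A).Reach (u := .inr u) x w y →
          ∀ w' (e : w = .inr w'), A.left.Reach x w'
            (e ▸ y : (dPre P hE hZ Q hQ A).X (.inr w')) := by
        intro w y hy
        induction hy with
        | refl => intro w' e; cases e; exact .refl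
        | step v w y h _ ih =>
          rintro w' rfl
          match v, h with
          | .inr v, h => exact .step _ _ _ _ (ih v rfl)
      exact A.left.rel u v h _ _ (this _ _ hxy _ rfl)
    | .inl u, .inl v, h =>
      have : ∀ w y, (dPre P hE hZ Q hQ A).Reach (u := .inl u) x w y →
          ∃ w' , ∃ e : w = .inl w', A.right.Reach x w'
            (e ▸ y : (dPre P hE hZ Q hQ A).X (.inl w')) := by
        intro w y hy
        induction hy with
        | refl => exact ⟨_, rfl, .refl⟩
        | step v w y h _ ih =>
          obtain ⟨v', rfl, ih⟩ := ih
          match w, h with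
          | .inl w, h => exact ⟨w, rfl, .step _ _ _ _ ih⟩
      obtain ⟨w', e, hh⟩ := this _ _ hxy
      cases e
      exact A.right.rel u v h _ _ hh

/-- glueing functor -/
noncomputable def dF' : DD.Ob (G (k := k) (EL := EL) (ZL := ZL) P hE hZ) ⥤
    QRep k (VL ⊕ VM) (dE EL EM Q) (dE ZL ZM (fun _ _ => False)) where
  obj A := dRep P hE hZ Q hQ A
  map {A B} f :=
    { app := fun v => match v with
        | .inl u => QRep.RHom.app f.right u
        | .inr j => QRep.RHom.app f.left j
      comm := fun u v h x => match u, v, h with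
        | .inl u, .inl v, h => QRep.RHom.comm f.right u v h x
        | .inr j, .inl u, h => by
          have := congrArg (fun z => QRep.RHom.app z j x) f.w
          exact (congrFun this ⟨u, hQ u j h⟩).symm
        | .inr i, .inr j, h => QRep.RHom.comm f.left i j h x }
  map_id A := by
    apply QRep.hom_ext
    rintro (v | v) x <;> rfl
  map_comp f g := by
    apply QRep.hom_ext
    rintro (v | v) x <;> rfl

instance : (dF' (k := k) (EL := EL) (ZL := ZL) P hE hZ Q hQ).Additive := ⟨by
  intro A B f g
  apply QRep.hom_ext
  rintro (v | v) x <;> rfl⟩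

instance : (dF' (k := k) (EL := EL) (ZL := ZL) P hE hZ Q hQ).Faithful := ⟨by
  intro A B f g h
  ext v x
  · exact congrArg (fun z => QRep.RHom.app z (.inr v) x) h
  · exact congrArg (fun z => QRep.RHom.app z (.inl v) x) h⟩

lemma dF_full (H : ∀ A B (f : (dF' (k := k) (EL := EL) (ZL := ZL) P hE hZ Q hQ).obj A ⟶
    (dF' (k := k) (EL := EL) (ZL := ZL) P hE hZ Q hQ).obj B) (j : VM)
    (x : A.left.X j) (u : {u // P u j}),
    (QRep.RHom.app B.hom j (QRep.RHom.app f (.inr j) x) : ∀ u : {u // P u j}, B.right.X u.1) u =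
      QRep.RHom.app f (.inl u.1) ((QRep.RHom.app A.hom j x : ∀ u : {u // P u j}, A.right.X u.1) u)) :
    (dF' (k := k) (EL := EL) (ZL := ZL) P hE hZ Q hQ).Full := ⟨by
  intro A B f
  let l : A.left ⟶ B.left := ⟨fun u => QRep.RHom.app f (.inr u),
    fun u v h x => QRep.RHom.comm f (.inr u) (.inr v) h x⟩
  let r : A.right ⟶ B.right := ⟨fun u => QRep.RHom.app f (.inl u),
    fun u v h x => QRep.RHom.comm f (.inl u) (.inl v) h x⟩
  refine ⟨{ left := l, right := r, w := ?_ }, ?_⟩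
  · apply QRep.hom_ext
    intro j x
    funext u
    exact (H A B f j x u)
  · apply QRep.hom_ext
    rintro (v | v) x <;> rfl⟩

lemma dF_essSurj (H : ∀ R : QRep k (VL ⊕ VM) (dE EL EM Q) (dE ZL ZM (fun _ _ => False)),
    ∃ φ : ∀ j (u : {u // P u j}), R.X (.inr j) →ₗ[k] R.X (.inl u.1),
    (∀ i j (h : EM i j) x u, φ j u (R.map (.inr i) (.inr j) h x) =
      φ i ⟨u.1, hE i j h u.1 u.2⟩ x) ∧
    (∀ u j (h : Q u j) x, φ j ⟨u, hQ u j h⟩ x = R.map (.inr j) (.inl u) h x)) :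
    (dF' (k := k) (EL := EL) (ZL := ZL) P hE hZ Q hQ).EssSurj := ⟨fun R => by
  obtain ⟨φ, h1, h2⟩ := H R
  let l' : PreRep k VL EL := ⟨fun u => R.X (.inl u), fun u v h => R.map (.inl u) (.inl v) h⟩
  let r' : PreRep k VM EM := ⟨fun u => R.X (.inr u), fun u v h => R.map (.inr u) (.inr v) h⟩
  let l : QRep k VL EL ZL := ⟨l', fun u v h x y hxy => R.rel (.inl u) (.inl v) h x y (by
    clear h
    induction hxy with
    | refl => exact .refl
    | step v w y h _ ih => exact .step _ _ _ _ ih)⟩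
  let r : QRep k VM EM ZM := ⟨r', fun u v h x y hxy => R.rel (.inr u) (.inr v) h x y (by
    clear h
    induction hxy with
    | refl => exact .refl
    | step v w y h _ ih => exact .step _ _ _ _ ih)⟩
  let A : DD.Ob (G (k := k) (EL := EL) (ZL := ZL) P hE hZ) :=
    ⟨r, l, ⟨fun j => LinearMap.pi (φ j), fun i j h x => funext fun u => h1 i j h x u⟩⟩
  refine ⟨A, ⟨QRep.mkIso (fun v => match v with
        | .inl u => LinearEquiv.refl k (R.X (.inl u))
        | .inr j => LinearEquiv.refl k (R.X (.inr j)))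
        (fun u v h x => ?_)⟩⟩
  rcases u with u | i <;> rcases v with v | j
  · rfl
  · exact h.elim
  · exact h2 v i h x
  · rfl⟩

end Glue
end S10

section S11
open CategoryTheory Category Limits

namespace Glue
variable {k : Type} [Field k] {VL VM : Type} {EL ZL : VL → VL → Prop} {EM ZM : VM → VM → Prop}

lemma glue_deq (P : VL → VM → Prop) (hE : ∀ i j, EM i j → ∀ u, P u j → P u i)
    (hZ : ∀ i j, ZM i j → ∀ u, ¬ P u j)
    (Q : VL → VM → Prop) (hQ : ∀ u j, Q u j → P u j) (ZZ : VL → VM → Prop)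
    (hZZ : ∀ u j, ZZ u j → ∀ u, ¬ P u j)
    (Q' : VL → VM → Prop) (hQ' : ∀ u j, Q' u j → P u j)
    (h1 : (cF (k := k) (EL := EL) (ZL := ZL) P hE hZ Q hQ ZZ hZZ).Full)
    (h2 : (cF (k := k) (EL := EL) (ZL := ZL) P hE hZ Q hQ ZZ hZZ).EssSurj)
    (h3 : (dF' (k := k) (EL := EL) (ZL := ZL) P hE hZ Q' hQ').Full)
    (h4 : (dF' (k := k) (EL := EL) (ZL := ZL) P hE hZ Q' hQ').EssSurj) :
    DEq (QRep k (VL ⊕ VM) (cE EL EM Q) (cE ZL ZM ZZ))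
      (QRep k (VL ⊕ VM) (dE EL EM Q') (dE ZL ZM (fun _ _ => False))) := by
  haveI i1 : (cF (k := k) (EL := EL) (ZL := ZL) P hE hZ Q hQ ZZ hZZ).IsEquivalence := {}
  haveI i2 : (dF' (k := k) (EL := EL) (ZL := ZL) P hE hZ Q' hQ').IsEquivalence := {}
  have e1 := DEq.of_equiv (cF (k := k) (EL := EL) (ZL := ZL) P hE hZ Q hQ ZZ hZZ).asEquivalence
    (he := by change (cF (k := k) (EL := EL) (ZL := ZL) P hE hZ Q hQ ZZ hZZ).Additive; infer_instance)
  have e2 := DEq.of_equiv (dF' (k := k) (EL := EL) (ZL := ZL) P hE hZ Q' hQ').asEquivalence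
    (he := by change (dF' (k := k) (EL := EL) (ZL := ZL) P hE hZ Q' hQ').Additive; infer_instance)
  exact e1.symm.trans ((thmT (G (k := k) (EL := EL) (ZL := ZL) P hE hZ)).trans e2)

theorem move1 [Finite VL] (adj : VL → Prop) :
    DEq (QRep k (VL ⊕ Unit) (cE EL (fun _ _ => False) (fun u _ => adj u))
        (cE ZL (fun _ _ => False) (fun _ _ => False)))
      (QRep k (VL ⊕ Unit) (dE EL (fun _ _ => False) (fun u _ => adj u))
        (dE ZL (fun _ _ => False) (fun _ _ => False))) := by
  classical
  haveI := Fintype.ofFinite VL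
  refine glue_deq (fun u _ => adj u) (by simp) (by simp) _ (fun _ _ h => h) _ (by simp)
    _ (fun _ _ h => h) ?_ ?_ ?_ ?_
  · apply cF_full
    intro A B f j x
    have hx : x = ∑ u : {u // adj u}, Pi.single (M := fun u : {u // adj u} => A.left.X u.1)
      u (x u) := (Finset.univ_sum_single x).symm
    have key : ∀ u : {u // adj u}, QRep.RHom.app f (.inr j) (QRep.RHom.app A.hom j
        (Pi.single (M := fun u : {u // adj u} => A.left.X u.1) u (x u))) = QRep.RHom.app B.hom j
        (Pi.single (M := fun u : {u // adj u} => B.left.X u.1) u 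
          (QRep.RHom.app f (.inl u.1) (x u))) := by
      intro u
      exact QRep.RHom.comm f (.inl u.1) (.inr j) u.2 (x u)
    have e1 : QRep.RHom.app A.hom j x = ∑ u, QRep.RHom.app A.hom j
        (Pi.single (M := fun u : {u // adj u} => A.left.X u.1) u (x u)) := by
      conv_lhs => rw [hx]
      exact map_sum (QRep.RHom.app A.hom j) _ _
    have hy : (fun u => QRep.RHom.app f (.inl u.1) (x u) : ∀ u : {u // adj u}, B.left.X u.1) =
      ∑ u : {u // adj u}, Pi.single (M := fun u : {u // adj u} => B.left.X u.1)
      u (QRep.RHom.app f (.inl u.1) (x u)) := (Finset.univ_sum_single _).symm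
    rw [e1, hy]
    refine (map_sum (QRep.RHom.app f (.inr j)) _ _).trans ?_
    refine Eq.trans ?_ (map_sum (QRep.RHom.app B.hom j) _ _).symm
    exact Finset.sum_congr rfl (fun u _ => key u)
  · apply cF_essSurj
    intro R
    refine ⟨fun j => ∑ u : {u // adj u}, (R.map (.inl u.1) (.inr j) u.2).comp
      (LinearMap.proj u), ?_, ?_⟩
    · intro i j h; exact h.elim
    · intro u j h x y h1 h2
      rw [LinearMap.sum_apply, Finset.sum_eq_single ⟨u, h⟩]
      · simp [h1]
      · intro b _ hb
        simp [h2 b (fun e => hb (Subtype.ext e))]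
      · simp
  · apply dF_full
    intro A B f j x u
    exact (QRep.RHom.comm f (.inr j) (.inl u.1) u.2 x).symm
  · apply dF_essSurj
    intro R
    refine ⟨fun j u => R.map (.inr j) (.inl u.1) u.2, ?_, ?_⟩
    · intro i j h; exact h.elim
    · intros; rfl

/-- path maps -/
noncomputable def cg {a : VL} {ZZ : VL ⊕ ℕ → VL ⊕ ℕ → Prop}
    (R : QRep k (VL ⊕ ℕ) (cE EL (fun i j => j = i + 1) (fun u j => u = a ∧ j = 0)) ZZ) :
    ∀ j : ℕ, R.X (.inl a) →ₗ[k] R.X (.inr j)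
  | 0 => R.map (.inl a) (.inr 0) ⟨rfl, rfl⟩
  | j + 1 => LinearMap.comp (R.map (.inr j) (.inr (j+1)) rfl) (cg R j)

lemma cg_reach {a : VL} {ZZ : VL ⊕ ℕ → VL ⊕ ℕ → Prop}
    (R : QRep k (VL ⊕ ℕ) (cE EL (fun i j => j = i + 1) (fun u j => u = a ∧ j = 0)) ZZ) (j x) :
    R.Reach x (.inr j) (cg R j x) := by
  induction j with
  | zero => exact .step _ _ _ _ .refl
  | succ j ih => exact .step _ _ _ _ ih

/-- path maps -/
noncomputable def dg {a : VL} {p : ℕ} {ZZ : VL ⊕ ℕ → VL ⊕ ℕ → Prop}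
    (R : QRep k (VL ⊕ ℕ) (dE EL (fun i j => j = i + 1) (fun u j => u = a ∧ j = p)) ZZ) :
    ∀ (d j : ℕ), j + d = p → (R.X (.inr j) →ₗ[k] R.X (.inl a))
  | 0, j, h => R.map (.inr j) (.inl a) ⟨rfl, h⟩
  | d + 1, j, h => LinearMap.comp (dg R d (j + 1) (by omega)) (R.map (.inr j) (.inr (j+1)) rfl)

theorem move2 {ZM : ℕ → ℕ → Prop} (a : VL) (p : ℕ) (hZM : ∀ i j, ZM i j → p + 1 ≤ j) :
    DEq (QRep k (VL ⊕ ℕ) (cE EL (fun i j => j = i + 1) (fun u j => u = a ∧ j = 0))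
        (cE ZL ZM (fun u j => u = a ∧ j = p + 1)))
      (QRep k (VL ⊕ ℕ) (dE EL (fun i j => j = i + 1) (fun u j => u = a ∧ j = p))
        (dE ZL ZM (fun _ _ => False))) := by
  classical
  refine glue_deq (fun u j => u = a ∧ j ≤ p) (fun i j h u hu => ⟨hu.1, by omega⟩)
    (fun i j h u hu => by have := hZM i j h; omega)
    _ (fun u j h => ⟨h.1, by omega⟩) _ (fun u j h u hu => by omega)
    _ (fun u j h => ⟨h.1, by omega⟩) ?_ ?_ ?_ ?_
  · apply cF_full
    intro A B f j x
    by_cases hj : j ≤ p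
    · obtain ⟨x', hx'⟩ : ∃ x' : A.left.X a, x' = x ⟨a, rfl, hj⟩ := ⟨_, rfl⟩
      induction j with
      | zero =>
        have := QRep.RHom.comm f (.inl a) (.inr 0) ⟨rfl, rfl⟩ x'
        have e1 : Pi.single (M := fun u : {u // u = a ∧ 0 ≤ p} => A.left.X u.1)
            ⟨a, rfl, hj⟩ x' = x := by
          funext ⟨w, h1, h2⟩; subst h1; rw [hx', Pi.single_eq_same]
        have e2 : Pi.single (M := fun u : {u // u = a ∧ 0 ≤ p} => B.left.X u.1)
            ⟨a, rfl, hj⟩ (QRep.RHom.app f (.inl a) x') = 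
              (fun u : {u // u = a ∧ 0 ≤ p} =>
                (QRep.RHom.app f (.inl u.1) (x u) : B.left.X u.1)) := by
          funext ⟨w, h1, h2⟩; subst h1; rw [hx']
          exact Pi.single_eq_same (M := fun u : {u // u = w ∧ 0 ≤ p} => B.left.X u.1) _ _
        refine Eq.trans (congrArg (fun z => QRep.RHom.app f (.inr 0) (QRep.RHom.app A.hom 0 z))
          e1.symm) ?_
        refine Eq.trans ?_ (congrArg (QRep.RHom.app B.hom 0) e2)
        exact this
      | succ j ih =>
        let z : ∀ u : {u // u = a ∧ j ≤ p}, A.left.X u.1 := fun u => x ⟨u.1, u.2.1, hj⟩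
        have := ih z (by omega) hx'
        have h1 := QRep.RHom.comm A.hom j (j+1) rfl z
        have h2 := QRep.RHom.comm B.hom j (j+1) rfl
          (fun u => (QRep.RHom.app f (.inl u.1) (z u) : B.left.X u.1))
        refine Eq.trans ?_ h2.symm
        refine Eq.trans ?_ (congrArg (B.right.map j (j+1) rfl) this)
        refine Eq.trans (congrArg (QRep.RHom.app f (.inr (j+1))) h1) ?_
        exact QRep.RHom.comm f (.inr j) (.inr (j+1)) rfl _
    · have h0 : x = 0 := by funext u; exact absurd u.2.2 hj
      subst h0
      have h1 : QRep.RHom.app A.hom j 0 = 0 := map_zero _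
      have h2 : (fun u => (QRep.RHom.app f (.inl u.1) 0 : B.left.X u.1) :
        ∀ u : {u // u = a ∧ j ≤ p}, B.left.X u.1) = 0 := by funext u; exact map_zero _
      refine Eq.trans (congrArg _ h1) ?_
      refine Eq.trans (map_zero _) ?_
      refine Eq.trans ?_ (congrArg _ h2.symm)
      exact (map_zero (QRep.RHom.app B.hom j)).symm
  · apply cF_essSurj
    intro R
    refine ⟨fun j => if h : j ≤ p then (cg R j).comp (LinearMap.proj
      (φ := fun u : {u // u = a ∧ j ≤ p} => R.X (.inl u.1)) ⟨a, rfl, h⟩) else 0, ?_, ?_⟩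
    · rintro i _ rfl x
      beta_reduce
      by_cases hi : i + 1 ≤ p
      · rw [dif_pos hi, dif_pos (by omega)]
        rfl
      · rw [dif_neg hi]
        by_cases hi' : i ≤ p
        · obtain rfl : i = p := by omega
          rw [dif_pos le_rfl]
          symm
          exact R.rel (.inl a) (.inr (i+1)) ⟨rfl, rfl⟩ _ _ (cg_reach R (i+1) _)
        · rw [dif_neg hi']
          exact (map_zero _).symm
    · rintro u _ ⟨rfl, rfl⟩ x y h1 h2
      subst h1
      beta_reduce
      rw [dif_pos (by omega)]
      rfl
  · apply dF_full
    rintro A B f j x ⟨u, rfl, hj⟩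
    obtain ⟨d, hd⟩ : ∃ d, j + d = p := ⟨p - j, by omega⟩
    induction d generalizing j with
    | zero => 
      obtain rfl : j = p := by omega
      exact (QRep.RHom.comm f (.inr j) (.inl u) ⟨rfl, rfl⟩ x).symm
    | succ d ih =>
      have := ih (j+1) (by omega) (A.left.map j (j+1) rfl x) (by omega)
      have h1 := congrFun (QRep.RHom.comm A.hom j (j+1) rfl x) ⟨u, rfl, by omega⟩
      have h2 := congrFun (QRep.RHom.comm B.hom j (j+1) rfl (QRep.RHom.app f (.inr j) x))
        ⟨u, rfl, by omega⟩
      have h3 := QRep.RHom.comm f (.inr j) (.inr (j+1)) rfl x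
      refine Eq.trans h2.symm ?_
      refine Eq.trans ?_ (congrArg (QRep.RHom.app f (.inl u)) h1)
      refine Eq.trans ?_ this
      exact congrFun (congrArg (QRep.RHom.app B.hom (j+1)) h3.symm) _
  · apply dF_essSurj
    intro R
    refine ⟨fun j u => Eq.rec (motive := fun v _ => R.X (.inr j) →ₗ[k] R.X (.inl v))
      (dg R (p - j) j (by have := u.2.2; omega)) u.2.1.symm, ?_, ?_⟩
    · rintro i _ rfl x ⟨u, rfl, hu⟩
      have : ∀ d e (h1 : i + d = p) (h2 : i + 1 + e = p) (h : d = e + 1),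
        dg R e (i+1) h2 (R.map (.inr i) (.inr (i+1)) rfl x) = dg R d i h1 x := by
        rintro _ e h1 h2 rfl; rfl
      exact this _ _ _ _ (by omega)
    · rintro u j ⟨rfl, rfl⟩ x
      have : ∀ d (h : j + d = j) (h2 : d = 0),
        dg R d j h x = R.map (.inr j) (.inl u) ⟨rfl, rfl⟩ x := by
        rintro _ h rfl; rfl
      exact this _ _ (by omega)

end Glue
end S11

section S12
open CategoryTheory Category Limits

namespace Restr
variable {k : Type} [Field k] {V V' : Type} {E Z : V → V → Prop} {E' Z' : V' → V' → Prop}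
  (φ : V' → V)

/-- restriction -/
def rp (hE : ∀ u v, E' u v ↔ E (φ u) (φ v)) (R : PreRep k V E) : PreRep k V' E' where
  X u := R.X (φ u)
  map u v h := R.map (φ u) (φ v) ((hE u v).1 h)

lemma rp_reach (hE : ∀ u v, E' u v ↔ E (φ u) (φ v)) (R : PreRep k V E) {u : V'}
    {x : (rp φ hE R).X u} {v : V'} {y : (rp φ hE R).X v}
    (h : (rp φ hE R).Reach x v y) : R.Reach (u := φ u) x (φ v) y := by
  induction h with
  | refl => exact .refl
  | step v w y h _ ih => exact .step _ _ _ _ ih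

/-- restriction functor -/
def rf (hE : ∀ u v, E' u v ↔ E (φ u) (φ v))
    (hZ : ∀ u v, Z' u v ↔ Z (φ u) (φ v)) : QRep k V E Z ⥤ QRep k V' E' Z' where
  obj R := ⟨rp φ hE R.toPreRep, fun u v h x y hxy =>
    R.rel _ _ ((hZ u v).1 h) x y (rp_reach φ hE _ hxy)⟩
  map f := ⟨fun u => f.app (φ u), fun u v h x => f.comm _ _ _ x⟩

instance (hE : ∀ u v, E' u v ↔ E (φ u) (φ v))
    (hZ : ∀ u v, Z' u v ↔ Z (φ u) (φ v)) : (rf (k := k) φ hE hZ).Additive := ⟨rfl⟩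

lemma dead_zero (hd : ∀ v, (∀ u, φ u ≠ v) → Z v v) (R : QRep k V E Z) (v : V) (h : ∀ u, φ u ≠ v) (x : R.X v) : x = 0 :=
  R.rel v v (hd v h) x x .refl

lemma rf_faithful (hE : ∀ u v, E' u v ↔ E (φ u) (φ v))
    (hZ : ∀ u v, Z' u v ↔ Z (φ u) (φ v)) (hd : ∀ v, (∀ u, φ u ≠ v) → Z v v) : (rf (k := k) φ hE hZ).Faithful := ⟨by
  intro R S f g h
  apply QRep.hom_ext
  intro v x
  by_cases hv : ∃ u, φ u = v
  · obtain ⟨u, rfl⟩ := hv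
    exact congrArg (fun z => QRep.RHom.app z u x) h
  · push Not at hv
    rw [dead_zero φ hd R v hv x, map_zero, map_zero]⟩

open Classical in
/-- extend a map by zero -/
noncomputable def exm {A B : V → Type} [∀ v, AddCommGroup (A v)] [∀ v, AddCommGroup (B v)]
    [∀ v, Module k (A v)] [∀ v, Module k (B v)]
    (f : ∀ u, A (φ u) →ₗ[k] B (φ u)) (v : V) : A v →ₗ[k] B v :=
  if h : ∃ u, φ u = v then
    Eq.rec (motive := fun v _ => A v →ₗ[k] B v) (f h.choose) h.choose_spec
  else 0

lemma exm_apply (hφ : Function.Injective φ) {A B : V → Type} [∀ v, AddCommGroup (A v)] [∀ v, AddCommGroup (B v)]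
    [∀ v, Module k (A v)] [∀ v, Module k (B v)]
    (f : ∀ u, A (φ u) →ₗ[k] B (φ u)) (u : V') : exm φ f (φ u) = f u := by
  have h : ∃ u', φ u' = φ u := ⟨u, rfl⟩
  unfold exm
  rw [dif_pos h]
  have key : ∀ (c : V') (e : φ c = φ u),
    Eq.rec (motive := fun v _ => A v →ₗ[k] B v) (f c) e = f u := by
    intro c e
    obtain rfl := hφ e
    rfl
  exact key _ _

lemma rf_full (hφ : Function.Injective φ) (hE : ∀ u v, E' u v ↔ E (φ u) (φ v))
    (hZ : ∀ u v, Z' u v ↔ Z (φ u) (φ v)) (hd : ∀ v, (∀ u, φ u ≠ v) → Z v v) : (rf (k := k) φ hE hZ).Full := ⟨by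
  intro R S f
  have fc : ∀ u v (h : E (φ u) (φ v)) x, f.app v (R.map (φ u) (φ v) h x) =
    S.map (φ u) (φ v) h (f.app u x) := fun u v h x => f.comm u v ((hE u v).2 h) x
  let f' : ∀ u, R.X (φ u) →ₗ[k] S.X (φ u) := fun u => f.app u
  refine ⟨⟨exm φ f', fun u v h x => ?_⟩, ?_⟩
  · by_cases hv : ∃ u, φ u = v
    · obtain ⟨v, rfl⟩ := hv
      by_cases hu : ∃ u', φ u' = u
      · obtain ⟨u, rfl⟩ := hu
        rw [exm_apply φ hφ, exm_apply φ hφ]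
        exact fc u v h x
      · push Not at hu
        rw [dead_zero φ hd R u hu x]
        simp
    · push Not at hv
      exact (dead_zero φ hd S v hv _).trans (dead_zero φ hd S v hv _).symm
  · apply QRep.hom_ext
    intro u x
    exact congrArg (fun z => z x) (exm_apply φ hφ f' u)⟩

open Classical in
/-- extension by zero -/
noncomputable def xp (hE : ∀ u v, E' u v ↔ E (φ u) (φ v)) (R : PreRep k V' E') : PreRep k V E where
  X v := ∀ u : {u // φ u = v}, R.X u.1
  map v w h := if hv : ∃ u, φ u = v then
      LinearMap.pi fun u' : {u // φ u = w} => (R.map hv.choose u'.1 ((hE _ _).2 (by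
        rw [hv.choose_spec, u'.2]; exact h))).comp (LinearMap.proj
          (φ := fun u : {u // φ u = v} => R.X u.1) ⟨_, hv.choose_spec⟩)
    else 0

lemma xp_map (hφ : Function.Injective φ) (hE : ∀ u v, E' u v ↔ E (φ u) (φ v))
    (R : PreRep k V' E') (u v : V') (h : E (φ u) (φ v)) (x : (xp φ hE R).X (φ u)) :
    (xp φ hE R).map (φ u) (φ v) h x ⟨v, rfl⟩ = R.map u v ((hE u v).2 h) (x ⟨u, rfl⟩) := by
  have hv : ∃ u', φ u' = φ u := ⟨u, rfl⟩
  have e : (xp φ hE R).map (φ u) (φ v) h = LinearMap.pi fun u' : {u // φ u = φ v} => (R.map hv.choose u'.1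
      ((hE _ _).2 (by rw [hv.choose_spec, u'.2]; exact h))).comp
        (LinearMap.proj
          (φ := fun u' : {u' // φ u' = φ u} => R.X u'.1) ⟨_, hv.choose_spec⟩) := dif_pos hv
  rw [e]
  have key : ∀ (c : V') (e : φ c = φ u) (hh : E' c v), R.map c v hh (x ⟨c, e⟩) =
      R.map u v ((hE u v).2 h) (x ⟨u, rfl⟩) := by
    intro c e hh
    obtain rfl := hφ e
    rfl
  exact key _ _ _

lemma xp_reach (hφ : Function.Injective φ) (hE : ∀ u v, E' u v ↔ E (φ u) (φ v))
    (R : PreRep k V' E') (u : V') (x : (xp φ hE R).X (φ u)) (v : V)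
    (y : (xp φ hE R).X v) (h : (xp φ hE R).Reach x v y) :
    y = 0 ∨ ∃ v', ∃ e : φ v' = v, R.Reach (x ⟨u, rfl⟩) v' (y ⟨v', e⟩) := by
  induction h with
  | refl => exact .inr ⟨u, rfl, .refl⟩
  | step v w y h _ ih =>
    rcases ih with rfl | ⟨v', rfl, ih⟩
    · left; exact map_zero _
    · by_cases hw : ∃ w', φ w' = w
      · obtain ⟨w', rfl⟩ := hw
        right
        refine ⟨w', rfl, ?_⟩
        rw [xp_map φ hφ hE R v' w' h]
        exact .step _ _ _ _ ih
      · left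
        funext t
        exact absurd ⟨t.1, t.2⟩ hw

lemma rf_essSurj (hφ : Function.Injective φ) (hE : ∀ u v, E' u v ↔ E (φ u) (φ v))
    (hZ : ∀ u v, Z' u v ↔ Z (φ u) (φ v)) : (rf (k := k) φ hE hZ).EssSurj := ⟨fun R => by
  refine ⟨⟨xp φ hE R.toPreRep, fun u v h x y hxy => ?_⟩, ⟨QRep.mkIso (fun u =>
    { toFun := fun x => x ⟨u, rfl⟩
      map_add' := fun _ _ => rfl
      map_smul' := fun _ _ => rfl
      invFun := fun y t => Eq.rec (motive := fun u _ => R.X u) y (hφ t.2).symm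
      left_inv := fun x => by
        funext ⟨t, ht⟩
        obtain rfl := hφ ht
        rfl
      right_inv := fun y => rfl }) (fun u v h x => ?_)⟩⟩
  · by_cases hu : ∃ u', φ u' = u
    · obtain ⟨u, rfl⟩ := hu
      rcases xp_reach φ hφ hE R.toPreRep u x v y hxy with h0 | ⟨v', rfl, h0⟩
      · exact h0
      · funext ⟨t, ht⟩
        obtain rfl := hφ ht
        exact R.rel u t ((hZ _ _).2 h) _ _ h0
    · have hx : x = 0 := by funext t; exact absurd ⟨t.1, t.2⟩ hu
      subst hx
      clear h
      induction hxy with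
      | refl => rfl
      | step v w y h _ ih => rw [ih]; exact map_zero _
  · exact xp_map φ hφ hE R.toPreRep u v ((hE u v).1 h) x⟩

theorem restr_deq (hφ : Function.Injective φ) (hE : ∀ u v, E' u v ↔ E (φ u) (φ v))
    (hZ : ∀ u v, Z' u v ↔ Z (φ u) (φ v)) (hd : ∀ v, (∀ u, φ u ≠ v) → Z v v) :
    DEq (QRep k V E Z) (QRep k V' E' Z') := by
  haveI i1 := rf_full (k := k) φ hφ hE hZ hd
  haveI i2 := rf_faithful (k := k) φ hE hZ hd
  haveI i3 := rf_essSurj (k := k) φ hφ hE hZ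
  haveI i4 : (rf (k := k) φ hE hZ).IsEquivalence := {}
  exact DEq.of_equiv (rf (k := k) φ hE hZ).asEquivalence
    (he := by change (rf (k := k) φ hE hZ).Additive; infer_instance)

end Restr
end S12

section S13
open CategoryTheory Category Limits

namespace Nak
variable (k : Type) [Field k] (n t : ℕ) (ns ls : Fin t → ℕ)

/-- idempotents -/
noncomputable def ed (v : Fin n) : NakayamaAlgebra k n t ns ls :=
  RingQuot.mkAlgHom k _ (FreeAlgebra.ι k (Sum.inl (v : (linQuiver n).V)))

/-- arrows -/
noncomputable def ar (a : Fin (n - 1)) : NakayamaAlgebra k n t ns ls :=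
  RingQuot.mkAlgHom k _ (FreeAlgebra.ι k (Sum.inr (a : (linQuiver n).A)))

/-- source of an arrow -/
def sr {n : ℕ} (a : Fin (n - 1)) : Fin n := ⟨a.1, by have := a.2; omega⟩
/-- target of an arrow -/
def tg {n : ℕ} (a : Fin (n - 1)) : Fin n := ⟨a.1 + 1, by have := a.2; omega⟩

lemma ed_idem (v) : ed k n t ns ls v * ed k n t ns ls v = ed k n t ns ls v := by
  have := RingQuot.mkAlgHom_rel k (PathAlgRel.idem (k := k) (Q := linQuiver n)
    (R := {p | ∃ i : Fin t, p = linPath n (ns i) (ls i)}) v)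
  rw [map_mul] at this
  exact this

lemma ed_orth (v w) (h : v ≠ w) : ed k n t ns ls v * ed k n t ns ls w = 0 := by
  have := RingQuot.mkAlgHom_rel k (PathAlgRel.orth (k := k) (Q := linQuiver n)
    (R := {p | ∃ i : Fin t, p = linPath n (ns i) (ls i)}) v w h)
  rw [map_mul, map_zero] at this
  exact this

lemma ed_sum : ∑ v, ed k n t ns ls v = 1 := by
  have := RingQuot.mkAlgHom_rel k (PathAlgRel.unit (k := k) (Q := linQuiver n)
    (R := {p | ∃ i : Fin t, p = linPath n (ns i) (ls i)}))
  rw [map_sum, map_one] at this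
  exact this

lemma ed_src (a) : ed k n t ns ls (sr a) * ar k n t ns ls a = ar k n t ns ls a := by
  have := RingQuot.mkAlgHom_rel k (PathAlgRel.source (k := k) (Q := linQuiver n)
    (R := {p | ∃ i : Fin t, p = linPath n (ns i) (ls i)}) a)
  rw [map_mul] at this
  exact this

lemma ed_tgt (a) : ar k n t ns ls a * ed k n t ns ls (tg a) = ar k n t ns ls a := by
  have := RingQuot.mkAlgHom_rel k (PathAlgRel.target (k := k) (Q := linQuiver n)
    (R := {p | ∃ i : Fin t, p = linPath n (ns i) (ls i)}) a)
  rw [map_mul] at this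
  exact this

lemma ed_zero (i : Fin t) : ((linPath n (ns i) (ls i)).map (ar k n t ns ls)).prod = 0 := by
  have := RingQuot.mkAlgHom_rel k (PathAlgRel.zeroRel (k := k) (Q := linQuiver n)
    (R := {p | ∃ i : Fin t, p = linPath n (ns i) (ls i)}) _ ⟨i, rfl⟩)
  rw [map_list_prod, map_zero, List.map_map] at this
  exact this

/-- partial path products -/
def pp {B : Type} [Monoid B] (β : Fin (n - 1) → B) (v : ℕ) : ℕ → B
  | 0 => 1
  | l + 1 => pp β v l * (if h : v + l < n - 1 then β ⟨v + l, h⟩ else 1)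

lemma linPath_prod {B : Type} [Monoid B] (β : Fin (n - 1) → B) (v l : ℕ) :
    ((linPath n v l).map β).prod = pp n β (v - 1) l := by
  induction l with
  | zero => rfl
  | succ l ih =>
    rw [pp, ← ih]
    change (List.map β (List.filterMap (β := Fin (n - 1)) (fun j =>
      if h : v - 1 + j < n - 1 then some ⟨v - 1 + j, h⟩ else none) (List.range (l + 1)))).prod =
      (List.map β (List.filterMap (β := Fin (n - 1)) (fun j =>
      if h : v - 1 + j < n - 1 then some ⟨v - 1 + j, h⟩ else none) (List.range l))).prod * _
    rw [List.range_succ, List.filterMap_append, List.map_append, List.prod_append]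
    congr 1
    by_cases h : v - 1 + l < n - 1
    · rw [dif_pos h]; simp [h]
    · rw [dif_neg h]; simp [h]

lemma ind {motive : NakayamaAlgebra k n t ns ls → Prop}
    (h0 : ∀ r, motive (algebraMap k _ r)) (he : ∀ v, motive (ed k n t ns ls v))
    (ha : ∀ a, motive (ar k n t ns ls a))
    (mul : ∀ a b, motive a → motive b → motive (a * b))
    (add : ∀ a b, motive a → motive b → motive (a + b)) (a) : motive a := by
  obtain ⟨a, rfl⟩ := RingQuot.mkAlgHom_surjective k _ a
  induction a using FreeAlgebra.induction with
  | grade0 r => rw [AlgHom.commutes]; exact h0 r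
  | grade1 x =>
    rcases x with v | a
    · exact he v
    · exact ha a
  | mul a b h1 h2 => rw [map_mul]; exact mul _ _ h1 h2
  | add a b h1 h2 => rw [map_add]; exact add _ _ h1 h2

lemma exists_lift {B : Type} [Ring B] [Algebra k B] (ε : Fin n → B) (β : Fin (n - 1) → B)
    (h1 : ∀ v, ε v * ε v = ε v) (h2 : ∀ v w, v ≠ w → ε v * ε w = 0) (h3 : ∑ v, ε v = 1)
    (h4 : ∀ a, ε (sr a) * β a = β a) (h5 : ∀ a, β a * ε (tg a) = β a)
    (h6 : ∀ i, ((linPath n (ns i) (ls i)).map β).prod = 0) :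
    ∃ ρ : NakayamaAlgebra k n t ns ls →ₐ[k] B, (∀ v, ρ (ed k n t ns ls v) = ε v) ∧
      ∀ a, ρ (ar k n t ns ls a) = β a := by
  let f : FreeAlgebra k ((linQuiver n).V ⊕ (linQuiver n).A) →ₐ[k] B :=
    FreeAlgebra.lift k (Sum.elim ε β)
  have fv : ∀ v, f (FreeAlgebra.ι k (Sum.inl v)) = ε v := fun v => FreeAlgebra.lift_ι_apply _ _
  have fa : ∀ v, f (FreeAlgebra.ι k (Sum.inr v)) = β v := fun v => FreeAlgebra.lift_ι_apply _ _
  have hf : ∀ ⦃x y⦄, PathAlgRel k (linQuiver n) {p | ∃ i : Fin t, p = linPath n (ns i) (ls i)} x y →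
      f x = f y := by
    intro x y h
    cases h with
    | idem v => rw [map_mul, fv]; exact h1 v
    | orth v w h => rw [map_mul, map_zero, fv, fv]; exact h2 v w h
    | unit => rw [map_sum, map_one, ← h3]; exact Finset.sum_congr rfl (fun v _ => fv v)
    | source a => rw [map_mul, fv, fa]; exact h4 a
    | target a => rw [map_mul, fv, fa]; exact h5 a
    | zeroRel p hp =>
      obtain ⟨i, rfl⟩ := hp
      rw [map_list_prod, map_zero, List.map_map, ← h6 i]
      congr 1
      apply List.map_congr_left
      intro a _
      exact fa a
  refine ⟨RingQuot.liftAlgHom k ⟨f, hf⟩, fun v => ?_, fun a => ?_⟩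
  · exact (RingQuot.liftAlgHom_mkAlgHom_apply (S := k) f hf _).trans (fv v)
  · exact (RingQuot.liftAlgHom_mkAlgHom_apply (S := k) f hf _).trans (fa a)

end Nak
end S13

section S14
open CategoryTheory MulOpposite
open scoped ModuleCat

namespace Nak
variable (k : Type) [Field k] (n t : ℕ) (ns ls : Fin t → ℕ)

/-- linear edges -/
abbrev LE (n : ℕ) : Fin n → Fin n → Prop := fun u v => v.1 = u.1 + 1
/-- zero relations -/
abbrev LZ {t : ℕ} (n : ℕ) (ns ls : Fin t → ℕ) : Fin n → Fin n → Prop :=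
  fun u v => ∃ i, u.1 + 1 = ns i ∧ v.1 + 1 = ns i + ls i

variable {k n t ns ls}

/-- the vertex spaces -/
def sm (M : ModuleCat.{0} (NakayamaAlgebra k n t ns ls)ᵐᵒᵖ) (v : Fin n) : Submodule k M where
  carrier := {m | op (ed k n t ns ls v) • m = m}
  add_mem' := fun {a b} ha hb => by
    change _ • (a + b) = _
    rw [smul_add]; exact congrArg₂ _ ha hb
  zero_mem' := smul_zero _
  smul_mem' := fun c x hx => by
    change _ • (c • x) = _
    rw [smul_comm]; exact congrArg _ hx

/-- arrow action -/
noncomputable def am (M : ModuleCat.{0} (NakayamaAlgebra k n t ns ls)ᵐᵒᵖ) (a : Fin (n - 1)) :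
    M →ₗ[k] M where
  toFun m := op (ar k n t ns ls a) • m
  map_add' := smul_add _
  map_smul' c x := smul_comm _ c x

lemma am_mem (M : ModuleCat.{0} (NakayamaAlgebra k n t ns ls)ᵐᵒᵖ) (a : Fin (n - 1)) (m) :
    am M a m ∈ sm M (tg a) := by
  change op (ed k n t ns ls (tg a)) • op (ar k n t ns ls a) • m = op (ar k n t ns ls a) • m
  rw [← mul_smul, ← op_mul, ed_tgt]

/-- the representation of a module -/
noncomputable def mpr (M : ModuleCat.{0} (NakayamaAlgebra k n t ns ls)ᵐᵒᵖ) : PreRep k (Fin n) (LE n) where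
  X v := sm M v
  map u v h := ((am M ⟨u.1, by have := v.2; omega⟩).comp (sm M u).subtype).codRestrict _ (by
    intro c
    have h2 : tg ⟨u.1, by have := v.2; omega⟩ = v := Fin.ext h.symm
    have h3 := am_mem M ⟨u.1, by have := v.2; omega⟩ c.1
    exact (congrArg (fun w => am M ⟨u.1, by have := v.2; omega⟩ c.1 ∈ sm M w) h2).mp h3)

lemma mpr_reach (M : ModuleCat.{0} (NakayamaAlgebra k n t ns ls)ᵐᵒᵖ) (u : Fin n)
    (x : (mpr M).X u) (w) (y : (mpr M).X w) (h : (mpr M).Reach x w y) :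
    ∃ d, w.1 = u.1 + d ∧ (Subtype.val y : M) = op (pp n (ar k n t ns ls) u.1 d) •
      (Subtype.val x : M) := by
  induction h with
  | refl => exact ⟨0, rfl, by rw [pp, op_one, one_smul]⟩
  | step v w y h _ ih =>
    obtain ⟨d, h1, h2⟩ := ih
    refine ⟨d + 1, by change w.1 = v.1 + 1 at h; omega, ?_⟩
    have hw := w.2
    change w.1 = v.1 + 1 at h
    rw [pp, dif_pos (by omega), op_mul, mul_smul, ← h2]
    change op (ar k n t ns ls ⟨v.1, _⟩) • (Subtype.val y : M) = _
    simp only [h1]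

/-- the representation of a module -/
noncomputable def mrep (hn : ∀ i, 1 ≤ ns i) (hl : ∀ i, 1 ≤ ls i)
    (M : ModuleCat.{0} (NakayamaAlgebra k n t ns ls)ᵐᵒᵖ) :
    QRep k (Fin n) (LE n) (LZ n ns ls) where
  toPreRep := mpr M
  rel u v h x y hxy := by
    obtain ⟨i, h1, h2⟩ := h
    obtain ⟨d, h3, h4⟩ := mpr_reach M u x v y hxy
    apply Subtype.ext
    rw [h4]
    have := ed_zero k n t ns ls i
    have := (linPath_prod n (ar k n t ns ls) (ns i) (ls i)).symm.trans this
    rw [show ns i - 1 = u.1 by omega, show ls i = d by have := hn i; omega] at this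
    rw [this, MulOpposite.op_zero, zero_smul]
    rfl

lemma lin_comm {M N : ModuleCat.{0} (NakayamaAlgebra k n t ns ls)ᵐᵒᵖ} (f : M ⟶ N) (c : k) (m : M) :
    f.hom (c • m) = c • f.hom m := by
  rw [← algebraMap_smul (NakayamaAlgebra k n t ns ls)ᵐᵒᵖ c m, map_smul, algebraMap_smul]

/-- the functor -/
noncomputable def mF (hn : ∀ i, 1 ≤ ns i) (hl : ∀ i, 1 ≤ ls i) :
    ModuleCat.{0} (NakayamaAlgebra k n t ns ls)ᵐᵒᵖ ⥤ QRep k (Fin n) (LE n) (LZ n ns ls) where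
  obj M := mrep hn hl M
  map {M N} f := ⟨fun v =>
    { toFun := fun x => ⟨f.hom x.1, by
        change _ • f.hom _ = _
        rw [← map_smul]; exact congrArg _ x.2⟩
      map_add' := fun x y => Subtype.ext (map_add f.hom x.1 y.1)
      map_smul' := fun c x => Subtype.ext (lin_comm f c x.1) },
    fun u v h x => Subtype.ext (map_smul f.hom (op (ar k n t ns ls _)) x.1)⟩

instance (hn : ∀ i, 1 ≤ ns i) (hl : ∀ i, 1 ≤ ls i) :
    (mF (k := k) (n := n) (ns := ns) (ls := ls) hn hl).Additive := ⟨rfl⟩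

lemma ed_mem (M : ModuleCat.{0} (NakayamaAlgebra k n t ns ls)ᵐᵒᵖ) (v : Fin n) (m : M) :
    op (ed k n t ns ls v) • m ∈ sm M v := by
  change op (ed k n t ns ls v) • op (ed k n t ns ls v) • m = op (ed k n t ns ls v) • m
  rw [← mul_smul, ← op_mul, ed_idem]

lemma ed_decomp (M : ModuleCat.{0} (NakayamaAlgebra k n t ns ls)ᵐᵒᵖ) (m : M) :
    m = ∑ v, op (ed k n t ns ls v) • m := by
  rw [← Finset.sum_smul, ← Finset.op_sum, ed_sum, op_one, one_smul]

instance mF_faithful (hn : ∀ i, 1 ≤ ns i) (hl : ∀ i, 1 ≤ ls i) :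
    (mF (k := k) (n := n) (ns := ns) (ls := ls) hn hl).Faithful := ⟨by
  intro M N f g h
  ext m
  rw [ed_decomp M m, map_sum, map_sum]
  refine Finset.sum_congr rfl (fun v _ => ?_)
  exact congrArg (fun z => Subtype.val (QRep.RHom.app z v (⟨_, ed_mem M v m⟩ : sm M v))) h⟩

instance mF_full (hn : ∀ i, 1 ≤ ns i) (hl : ∀ i, 1 ≤ ls i) :
    (mF (k := k) (n := n) (ns := ns) (ls := ls) hn hl).Full := ⟨by
  intro M N f
  let p : ∀ v, M →ₗ[k] sm M v := fun v =>
    { toFun := fun m => ⟨_, ed_mem M v m⟩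
      map_add' := fun x y => Subtype.ext (smul_add _ _ _)
      map_smul' := fun c x => Subtype.ext (smul_comm _ c x) }
  let f' : ∀ v, sm M v →ₗ[k] sm N v := fun v => QRep.RHom.app f v
  let g : M →ₗ[k] N := ∑ v, (sm N v).subtype.comp ((f' v).comp (p v))
  have gapp : ∀ m, g m = ∑ v, (f' v (p v m)).1 := fun m => by
    rw [LinearMap.sum_apply]; rfl
  have gv : ∀ v (x : sm M v), g x.1 = (f' v x).1 := by
    intro v x
    rw [gapp, Finset.sum_eq_single v]
    · have : p v x.1 = x := Subtype.ext x.2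
      rw [this]
    · intro w _ hw
      have : p w x.1 = 0 := by
        apply Subtype.ext
        change op (ed k n t ns ls w) • x.1 = 0
        have hx : op (ed k n t ns ls v) • x.1 = x.1 := x.2
        rw [← hx, ← mul_smul, ← op_mul, ed_orth k n t ns ls _ _ hw.symm, MulOpposite.op_zero, zero_smul]
      rw [this, map_zero]; rfl
    · simp
  have key : ∀ (a : NakayamaAlgebra k n t ns ls) m, g (op a • m) = op a • g m := by
    intro a
    induction a using ind with
    | h0 r =>
      intro m
      have e1 : ∀ (P : ModuleCat.{0} (NakayamaAlgebra k n t ns ls)ᵐᵒᵖ) (m : P),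
          op (algebraMap k (NakayamaAlgebra k n t ns ls) r) • m = r • m :=
        fun P m => algebraMap_smul (NakayamaAlgebra k n t ns ls)ᵐᵒᵖ r m
      rw [e1, e1, map_smul]
    | he v =>
      intro m
      have h1 := gv v ⟨_, ed_mem M v m⟩
      refine h1.trans ?_
      rw [gapp, Finset.smul_sum, Finset.sum_eq_single v]
      · exact ((f' v (p v m)).2).symm
      · intro w _ hw
        have hx : op (ed k n t ns ls w) • (f' w (p w m)).1 = (f' w (p w m)).1 := (f' w (p w m)).2
        rw [← hx, ← mul_smul, ← op_mul, ed_orth k n t ns ls _ _ hw, MulOpposite.op_zero, zero_smul]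
      · simp
    | ha a =>
      intro m
      have e0 : ∀ (P : ModuleCat.{0} (NakayamaAlgebra k n t ns ls)ᵐᵒᵖ) (m : P),
          op (ar k n t ns ls a) • m = op (ar k n t ns ls a) • op (ed k n t ns ls (sr a)) • m := by
        intro P m; rw [← mul_smul, ← op_mul, ed_src]
      have h1 := gv (tg a) ⟨_, am_mem M a (op (ed k n t ns ls (sr a)) • m)⟩
      have h2 := f.comm (sr a) (tg a) rfl (p (sr a) m)
      rw [e0 M m]
      refine h1.trans ?_
      refine (congrArg Subtype.val h2).trans ?_
      change op (ar k n t ns ls a) • (f' (sr a) (p (sr a) m)).1 = _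
      rw [gapp, Finset.smul_sum, Finset.sum_eq_single (sr a)]
      · intro w _ hw
        have hx : op (ed k n t ns ls w) • (f' w (p w m)).1 = (f' w (p w m)).1 := (f' w (p w m)).2
        rw [e0, ← hx, ← mul_smul (op (ed _ _ _ _ _ (sr a))), ← op_mul,
          ed_orth k n t ns ls _ _ hw, MulOpposite.op_zero, zero_smul, smul_zero]
      · simp
    | mul a b h1 h2 => intro m; rw [op_mul, mul_smul, mul_smul, h2, h1]
    | add a b h1 h2 => intro m; rw [MulOpposite.op_add, add_smul, add_smul, map_add, h2, h1]
  refine ⟨ModuleCat.ofHom ⟨⟨g, map_add g⟩, fun a m => key (unop a) m⟩, ?_⟩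
  apply QRep.hom_ext
  intro v x
  apply Subtype.ext
  exact gv v x⟩

end Nak
end S14

section S15
open CategoryTheory MulOpposite
open scoped ModuleCat

namespace Nak
variable {k : Type} [Field k] {n t : ℕ} {ns ls : Fin t → ℕ}

/-- arrow operators -/
noncomputable def tT (R : QRep k (Fin n) (LE n) (LZ n ns ls)) (a : Fin (n - 1)) :
    Module.End k (∀ v, R.X v) :=
  (LinearMap.single k R.X (tg a)).comp ((R.map (sr a) (tg a) rfl).comp (LinearMap.proj (sr a)))

/-- vertex operators -/
noncomputable def tE (R : QRep k (Fin n) (LE n) (LZ n ns ls)) (v : Fin n) :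
    Module.End k (∀ v, R.X v) :=
  (LinearMap.single k R.X v).comp (LinearMap.proj v)

lemma tT_apply (R : QRep k (Fin n) (LE n) (LZ n ns ls)) (a f) :
    tT R a f = Pi.single (tg a) (R.map (sr a) (tg a) rfl (f (sr a))) := rfl

lemma tE_apply (R : QRep k (Fin n) (LE n) (LZ n ns ls)) (v f) :
    tE R v f = Pi.single v (f v) := rfl

lemma pp_reach (R : QRep k (Fin n) (LE n) (LZ n ns ls)) (u d : ℕ) (h : u + d < n)
    (f : ∀ v, R.X v) :
    R.Reach (f ⟨u, by omega⟩) ⟨u + d, h⟩ (unop (pp n (fun a => op (tT R a)) u d) f ⟨u + d, h⟩) ∧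
    (1 ≤ d → ∀ w, w ≠ ⟨u + d, h⟩ → unop (pp n (fun a => op (tT R a)) u d) f w = 0) := by
  induction d with
  | zero => exact ⟨PreRep.Reach.refl, by simp⟩
  | succ d ih =>
    obtain ⟨ih, -⟩ := ih (by omega)
    have e : unop (pp n (fun a => op (tT R a)) u (d + 1)) f = Pi.single ⟨u + d + 1, h⟩
        (R.map ⟨u + d, by omega⟩ ⟨u + d + 1, h⟩ rfl
          (unop (pp n (fun a => op (tT R a)) u d) f ⟨u + d, by omega⟩)) := by
      rw [pp, dif_pos (by omega)]
      rfl
    rw [e]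
    constructor
    · have := PreRep.Reach.step (⟨u + d, by omega⟩ : Fin n) (⟨u + d + 1, h⟩ : Fin n) _ rfl ih
      exact (congrArg (fun z => R.Reach (f ⟨u, by omega⟩) ⟨u + d + 1, h⟩ z)
        (Pi.single_eq_same (M := R.X) (⟨u + d + 1, h⟩ : Fin n) _)).mpr this
    · intro _ w hw
      exact Pi.single_eq_of_ne (M := R.X) hw _

lemma exists_rho (hn : ∀ i, 1 ≤ ns i) (hl : ∀ i, 1 ≤ ls i) (he : ∀ i, ns i + ls i ≤ n)
    (R : QRep k (Fin n) (LE n) (LZ n ns ls)) :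
    ∃ ρ : NakayamaAlgebra k n t ns ls →ₐ[k] (Module.End k (∀ v, R.X v))ᵐᵒᵖ,
      (∀ v, ρ (ed k n t ns ls v) = op (tE R v)) ∧ ∀ a, ρ (ar k n t ns ls a) = op (tT R a) := by
  apply exists_lift
  · intro v
    rw [← op_mul]
    congr 1
    apply LinearMap.ext; intro f
    change tE R v (tE R v f) = _
    rw [tE_apply R v f, tE_apply, Pi.single_eq_same]
  · intro v w h
    rw [← op_mul, ← MulOpposite.op_zero]
    congr 1
    apply LinearMap.ext; intro f
    change tE R w (tE R v f) = _
    rw [tE_apply R v f, tE_apply, Pi.single_eq_of_ne h.symm, Pi.single_zero]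
    rfl
  · rw [← Finset.op_sum, ← op_one]
    congr 1
    apply LinearMap.ext
    intro f
    rw [LinearMap.sum_apply]
    exact Finset.univ_sum_single f
  · intro a
    rw [← op_mul]
    congr 1
    apply LinearMap.ext; intro f
    change tT R a (tE R _ f) = _
    rw [tE_apply, tT_apply, tT_apply, Pi.single_eq_same]
  · intro a
    rw [← op_mul]
    congr 1
    apply LinearMap.ext; intro f
    change tE R _ (tT R _ f) = _
    rw [tE_apply, tT_apply, Pi.single_eq_same]
  · intro i
    have h1 := hn i
    have h2 := hl i
    have h3 := he i
    rw [linPath_prod, ← MulOpposite.unop_inj, unop_zero]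
    apply LinearMap.ext; intro f
    obtain ⟨h4, h5⟩ := pp_reach R (ns i - 1) (ls i) (by omega) f
    funext w
    by_cases hw : w = ⟨ns i - 1 + ls i, by omega⟩
    · subst hw
      exact R.rel _ _ ⟨i, by simp; omega, by simp; omega⟩ _ _ h4
    · exact h5 h2 w hw

lemma smul_eq (M : ModuleCat.{0} (NakayamaAlgebra k n t ns ls)ᵐᵒᵖ) (c : k) (x : M) :
    c • x = algebraMap k (NakayamaAlgebra k n t ns ls)ᵐᵒᵖ c • x :=
  (algebraMap_smul (NakayamaAlgebra k n t ns ls)ᵐᵒᵖ c x).symm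

lemma mF_essSurj (hn : ∀ i, 1 ≤ ns i) (hl : ∀ i, 1 ≤ ls i) (he : ∀ i, ns i + ls i ≤ n) :
    (mF (k := k) (n := n) (ns := ns) (ls := ls) hn hl).EssSurj := ⟨by
  intro R
  obtain ⟨ρ, hv, ha⟩ := exists_rho hn hl he R
  let φ : (NakayamaAlgebra k n t ns ls)ᵐᵒᵖ →ₐ[k] Module.End k (∀ v, R.X v) := AlgHom.opComm ρ
  have φv : ∀ v, φ (op (ed k n t ns ls v)) = tE R v := fun v => congrArg unop (hv v)
  have φa : ∀ a, φ (op (ar k n t ns ls a)) = tT R a := fun v => congrArg unop (ha v)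
  letI : Module (NakayamaAlgebra k n t ns ls)ᵐᵒᵖ (∀ v, R.X v) := Module.compHom _ φ.toRingHom
  let W : ModuleCat.{0} (NakayamaAlgebra k n t ns ls)ᵐᵒᵖ :=
    ModuleCat.of (NakayamaAlgebra k n t ns ls)ᵐᵒᵖ (∀ v, R.X v)
  have hsm : ∀ (a : (NakayamaAlgebra k n t ns ls)ᵐᵒᵖ) (x : W),
    (a • x : W) = φ a (x : ∀ v, R.X v) := fun a x => rfl
  have hk : ∀ (c : k) (x : W) v, (algebraMap k (NakayamaAlgebra k n t ns ls)ᵐᵒᵖ c • x : W) v =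
      c • ((x : ∀ v, R.X v) v) := by
    intro c x v
    rw [hsm, φ.commutes]
    rfl
  have mem : ∀ v (x : W), x ∈ sm W v ↔ Pi.single v ((x : ∀ v, R.X v) v) = (x : ∀ v, R.X v) := by
    intro v x
    change (op (ed k n t ns ls v) • x : W) = x ↔ _
    rw [hsm, φv]
    rfl
  let e : ∀ v, sm W v ≃ₗ[k] R.X v := fun v =>
    { toFun := fun x => (x.1 : ∀ v, R.X v) v
      map_add' := fun x y => rfl
      map_smul' := fun c x => (congrFun (smul_eq W c x.1) v).trans (hk c x.1 v)
      invFun := fun y => ⟨(Pi.single v y : ∀ v, R.X v), (mem v _).2 (by rw [Pi.single_eq_same])⟩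
      left_inv := fun x => Subtype.ext ((mem v x.1).1 x.2)
      right_inv := fun y => Pi.single_eq_same (M := R.X) v y }
  refine ⟨W, ⟨QRep.mkIso e ?_⟩⟩
  intro u v hh x
  have huv : v.1 = u.1 + 1 := hh
  have hlt : u.1 < n - 1 := by have := v.2; omega
  obtain rfl : tg ⟨u.1, hlt⟩ = v := Fin.ext huv.symm
  change (op (ar k n t ns ls ⟨u.1, hlt⟩) • (Subtype.val x : W) : W) (tg ⟨u.1, hlt⟩) = _
  rw [hsm, φa, tT_apply, Pi.single_eq_same]
  rfl⟩

theorem bridge (hn : ∀ i, 1 ≤ ns i) (hl : ∀ i, 1 ≤ ls i) (he : ∀ i, ns i + ls i ≤ n) :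
    DEq (ModuleCat.{0} (NakayamaAlgebra k n t ns ls)ᵐᵒᵖ) (QRep k (Fin n) (LE n) (LZ n ns ls)) := by
  haveI := mF_essSurj (k := k) hn hl he
  haveI : (mF (k := k) (n := n) (ns := ns) (ls := ls) hn hl).IsEquivalence := {}
  exact DEq.of_equiv (mF (k := k) (n := n) (ns := ns) (ls := ls) hn hl).asEquivalence
    (he := inferInstanceAs (mF (k := k) (n := n) (ns := ns) (ls := ls) hn hl).Additive)

end Nak
end S15

section S16

namespace Orient
variable {k : Type} [Field k] {V : Type}

/-- orientation given by a height function -/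
def EH (G : SimpleGraph V) (h : V → ℤ) (u v : V) : Prop := G.Adj u v ∧ h v = h u + 1

/-- no relations -/
abbrev Z0 : V → V → Prop := fun _ _ => False

/-- valid height functions -/
def Valid (G : SimpleGraph V) (h : V → ℤ) : Prop :=
  ∀ u v, G.Adj u v → h v = h u + 1 ∨ h u = h v + 1

lemma sink_move [Finite V] (G : SimpleGraph V) (h h1 : V → ℤ) (v : V)
    (hv : ∀ u, G.Adj u v → h v = h u + 1) (h1v : h1 v = h v - 2) (h1u : ∀ u, u ≠ v → h1 u = h u) :
    DEq (QRep k V (EH G h) Z0) (QRep k V (EH G h1) Z0) := by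
  classical
  let φ : {u : V // u ≠ v} ⊕ Unit → V := Sum.elim Subtype.val (fun _ => v)
  have hφ : Function.Injective φ := by
    rintro (⟨a, ha⟩ | a) (⟨b, hb⟩ | b) hab
    · exact congrArg Sum.inl (Subtype.ext hab)
    · exact (ha hab).elim
    · exact (hb hab.symm).elim
    · rfl
  have hs : ∀ w, ∃ u, φ u = w := fun w => by
    by_cases hw : w = v
    · exact ⟨.inr (), hw.symm⟩
    · exact ⟨.inl ⟨w, hw⟩, rfl⟩
  have m := Glue.move1 (k := k) (EL := fun a b : {u : V // u ≠ v} => EH G h a.1 b.1)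
    (ZL := Z0) (fun a => G.Adj a.1 v)
  refine (Restr.restr_deq φ hφ ?_ ?_ ?_).trans (m.trans (Restr.restr_deq φ hφ ?_ ?_ ?_).symm)
  · rintro (⟨a, ha⟩ | a) (⟨b, hb⟩ | b)
    · exact Iff.rfl
    · exact ⟨fun hh => ⟨hh, hv _ hh⟩, fun hh => hh.1⟩
    · refine ⟨fun hh => hh.elim, fun hh => ?_⟩
      have h2 : h b = h v + 1 := hh.2
      have := hv b (SimpleGraph.Adj.symm hh.1)
      omega
    · exact ⟨fun hh => hh.elim, fun hh => G.loopless.irrefl _ hh.1⟩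
  · rintro (⟨a, ha⟩ | a) (⟨b, hb⟩ | b) <;> exact Iff.rfl
  · intro w hw
    obtain ⟨u, hu⟩ := hs w
    exact (hw u hu).elim
  · rintro (⟨a, ha⟩ | a) (⟨b, hb⟩ | b)
    · change EH G h a b ↔ EH G h1 a b
      rw [EH, EH, h1u a ha, h1u b hb]
    · refine ⟨fun hh => hh.elim, fun hh => ?_⟩
      have h2 : h1 v = h1 a + 1 := hh.2
      have := hv a hh.1
      have := h1u a ha
      omega
    · refine ⟨fun hh => ⟨SimpleGraph.Adj.symm hh, ?_⟩, fun hh => SimpleGraph.Adj.symm hh.1⟩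
      have := hv b hh
      have := h1u b hb
      change h1 b = h1 v + 1
      omega
    · exact ⟨fun hh => hh.elim, fun hh => G.loopless.irrefl _ hh.1⟩
  · rintro (⟨a, ha⟩ | a) (⟨b, hb⟩ | b) <;> exact Iff.rfl
  · intro w hw
    obtain ⟨u, hu⟩ := hs w
    exact (hw u hu).elim

lemma orient_even [Fintype V] (G : SimpleGraph V) (N : ℕ) : ∀ (h h' : V → ℤ), Valid G h →
    Valid G h' → (∀ v, Even (h v - h' v)) → ∑ v, (h v - h' v).natAbs ≤ N →
    DEq (QRep k V (EH G h) Z0) (QRep k V (EH G h') Z0) := by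
  classical
  induction N with
  | zero =>
    intro h h' _ _ _ hN
    have : h = h' := by
      funext v
      have h0 := Finset.sum_eq_zero_iff.1 (Nat.le_zero.1 hN) v (Finset.mem_univ v)
      omega
    subst this
    exact DEq.refl _
  | succ N ih =>
    have key : ∀ (h h' : V → ℤ), Valid G h →
        Valid G h' → (∀ v, Even (h v - h' v)) → ∑ v, (h v - h' v).natAbs ≤ N + 1 →
        (∃ v, h' v < h v) → DEq (QRep k V (EH G h) Z0) (QRep k V (EH G h') Z0) := by
      intro h h' hV hV' he hN hex
      obtain ⟨v0, hv0⟩ := hex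
      obtain ⟨v, hvm, hvmax⟩ := Finset.exists_max_image
        (Finset.univ.filter (fun v => h' v < h v)) h ⟨v0, by simpa using hv0⟩
      have hlt : h' v < h v := by simpa using hvm
      have hmax : ∀ u, h' u < h u → h u ≤ h v := fun u hu => hvmax u (by simpa using hu)
      have hs : ∀ u, G.Adj u v → h v = h u + 1 := by
        intro u hu
        rcases hV u v hu with h1 | h1
        · exact h1
        · have h2 := hV' u v hu
          have h3 := hmax u
          omega
      have ev := he v
      rw [Int.even_iff] at ev
      let h1 : V → ℤ := Function.update h v (h v - 2)
      have h1v : h1 v = h v - 2 := Function.update_self _ _ _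
      have h1u : ∀ u, u ≠ v → h1 u = h u := fun u hu => Function.update_of_ne hu _ _
      refine (sink_move G h h1 v hs h1v h1u).trans (ih h1 h' ?_ hV' ?_ ?_)
      · intro a b hab
        by_cases ha : a = v
        · subst ha
          have hb : b ≠ a := fun e => G.loopless.irrefl _ (e ▸ hab)
          have := hs b (SimpleGraph.Adj.symm hab)
          have := h1u b hb
          omega
        · by_cases hb : b = v
          · subst hb
            have := hs a hab
            have := h1u a ha
            omega
          · rw [h1u a ha, h1u b hb]; exact hV a b hab
      · intro u
        by_cases hu : u = v
        · subst hu; rw [h1v, Int.even_iff]; omega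
        · rw [h1u u hu]; exact he u
      · rw [← Finset.add_sum_erase _ _ (Finset.mem_univ v)] at hN ⊢
        have : ∑ x ∈ Finset.univ.erase v, (h1 x - h' x).natAbs =
            ∑ x ∈ Finset.univ.erase v, (h x - h' x).natAbs :=
          Finset.sum_congr rfl (fun u hu => by rw [h1u u (Finset.ne_of_mem_erase hu)])
        rw [this, h1v]
        omega
    intro h h' hV hV' he hN
    by_cases hex : ∃ v, h' v < h v
    · exact key h h' hV hV' he hN hex
    · by_cases hex' : ∃ v, h v < h' v
      · refine (key h' h hV' hV (fun v => ?_) ?_ hex').symm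
        · have := he v
          rw [Int.even_iff] at this ⊢
          omega
        · refine le_trans (le_of_eq (Finset.sum_congr rfl (fun v _ => ?_))) hN
          omega
      · have : h = h' := by
          funext v
          by_contra hne
          rcases lt_or_gt_of_ne hne with h1 | h1
          · exact hex' ⟨v, h1⟩
          · exact hex ⟨v, h1⟩
        subst this
        exact DEq.refl _

theorem orient [Finite V] (G : SimpleGraph V) (h h' : V → ℤ) (hV : Valid G h)
    (hV' : Valid G h') : DEq (QRep k V (EH G h) Z0) (QRep k V (EH G h') Z0) := by
  classical
  haveI := Fintype.ofFinite V
  let h2 : V → ℤ := fun v => if Even (h v - h' v) then h' v else h' v + 1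
  have hadj : ∀ u v, G.Adj u v → (h2 u = h' u ∧ h2 v = h' v) ∨
      (h2 u = h' u + 1 ∧ h2 v = h' v + 1) := by
    intro u v huv
    have a1 := hV u v huv
    have a2 := hV' u v huv
    simp only [h2, Int.even_iff]
    split_ifs <;> omega
  have hE : EH G h2 = EH G h' := by
    funext u v
    apply propext
    refine and_congr_right (fun huv => ?_)
    have := hadj u v huv
    omega
  rw [← hE]
  refine orient_even G _ h h2 hV ?_ ?_ le_rfl
  · intro u v huv
    have := hadj u v huv
    have := hV' u v huv
    omega
  · intro v
    simp only [h2, Int.even_iff]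
    split_ifs <;> omega

/-- Isomorphic graphs. -/
theorem orient_iso {V' : Type} [Finite V] {G : SimpleGraph V} {G' : SimpleGraph V'} (e : G' ≃g G)
    (h : V → ℤ) (h' : V' → ℤ) (hV : Valid G h) (hV' : Valid G' h') :
    DEq (QRep k V (EH G h) Z0) (QRep k V' (EH G' h') Z0) := by
  haveI : Finite V' := Finite.of_equiv V e.symm.toEquiv
  refine DEq.trans (Restr.restr_deq (E' := EH G' (h ∘ e)) (Z' := Z0) e e.injective ?_ ?_ ?_)
    (orient G' (h ∘ e) h' ?_ hV')
  · intro u v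
    exact and_congr_left (fun _ => e.map_adj_iff.symm)
  · intro u v; exact Iff.rfl
  · intro v hv
    exact (hv (e.symm v) (e.apply_symm_apply v)).elim
  · intro u v huv
    exact hV _ _ (e.map_adj_iff.2 huv)

end Orient
end S16

section S17

namespace Stg
variable {k : Type} [Field k]

/-- numerical data -/
structure Dat (n T : ℕ) (a l : ℕ → ℕ) : Prop where
  aT : a T = n
  pos : 1 ≤ a 0
  l2 : ∀ i, i < T → 2 ≤ l i
  sep : ∀ i, i < T → a i + l i ≤ a (i + 1) + 1

lemma Dat.mono {n T : ℕ} {a l : ℕ → ℕ} (D : Dat n T a l) {i j : ℕ} (hij : i < j) (hj : j ≤ T) :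
    a i + l i ≤ a j + 1 := by
  induction j with
  | zero => omega
  | succ j ih =>
    rcases Nat.lt_succ_iff_lt_or_eq.1 hij with h | h
    · have h1 := ih h (by omega)
      have h2 := D.sep j (by omega)
      have h3 := D.l2 j (by omega)
      omega
    · subst h; exact D.sep i (by omega)

lemma Dat.lt {n T : ℕ} {a l : ℕ → ℕ} (D : Dat n T a l) {i j : ℕ} (hij : i < j) (hj : j ≤ T) :
    a i < a j := by
  have h1 := D.mono hij hj
  have h2 := D.l2 i (by omega)
  omega

/-- edges at stage `s` -/
def SE (a l : ℕ → ℕ) (s i j : ℕ) : Prop :=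
  (j = i + 1 ∧ ∀ t, t < s → i ≠ a t) ∨ ∃ t, t < s ∧ i = a t + l t - 1 ∧ j = a t

/-- relations at stage `s` -/
def SZ (n T : ℕ) (a l : ℕ → ℕ) (s i j : ℕ) : Prop :=
  (i = j ∧ (i = 0 ∨ n < i)) ∨ ∃ t, s ≤ t ∧ t < T ∧ i = a t ∧ j = a t + l t

lemma stage {n T : ℕ} {a l : ℕ → ℕ} (D : Dat n T a l) (s : ℕ) (hs : s < T) :
    DEq (QRep k ℕ (SE a l s) (SZ n T a l s)) (QRep k ℕ (SE a l (s + 1)) (SZ n T a l (s + 1))) := by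
  have ls2 := D.l2 s hs
  have pre1 : ∀ t, t < s → a t < a s := fun t ht => D.lt ht hs.le
  have pre2 : ∀ t, t < s → a t + l t ≤ a s + 1 := fun t ht => D.mono ht hs.le
  have post1 : ∀ t, s ≤ t → t < T → t = s ∨ (a s < a t ∧ a s + l s ≤ a t + 1) := fun t h1 h2 => by
    rcases Nat.eq_or_lt_of_le h1 with h | h
    · exact .inl h.symm
    · exact .inr ⟨D.lt h h2.le, D.mono h h2.le⟩
  have hn := D.mono hs le_rfl
  rw [D.aT] at hn
  let φ : {v : ℕ // v ≤ a s} ⊕ ℕ → ℕ := Sum.elim Subtype.val (fun m => a s + 1 + m)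
  have hφ : Function.Injective φ := by
    rintro (⟨x, hx⟩ | x) (⟨y, hy⟩ | y) hxy
    · exact congrArg Sum.inl (Subtype.ext hxy)
    · change x = a s + 1 + y at hxy; omega
    · change a s + 1 + x = y at hxy; omega
    · change a s + 1 + x = a s + 1 + y at hxy
      exact congrArg Sum.inr (by omega)
  have hsur : ∀ w, ∃ u, φ u = w := fun w => by
    by_cases hw : w ≤ a s
    · exact ⟨.inl ⟨w, hw⟩, rfl⟩
    · refine ⟨.inr (w - a s - 1), ?_⟩
      change a s + 1 + (w - a s - 1) = w
      omega
  have m := Glue.move2 (k := k) (EL := fun x y : {v : ℕ // v ≤ a s} => SE a l s x.1 y.1)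
    (ZL := fun x y : {v : ℕ // v ≤ a s} => SZ n T a l s x.1 y.1)
    (ZM := fun i j => SZ n T a l (s + 1) (a s + 1 + i) (a s + 1 + j)) ⟨a s, le_rfl⟩ (l s - 2) (by
      rintro i j (⟨h1, h2⟩ | ⟨t, h1, h2, h3, h4⟩)
      · omega
      · have := post1 t (by omega) h2
        have := D.l2 t h2
        omega)
  refine (Restr.restr_deq φ hφ ?_ ?_ ?_).trans (m.trans (Restr.restr_deq φ hφ ?_ ?_ ?_).symm)
  · rintro (⟨x, hx⟩ | x) (⟨y, hy⟩ | y)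
    · exact Iff.rfl
    · change ((⟨x, hx⟩ : {v : ℕ // v ≤ a s}) = ⟨a s, le_rfl⟩ ∧ y = 0) ↔ SE a l s x (a s + 1 + y)
      rw [Subtype.mk.injEq]
      constructor
      · rintro ⟨rfl, rfl⟩
        exact .inl ⟨rfl, fun t ht => (pre1 t ht).ne'⟩
      · rintro (⟨h1, h2⟩ | ⟨t, h1, h2, h3⟩)
        · omega
        · have := pre1 t h1; omega
    · change False ↔ SE a l s (a s + 1 + x) y
      refine ⟨fun h => h.elim, ?_⟩
      rintro (⟨h1, h2⟩ | ⟨t, h1, h2, h3⟩)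
      · omega
      · have := pre2 t h1; omega
    · change y = x + 1 ↔ SE a l s (a s + 1 + x) (a s + 1 + y)
      constructor
      · rintro rfl
        exact .inl ⟨rfl, fun t ht => by have := pre1 t ht; omega⟩
      · rintro (⟨h1, h2⟩ | ⟨t, h1, h2, h3⟩)
        · omega
        · have := pre1 t h1; omega
  · rintro (⟨x, hx⟩ | x) (⟨y, hy⟩ | y)
    · exact Iff.rfl
    · change ((⟨x, hx⟩ : {v : ℕ // v ≤ a s}) = ⟨a s, le_rfl⟩ ∧ y = l s - 2 + 1) ↔
        SZ n T a l s x (a s + 1 + y)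
      rw [Subtype.mk.injEq]
      constructor
      · rintro ⟨rfl, rfl⟩
        exact .inr ⟨s, le_rfl, hs, rfl, by omega⟩
      · rintro (⟨h1, h2⟩ | ⟨t, h1, h2, h3, h4⟩)
        · omega
        · rcases post1 t h1 h2 with rfl | h5 <;> omega
    · change False ↔ SZ n T a l s (a s + 1 + x) y
      refine ⟨fun h => h.elim, ?_⟩
      rintro (⟨h1, h2⟩ | ⟨t, h1, h2, h3, h4⟩) <;> omega
    · change SZ n T a l (s + 1) (a s + 1 + x) (a s + 1 + y) ↔ SZ n T a l s (a s + 1 + x) (a s + 1 + y)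
      constructor
      · rintro (h | ⟨t, h1, h2, h3, h4⟩)
        · exact .inl h
        · exact .inr ⟨t, by omega, h2, h3, h4⟩
      · rintro (h | ⟨t, h1, h2, h3, h4⟩)
        · exact .inl h
        · refine .inr ⟨t, ?_, h2, h3, h4⟩
          rcases post1 t h1 h2 with rfl | h5
          · omega
          · by_contra h6
            obtain rfl : t = s := by omega
            omega
  · intro w hw
    obtain ⟨u, hu⟩ := hsur w
    exact (hw u hu).elim
  · rintro (⟨x, hx⟩ | x) (⟨y, hy⟩ | y)
    · change SE a l s x y ↔ SE a l (s + 1) x y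
      constructor
      · rintro (⟨h1, h2⟩ | ⟨t, h1, h2, h3⟩)
        · refine .inl ⟨h1, fun t ht => ?_⟩
          rcases Nat.lt_succ_iff_lt_or_eq.1 ht with h | rfl
          · exact h2 t h
          · omega
        · exact .inr ⟨t, by omega, h2, h3⟩
      · rintro (⟨h1, h2⟩ | ⟨t, h1, h2, h3⟩)
        · exact .inl ⟨h1, fun t ht => h2 t (by omega)⟩
        · rcases Nat.lt_succ_iff_lt_or_eq.1 h1 with h | rfl
          · exact .inr ⟨t, h, h2, h3⟩
          · omega
    · change False ↔ SE a l (s + 1) x (a s + 1 + y)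
      refine ⟨fun h => h.elim, ?_⟩
      rintro (⟨h1, h2⟩ | ⟨t, h1, h2, h3⟩)
      · have := h2 s (by omega); omega
      · rcases Nat.lt_succ_iff_lt_or_eq.1 h1 with h | rfl
        · have := pre1 t h; omega
        · omega
    · change ((⟨y, hy⟩ : {v : ℕ // v ≤ a s}) = ⟨a s, le_rfl⟩ ∧ x = l s - 2) ↔
        SE a l (s + 1) (a s + 1 + x) y
      rw [Subtype.mk.injEq]
      constructor
      · rintro ⟨rfl, rfl⟩
        exact .inr ⟨s, by omega, by omega, rfl⟩
      · rintro (⟨h1, h2⟩ | ⟨t, h1, h2, h3⟩)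
        · omega
        · rcases Nat.lt_succ_iff_lt_or_eq.1 h1 with h | rfl
          · have := pre2 t h; omega
          · omega
    · change y = x + 1 ↔ SE a l (s + 1) (a s + 1 + x) (a s + 1 + y)
      constructor
      · rintro rfl
        refine .inl ⟨rfl, fun t ht => ?_⟩
        rcases Nat.lt_succ_iff_lt_or_eq.1 ht with h | rfl
        · have := pre1 t h; omega
        · omega
      · rintro (⟨h1, h2⟩ | ⟨t, h1, h2, h3⟩)
        · omega
        · rcases Nat.lt_succ_iff_lt_or_eq.1 h1 with h | rfl
          · have := pre1 t h; omega
          · omega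
  · rintro (⟨x, hx⟩ | x) (⟨y, hy⟩ | y)
    · change SZ n T a l s x y ↔ SZ n T a l (s + 1) x y
      constructor
      · rintro (h | ⟨t, h1, h2, h3, h4⟩)
        · exact .inl h
        · rcases post1 t h1 h2 with rfl | h5 <;> omega
      · rintro (h | ⟨t, h1, h2, h3, h4⟩)
        · exact .inl h
        · exact .inr ⟨t, by omega, h2, h3, h4⟩
    · change False ↔ SZ n T a l (s + 1) x (a s + 1 + y)
      refine ⟨fun h => h.elim, ?_⟩
      rintro (⟨h1, h2⟩ | ⟨t, h1, h2, h3, h4⟩)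
      · omega
      · have := D.lt (show s < t by omega) h2.le; omega
    · change False ↔ SZ n T a l (s + 1) (a s + 1 + x) y
      refine ⟨fun h => h.elim, ?_⟩
      rintro (⟨h1, h2⟩ | ⟨t, h1, h2, h3, h4⟩) <;> omega
    · exact Iff.rfl
  · intro w hw
    obtain ⟨u, hu⟩ := hsur w
    exact (hw u hu).elim

theorem stages {n T : ℕ} {a l : ℕ → ℕ} (D : Dat n T a l) (s : ℕ) (hs : s ≤ T) :
    DEq (QRep k ℕ (SE a l 0) (SZ n T a l 0)) (QRep k ℕ (SE a l s) (SZ n T a l s)) := by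
  induction s with
  | zero => exact DEq.refl _
  | succ s ih => exact (ih (by omega)).trans (stage D s hs)

end Stg
end S17

section S18

namespace Stg
variable {k : Type} [Field k]

/-- cord lengths before `i` -/
def cc (l : ℕ → ℕ) (i : ℕ) : ℕ := ∑ j ∈ Finset.range i, (l j - 2)

lemma cc_succ (l : ℕ → ℕ) (i : ℕ) : cc l (i + 1) = cc l i + (l i - 2) := Finset.sum_range_succ _ _

/-- segment starts -/
def st (a l : ℕ → ℕ) : ℕ → ℕ
  | 0 => 1
  | c + 1 => a c + l c - 1

section
variable {n T : ℕ} {a l : ℕ → ℕ} (D : Dat n T a l)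

lemma Dat.st_le (D : Dat n T a l) {c : ℕ} (hc : c ≤ T) : st a l c ≤ a c := by
  rcases c with _ | c
  · exact D.pos
  · have := D.sep c hc
    change a c + l c - 1 ≤ _
    omega

lemma Dat.lt_st (D : Dat n T a l) {c c' : ℕ} (h : c < c') (hc : c' ≤ T) : a c < st a l c' := by
  rcases c' with _ | d
  · omega
  · change _ < a d + l d - 1
    have := D.l2 d hc
    rcases Nat.lt_succ_iff_lt_or_eq.1 h with h | rfl
    · have := D.lt h (by omega); omega
    · omega

lemma Dat.cs (D : Dat n T a l) {c c' : ℕ} (h : c < c') (hc : c' ≤ T) :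
    a c + cc l c' < st a l c' + cc l c := by
  induction c' with
  | zero => omega
  | succ d ih =>
    change _ < a d + l d - 1 + _
    rw [cc_succ]
    have := D.l2 d hc
    rcases Nat.lt_succ_iff_lt_or_eq.1 h with h | rfl
    · have := ih h (by omega); have := D.st_le (c := d) (by omega); omega
    · omega

lemma Dat.seg (D : Dat n T a l) (p : ℕ) (hp : p + cc l T < n) :
    ∃ c, c ≤ T ∧ st a l c ≤ p + 1 + cc l c ∧ p + 1 + cc l c ≤ a c := by
  induction p with
  | zero => exact ⟨0, by omega, by simp [st, cc], by simpa [cc] using D.pos⟩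
  | succ p ih =>
    obtain ⟨c, h1, h2, h3⟩ := ih (by omega)
    by_cases h4 : p + 1 + cc l c = a c
    · have h5 : c < T := by
        by_contra h6
        obtain rfl : c = T := by omega
        have := D.aT
        omega
      refine ⟨c + 1, h5, ?_, ?_⟩
      · change a c + l c - 1 ≤ _
        rw [cc_succ]; have := D.l2 c h5; omega
      · have := D.sep c h5
        have := D.l2 c h5
        rw [cc_succ]; omega
    · exact ⟨c, h1, by omega, by omega⟩

/-- heights -/
def hh (T : ℕ) (a l : ℕ → ℕ) (i : ℕ) : ℤ :=
  (i : ℤ) - ((∑ t ∈ Finset.range T, if a t < i then l t else 0 : ℕ) : ℤ)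

lemma Dat.hh_edge (D : Dat n T a l) (i j : ℕ) (h : SE a l T i j) : hh T a l j = hh T a l i + 1 := by
  rcases h with ⟨rfl, h⟩ | ⟨t, ht, rfl, rfl⟩
  · have : (∑ t ∈ Finset.range T, if a t < i + 1 then l t else 0) =
        ∑ t ∈ Finset.range T, if a t < i then l t else 0 := by
      refine Finset.sum_congr rfl (fun t ht => ?_)
      have := h t (Finset.mem_range.1 ht)
      split_ifs <;> omega
    rw [hh, hh, this]
    push_cast
    ring
  · have l2 := D.l2 t ht
    have : (∑ s ∈ Finset.range T, if a s < a t + l t - 1 then l s else 0) =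
        (∑ s ∈ Finset.range T, if a s < a t then l s else 0) + l t := by
      have e : l t = ∑ s ∈ Finset.range T, if s = t then l s else 0 := by
        rw [Finset.sum_ite_eq' _ t, if_pos (Finset.mem_range.2 ht)]
      rw [e, ← Finset.sum_add_distrib]
      rw [← e]
      refine Finset.sum_congr rfl (fun s hs => ?_)
      have hs := Finset.mem_range.1 hs
      rcases lt_trichotomy s t with h | h | h
      · have := D.lt h ht.le
        split_ifs <;> omega
      · subst h
        split_ifs <;> omega
      · have := D.mono h hs.le
        split_ifs <;> omega
    rw [hh, hh, this]
    push_cast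
    omega

end

lemma quipu_map {n r : ℕ} {a l : ℕ → ℕ} (D : Dat n (r + 1) a l) (kk : Fin (r + 2) → ℕ)
    (mm : Fin (r + 1) → ℕ) (hL : r + 1 + ∑ i, kk i + cc l (r + 1) = n)
    (hb : ∀ i : Fin (r + 1), bpos r kk i + cc l i.1 = a i.1)
    (hm : ∀ i : Fin (r + 1), mm i = l i.1 - 2) :
    ∃ φ : QuipuV r kk mm → ℕ, Function.Injective φ ∧
      (∀ v, (∃ u, φ u = v) ↔ 1 ≤ v ∧ v ≤ n) ∧
      ∀ x y, (quipuGraph r kk mm).Adj x y ↔ SE a l (r + 1) (φ x) (φ y) ∨ SE a l (r + 1) (φ y) (φ x) := by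
  choose c hc1 hc2 hc3 using fun p : Fin (r + 1 + ∑ i, kk i) => D.seg p.1 (by have := p.2; omega)
  let φ : QuipuV r kk mm → ℕ := Sum.elim (fun p => p.1 + 1 + cc l (c p))
    (fun x => a x.1.1 + l x.1.1 - 2 - x.2.1)
  have φl : ∀ p, φ (.inl p) = p.1 + 1 + cc l (c p) := fun p => rfl
  have φr : ∀ i j, φ (.inr ⟨i, j⟩) = a i.1 + l i.1 - 2 - j.1 := fun p _ => rfl
  -- basic facts
  have cl : ∀ (i : Fin (r + 1)) (j : Fin (mm i)), j.1 + 2 < l i.1 := fun i j => by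
    have := j.2; have := hm i; omega
  have stS : ∀ i, st a l (i + 1) = a i + l i - 1 := fun i => rfl
  -- uniqueness of the segment
  have uniq : ∀ p d, d ≤ r + 1 → st a l d ≤ p.1 + 1 + cc l d → p.1 + 1 + cc l d ≤ a d → c p = d := by
    intro p d h1 h2 h3
    have e1 := hc1 p
    have e2 := hc2 p
    have e3 := hc3 p
    rcases lt_trichotomy (c p) d with h | h | h
    · have := D.cs h h1; omega
    · exact h
    · have := D.cs h e1; omega
  have uniqv : ∀ p d, d ≤ r + 1 → st a l d ≤ φ (.inl p) → φ (.inl p) ≤ a d → c p = d := by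
    intro p d h1 h2 h3
    rw [φl] at h2 h3
    have e1 := hc1 p
    have e2 := hc2 p
    have e3 := hc3 p
    rcases lt_trichotomy (c p) d with h | h | h
    · have := D.lt_st h h1; omega
    · exact h
    · have := D.lt_st h e1; omega
  -- main vertices avoid the cord intervals
  have avoid : ∀ p (i : ℕ), i < r + 1 → a i < φ (.inl p) → φ (.inl p) + 1 < a i + l i → False := by
    intro p i hi h2 h3
    rw [φl] at h2 h3
    have e1 := hc1 p
    have e2 := hc2 p
    have e3 := hc3 p
    rcases Nat.lt_or_ge i (c p) with h | h
    · rcases Nat.eq_or_lt_of_le (Nat.succ_le_of_lt h) with h' | h'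
      · rw [← h', Nat.succ_eq_add_one, stS] at e2
        rw [← h', Nat.succ_eq_add_one] at h3
        omega
      · have := D.lt_st h' e1
        have := D.sep i hi
        have := D.lt (show i < i + 1 by omega) hi
        rcases Nat.eq_or_lt_of_le h' with h'' | h''
        · rw [Nat.succ_eq_add_one] at *; omega
        · rw [Nat.succ_eq_add_one] at *; omega
    · rcases Nat.eq_or_lt_of_le h with h' | h'
      · rw [h'] at e3; rw [h'] at h2; omega
      · have := D.lt h' hi.le; omega
  -- no `a t` in a cord interval
  have avoid' : ∀ (i t : ℕ), i < r + 1 → t < r + 1 → a i < a t → a t + 1 < a i + l i → False := by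
    intro i t hi ht h2 h3
    rcases lt_trichotomy i t with h | h | h
    · have := D.mono h ht.le; omega
    · subst h; omega
    · have := D.lt h hi.le; omega
  have cordsame : ∀ (i i' v : ℕ), i < r + 1 → i' < r + 1 → a i < v → v + 1 < a i + l i →
      a i' < v → v + 1 < a i' + l i' → i = i' := by
    intro i i' v hi hi' h1 h2 h3 h4
    rcases lt_trichotomy i i' with h | h | h
    · have := D.mono h hi'.le; omega
    · exact h
    · have := D.mono h hi.le; omega
  have inj : Function.Injective φ := by
    rintro (p | ⟨i, j⟩) (q | ⟨i', j'⟩) hxy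
    · have h1 := uniqv q (c p) (hc1 p) (by rw [← hxy, φl]; exact hc2 p)
        (by rw [← hxy, φl]; exact hc3 p)
      rw [φl, φl, h1] at hxy
      exact congrArg Sum.inl (Fin.ext (by omega))
    · have := cl i' j'
      rw [φr] at hxy
      exact (avoid p i'.1 i'.2 (by omega) (by omega)).elim
    · have := cl i j
      rw [φr] at hxy
      exact (avoid q i.1 i.2 (by omega) (by omega)).elim
    · have h1 := cl i j
      have h2 := cl i' j'
      rw [φr, φr] at hxy
      have h3 := cordsame i.1 i'.1 (a i.1 + l i.1 - 2 - j.1) i.2 i'.2 (by omega) (by omega)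
        (by omega) (by omega)
      obtain rfl : i = i' := Fin.ext h3
      obtain rfl : j = j' := Fin.ext (by omega)
      rfl
  have an : ∀ i, i ≤ r + 1 → a i ≤ n := by
    intro i hi
    rcases Nat.eq_or_lt_of_le hi with h | h
    · rw [h, D.aT]
    · have := D.lt h le_rfl; rw [D.aT] at this; omega
  have st1 : ∀ i, i ≤ r + 1 → 1 ≤ st a l i := by
    intro i hi
    rcases i with _ | i
    · exact le_rfl
    · have := D.lt_st (show i < i + 1 by omega) hi; omega
  have rng : ∀ x, 1 ≤ φ x ∧ φ x ≤ n := by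
    rintro (p | ⟨i, j⟩)
    · rw [φl]
      have := hc3 p
      have := an _ (hc1 p)
      omega
    · rw [φr]
      have := cl i j
      have := D.sep i.1 i.2
      have := an (i.1 + 1) (by omega)
      omega
  -- every vertex in a segment is hit
  have hitm : ∀ d v, d ≤ r + 1 → st a l d ≤ v → v ≤ a d → ∃ p, φ (.inl p) = v := by
    intro d v hd h1 h2
    have e1 : cc l d + 1 ≤ st a l d := by
      rcases d with _ | d
      · simp [cc, st]
      · have := D.cs (show 0 < d + 1 by omega) hd
        have h0 : cc l 0 = 0 := rfl
        have := D.pos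
        omega
    have e2 : a d + cc l (r + 1) ≤ n + cc l d := by
      rcases Nat.eq_or_lt_of_le hd with h | h
      · rw [h, D.aT]
      · have := D.cs h le_rfl
        have := D.st_le (le_refl (r + 1))
        rw [D.aT] at this
        omega
    let p : Fin (r + 1 + ∑ i, kk i) := ⟨v - cc l d - 1, by omega⟩
    have hp : p.1 = v - cc l d - 1 := rfl
    refine ⟨p, ?_⟩
    have := uniq p d hd (by omega) (by omega)
    rw [φl, this]
    omega
  have hitall : ∀ d v, d ≤ r + 1 → 1 ≤ v → v ≤ a d → ∃ x, φ x = v := by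
    intro d
    induction d with
    | zero =>
      intro v h1 h2 h3
      obtain ⟨p, hp⟩ := hitm 0 v h1 h2 h3
      exact ⟨_, hp⟩
    | succ d ih =>
      intro v h1 h2 h3
      by_cases h4 : v ≤ a d
      · exact ih v (by omega) h2 h4
      · by_cases h5 : st a l (d + 1) ≤ v
        · obtain ⟨p, hp⟩ := hitm (d + 1) v h1 h5 h3
          exact ⟨_, hp⟩
        · rw [stS] at h5
          let i : Fin (r + 1) := ⟨d, h1⟩
          have hmi := hm i
          have hi : i.1 = d := rfl
          rw [hi] at hmi
          let j : Fin (mm i) := ⟨a d + l d - 2 - v, by omega⟩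
          refine ⟨.inr ⟨i, j⟩, ?_⟩
          rw [φr]
          change a d + l d - 2 - (a d + l d - 2 - v) = v
          omega
  refine ⟨φ, inj, fun v => ⟨?_, fun h => hitall (r + 1) v le_rfl h.1 (by rw [D.aT]; exact h.2)⟩, ?_⟩
  · rintro ⟨u, rfl⟩; exact rng u
  -- edges from the quipu
  have bp : ∀ (p : Fin (r + 1 + ∑ i, kk i)) (i : Fin (r + 1)), p.1 = bpos r kk i ↔
      φ (.inl p) = a i.1 + l i.1 - 1 := by
    intro p i
    have h1 := hb i
    have h2 := D.l2 i.1 i.2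
    have h3 := D.sep i.1 i.2
    have h4 := cc_succ l i.1
    constructor
    · intro h
      have := uniq p (i.1 + 1) (by omega) (by rw [stS]; omega) (by omega)
      rw [φl, this]
      omega
    · intro h
      have := uniqv p (i.1 + 1) (by omega) (by rw [stS]; omega) (by omega)
      rw [φl, this] at h
      omega
  have ll : ∀ p q : Fin (r + 1 + ∑ i, kk i), q.1 = p.1 + 1 →
      SE a l (r + 1) (φ (.inl p)) (φ (.inl q)) ∨ SE a l (r + 1) (φ (.inl q)) (φ (.inl p)) := by
    intro p q h
    have e1 := hc1 p
    have e2 := hc2 p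
    have e3 := hc3 p
    by_cases h4 : p.1 + 1 + cc l (c p) = a (c p)
    · have h5 : c p < r + 1 := by
        by_contra h6
        have h7 : c p = r + 1 := by omega
        have := D.aT
        have := q.2
        rw [h7] at h4
        omega
      have h8 := cc_succ l (c p)
      have h9 := D.l2 _ h5
      have h10 := D.sep _ h5
      have := uniq q (c p + 1) h5 (by rw [stS]; omega) (by omega)
      refine .inr (.inr ⟨c p, h5, ?_, ?_⟩)
      · rw [φl, this]; omega
      · rw [φl]; omega
    · have := uniq q (c p) e1 (by omega) (by omega)
      refine .inl (.inl ⟨?_, ?_⟩)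
      · rw [φl, φl, this]; omega
      · intro t ht h5
        rw [φl] at h5
        rcases lt_trichotomy (c p) t with h | h | h
        · have := D.lt h ht.le; omega
        · subst h; omega
        · have := D.lt_st h e1; omega
  have ll' : ∀ p q : Fin (r + 1 + ∑ i, kk i), SE a l (r + 1) (φ (.inl p)) (φ (.inl q)) →
      q.1 = p.1 + 1 ∨ p.1 = q.1 + 1 := by
    rintro p q (⟨h1, h2⟩ | ⟨t, h1, h2, h3⟩)
    · have e1 := hc1 p
      have e2 := hc2 p
      have e3 := hc3 p
      have r1 := rng (.inl q)
      rw [φl p] at h1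
      have h3 : p.1 + 1 + cc l (c p) ≠ a (c p) := by
        intro h4
        rcases Nat.eq_or_lt_of_le e1 with h5 | h5
        · have := D.aT
          rw [h5] at h4 h1
          omega
        · exact h2 _ h5 h4
      have := uniqv q (c p) e1 (by omega) (by omega)
      rw [φl, this] at h1
      omega
    · have := (bp p ⟨t, h1⟩).2 h2
      have hbt := hb ⟨t, h1⟩
      have := uniqv q t h1.le (by rw [h3]; exact D.st_le h1.le) h3.le
      rw [φl, this] at h3
      change bpos r kk ⟨t, h1⟩ + cc l t = a t at hbt
      omega
  have lr' : ∀ p i (j : Fin (mm i)), ¬ SE a l (r + 1) (φ (.inl p)) (φ (.inr ⟨i, j⟩)) := by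
    rintro p i j (⟨h1, h2⟩ | ⟨t, h1, h2, h3⟩)
    · have h3 := cl i j
      rw [φr] at h1
      have h4 := h2 i.1 i.2
      exact avoid p i.1 i.2 (by omega) (by omega)
    · have h4 := cl i j
      rw [φr] at h3
      exact avoid' i.1 t i.2 h1 (by omega) (by omega)
  have rl : ∀ p i (j : Fin (mm i)), SE a l (r + 1) (φ (.inr ⟨i, j⟩)) (φ (.inl p)) ↔
      p.1 = bpos r kk i ∧ j.1 = 0 := by
    intro p i j
    rw [bp]
    have h0 := cl i j
    constructor
    · rintro (⟨h1, h2⟩ | ⟨t, h1, h2, h3⟩)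
      · rw [φr] at h1
        have h3 : ¬ (φ (.inl p) + 1 < a i.1 + l i.1) := fun h4 =>
          avoid p i.1 i.2 (by omega) h4
        omega
      · rw [φr] at h2
        have h5 := D.l2 t h1
        rcases lt_trichotomy i.1 t with h | h | h
        · have := D.mono h h1.le; omega
        · subst h; omega
        · have := D.mono h i.2.le; omega
    · rintro ⟨h1, h2⟩
      refine .inl ⟨by rw [φr]; omega, fun t ht h3 => ?_⟩
      rw [φr] at h3
      exact avoid' i.1 t i.2 ht (by omega) (by omega)
  have rr : ∀ i (j : Fin (mm i)) i' (j' : Fin (mm i')),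
      SE a l (r + 1) (φ (.inr ⟨i, j⟩)) (φ (.inr ⟨i', j'⟩)) ↔ i.1 = i'.1 ∧ j.1 = j'.1 + 1 := by
    intro i j i' j'
    have h0 := cl i j
    have h0' := cl i' j'
    rw [φr, φr]
    constructor
    · rintro (⟨h1, h2⟩ | ⟨t, h1, h2, h3⟩)
      · have h4 := h2 i'.1 i'.2
        have := cordsame i.1 i'.1 (a i.1 + l i.1 - 2 - j.1) i.2 i'.2 (by omega) (by omega)
          (by omega) (by omega)
        refine ⟨this, ?_⟩
        rw [← this] at h1 h0'
        omega
      · exact (avoid' i'.1 t i'.2 h1 (by omega) (by omega)).elim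
    · rintro ⟨h1, h2⟩
      refine .inl ⟨by rw [← h1] at h0' ⊢; omega, fun t ht h3 => ?_⟩
      exact avoid' i.1 t i.2 ht (by omega) (by omega)
  rintro (p | ⟨i, j⟩) (q | ⟨i', j'⟩)
  · rw [quipuGraph, SimpleGraph.fromRel_adj]
    constructor
    · rintro ⟨-, h | h⟩
      · exact ll p q h
      · exact (ll q p h).symm
    · intro h
      have h2 : q.1 = p.1 + 1 ∨ p.1 = q.1 + 1 := h.elim (ll' p q) (fun h => (ll' q p h).symm)
      refine ⟨fun e => ?_, h2⟩
      have : p = q := Sum.inl.inj e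
      subst this
      omega
  · rw [quipuGraph, SimpleGraph.fromRel_adj, rl]
    constructor
    · rintro ⟨-, h | h⟩
      · exact .inr h
      · exact h.elim
    · rintro (h | h)
      · exact (lr' _ _ _ h).elim
      · exact ⟨Sum.inl_ne_inr, .inl h⟩
  · rw [quipuGraph, SimpleGraph.fromRel_adj, rl]
    constructor
    · rintro ⟨-, h | h⟩
      · exact h.elim
      · exact .inl h
    · rintro (h | h)
      · exact ⟨Sum.inr_ne_inl, .inr h⟩
      · exact (lr' _ _ _ h).elim
  · rw [quipuGraph, SimpleGraph.fromRel_adj, rr, rr]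
    constructor
    · rintro ⟨-, h | h⟩
      · exact .inr ⟨h.1.symm, h.2⟩
      · exact .inl ⟨h.1.symm, h.2⟩
    · intro h
      refine ⟨fun e => ?_, ?_⟩
      · have e2 := Sum.inr.inj e
        have e3 : j.1 = j'.1 := by cases e2; rfl
        omega
      · rcases h with h | h
        · exact .inr ⟨h.1.symm, h.2⟩
        · exact .inl ⟨h.1.symm, h.2⟩

theorem quipu_deq {n r : ℕ} {a l : ℕ → ℕ} (D : Dat n (r + 1) a l) (kk : Fin (r + 2) → ℕ)
    (mm : Fin (r + 1) → ℕ) (hL : r + 1 + ∑ i, kk i + cc l (r + 1) = n)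
    (hb : ∀ i : Fin (r + 1), bpos r kk i + cc l i.1 = a i.1)
    (hm : ∀ i : Fin (r + 1), mm i = l i.1 - 2) :
    ∃ h : QuipuV r kk mm → ℤ, Orient.Valid (quipuGraph r kk mm) h ∧
      DEq (QRep k ℕ (SE a l (r + 1)) (SZ n (r + 1) a l (r + 1)))
        (QRep k (QuipuV r kk mm) (Orient.EH (quipuGraph r kk mm) h) Orient.Z0) := by
  obtain ⟨φ, hφ, hr, hadj⟩ := quipu_map D kk mm hL hb hm
  refine ⟨fun x => hh (r + 1) a l (φ x), ?_, Restr.restr_deq φ hφ ?_ ?_ ?_⟩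
  · intro u v huv
    exact ((hadj u v).1 huv).imp (D.hh_edge _ _) (D.hh_edge _ _)
  · intro u v
    constructor
    · rintro ⟨h1, h2⟩
      rcases (hadj u v).1 h1 with h | h
      · exact h
      · have := D.hh_edge _ _ h
        change hh (r + 1) a l (φ v) = hh (r + 1) a l (φ u) + 1 at h2
        omega
    · intro h
      exact ⟨(hadj u v).2 (.inl h), D.hh_edge _ _ h⟩
  · intro u v
    refine ⟨fun h => h.elim, ?_⟩
    have := (hr (φ u)).1 ⟨u, rfl⟩
    rintro (⟨h1, h2⟩ | ⟨t, h1, h2, h3, h4⟩) <;> omega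
  · intro v hv
    refine .inl ⟨rfl, ?_⟩
    by_contra h
    obtain ⟨u, hu⟩ := (hr v).2 (by omega)
    exact hv u hu

end Stg
end S18

section S19

namespace Stg
variable {k : Type} [Field k]

/-- extended start vertices -/
def xa (n t : ℕ) (ns : Fin (t + 1) → ℕ) (i : ℕ) : ℕ := if h : i < t + 1 then ns ⟨i, h⟩ else n
/-- extended lengths -/
def xl (t : ℕ) (ls : Fin (t + 1) → ℕ) (i : ℕ) : ℕ := if h : i < t + 1 then ls ⟨i, h⟩ else 2

lemma xa_lt (n t : ℕ) (ns : Fin (t + 1) → ℕ) (i : ℕ) (h : i < t + 1) : xa n t ns i = ns ⟨i, h⟩ :=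
  dif_pos h
lemma xl_lt (t : ℕ) (ls : Fin (t + 1) → ℕ) (i : ℕ) (h : i < t + 1) : xl t ls i = ls ⟨i, h⟩ :=
  dif_pos h
lemma xa_top (n t : ℕ) (ns : Fin (t + 1) → ℕ) : xa n t ns (t + 1) = n := dif_neg (by omega)

lemma dat {n t : ℕ} {ns ls : Fin (t + 1) → ℕ} (hA : IsASNakayama n (t + 1) ns ls) :
    Dat n (t + 1) (xa n t ns) (xl t ls) where
  aT := xa_top _ _ _
  pos := by rw [xa_lt _ _ _ _ (by omega)]; exact hA.one_le _
  l2 i hi := by rw [xl_lt _ _ _ hi]; exact hA.two_le _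
  sep i hi := by
    rw [xa_lt _ _ _ _ hi, xl_lt _ _ _ hi]
    by_cases h : i + 1 < t + 1
    · rw [xa_lt _ _ _ _ h]
      exact hA.almost_separate ⟨i, hi⟩ ⟨i + 1, h⟩ (Fin.mk_lt_mk.2 (by omega))
    · obtain rfl : i = t := by omega
      rw [xa_top]
      have := hA.end_le ⟨i, hi⟩
      omega

/-- gap sequence -/
def gp (a l : ℕ → ℕ) : ℕ → ℕ
  | 0 => a 0
  | j + 1 => a (j + 1) + 1 - a j - l j

lemma nakK_eq {n t : ℕ} (ns ls : Fin (t + 1) → ℕ) (i : Fin (t + 2)) :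
    nakK n t ns ls i = gp (xa n t ns) (xl t ls) i.1 := by
  obtain ⟨i, hi⟩ := i
  rcases i with _ | i
  · exact (xa_lt n t ns 0 (by omega)).symm
  · change _ = xa n t ns (i + 1) + 1 - xa n t ns i - xl t ls i
    rw [xa_lt n t ns i (by omega), xl_lt t ls i (by omega)]
    by_cases h : i + 1 ≤ t
    · rw [xa_lt n t ns (i + 1) (by omega), nakK, dif_neg (by simp), dif_pos h]
      rfl
    · obtain rfl : i = t := by omega
      rw [xa_top, nakK, dif_neg (by simp), dif_neg h]
      rfl

lemma gp_sum {n T : ℕ} {a l : ℕ → ℕ} (D : Dat n T a l) (i : ℕ) (hi : i ≤ T) :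
    i + ∑ j ∈ Finset.range (i + 1), gp a l j + cc l i = a i := by
  induction i with
  | zero => simp [gp, cc]
  | succ i ih =>
    have h1 := ih (by omega)
    have h2 := D.sep i hi
    have h3 := D.l2 i hi
    rw [Finset.sum_range_succ, cc_succ]
    change i + 1 + (_ + (a (i + 1) + 1 - a i - l i)) + _ = _
    omega

lemma sumL {n t : ℕ} {ns ls : Fin (t + 1) → ℕ} (hA : IsASNakayama n (t + 1) ns ls) :
    t + 1 + ∑ i, nakK n t ns ls i + cc (xl t ls) (t + 1) = n := by
  have h := gp_sum (dat hA) (t + 1) le_rfl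
  rw [xa_top] at h
  refine Eq.trans ?_ h
  congr 2
  rw [← Fin.sum_univ_eq_sum_range]
  exact Finset.sum_congr rfl (fun i _ => nakK_eq ns ls i)

lemma sumB {n t : ℕ} {ns ls : Fin (t + 1) → ℕ} (hA : IsASNakayama n (t + 1) ns ls)
    (i : Fin (t + 1)) : bpos t (nakK n t ns ls) i + cc (xl t ls) i.1 = xa n t ns i.1 := by
  rw [← gp_sum (dat hA) i.1 i.2.le, bpos]
  congr 2
  have h1 : ∀ j : Fin (t + 2), (if j.1 ≤ i.1 then nakK n t ns ls j else 0) =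
      (fun m => if m ≤ i.1 then gp (xa n t ns) (xl t ls) m else 0) j.1 := by
    intro j
    rw [nakK_eq]
  rw [Finset.sum_congr rfl (fun j _ => h1 j), Fin.sum_univ_eq_sum_range
    (fun m => if m ≤ i.1 then gp (xa n t ns) (xl t ls) m else 0), ← Finset.sum_filter]
  refine Finset.sum_congr ?_ (fun _ _ => rfl)
  ext m
  have := i.2
  simp only [Finset.mem_filter, Finset.mem_range]
  omega

lemma start {n t : ℕ} {ns ls : Fin (t + 1) → ℕ} (hA : IsASNakayama n (t + 1) ns ls) :
    DEq (QRep k (Fin n) (Nak.LE n) (Nak.LZ n ns ls))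
      (QRep k ℕ (SE (xa n t ns) (xl t ls) 0) (SZ n (t + 1) (xa n t ns) (xl t ls) 0)) := by
  refine (Restr.restr_deq (fun v : Fin n => v.1 + 1) ?_ ?_ ?_ ?_).symm
  · intro u v h
    exact Fin.ext (Nat.succ.inj h)
  · intro u v
    change v.1 = u.1 + 1 ↔ SE _ _ 0 (u.1 + 1) (v.1 + 1)
    constructor
    · intro h
      exact .inl ⟨by omega, fun t ht => by omega⟩
    · rintro (⟨h1, -⟩ | ⟨t, h1, -⟩) <;> omega
  · intro u v
    change (∃ i, u.1 + 1 = ns i ∧ v.1 + 1 = ns i + ls i) ↔ SZ _ _ _ _ 0 (u.1 + 1) (v.1 + 1)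
    constructor
    · rintro ⟨i, h1, h2⟩
      exact .inr ⟨i.1, by omega, i.2, by rw [h1, xa_lt _ _ _ _ i.2],
        by rw [h2, xa_lt _ _ _ _ i.2, xl_lt _ _ _ i.2]⟩
    · rintro (⟨h1, h2⟩ | ⟨i, h1, h2, h3, h4⟩)
      · have := u.2; omega
      · rw [xa_lt _ _ _ _ h2] at h3 h4
        rw [xl_lt _ _ _ h2] at h4
        exact ⟨⟨i, h2⟩, h3, h4⟩
  · intro v hv
    refine .inl ⟨rfl, ?_⟩
    by_contra h
    exact hv ⟨v - 1, by omega⟩ (by change v - 1 + 1 = v; omega)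

theorem nak_quipu {n t : ℕ} {ns ls : Fin (t + 1) → ℕ} (hA : IsASNakayama n (t + 1) ns ls) :
    ∃ h : QuipuV t (nakK n t ns ls) (fun i => ls i - 2) → ℤ,
      Orient.Valid (quipuGraph t (nakK n t ns ls) (fun i => ls i - 2)) h ∧
      DEq (ModuleCat.{0} (NakayamaAlgebra k n (t + 1) ns ls)ᵐᵒᵖ)
        (QRep k (QuipuV t (nakK n t ns ls) (fun i => ls i - 2))
          (Orient.EH (quipuGraph t (nakK n t ns ls) (fun i => ls i - 2)) h) Orient.Z0) := by
  obtain ⟨h, hV, hD⟩ := quipu_deq (k := k) (dat hA) (nakK n t ns ls) (fun i => ls i - 2) (sumL hA)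
    (sumB hA) (fun i => by rw [xl_lt _ _ _ i.2])
  have hb := Nak.bridge (k := k) hA.one_le (fun i => le_trans (by omega) (hA.two_le i)) hA.end_le
  exact ⟨h, hV, hb.trans ((start hA).trans ((stages (dat hA) (t + 1) le_rfl).trans hD))⟩

theorem same_ns {n t : ℕ} {ns ls ns' : Fin (t + 1) → ℕ} (hA : IsASNakayama n (t + 1) ns ls)
    (hB : IsASNakayama n (t + 1) ns' ls) (h0 : ns' 0 = ns 0)
    (h : ∀ i : Fin t, ns' i.succ + 1 - ns' i.castSucc - ls i.castSucc =
      ns i.succ + 1 - ns i.castSucc - ls i.castSucc) : ns' = ns := by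
  funext i
  induction i using Fin.induction with
  | zero => exact h0
  | succ i ih =>
    have h1 := h i
    have h2 := hA.almost_separate i.castSucc i.succ Fin.castSucc_lt_succ
    have h3 := hB.almost_separate i.castSucc i.succ Fin.castSucc_lt_succ
    omega

end Stg
end S19

/-- If the data of two linear Nakayama algebras with almost separate
relations give rise to the same quipu parameters (same number of relations, same `n`, same
first start vertex `n_0`, same lengths, and the same gaps `n_i + 1 - n_{i-1} - l_{i-1}`) —
or, more generally, if the two associated quipus
`P_{(n_0, n_1+1-n_0-l_0, …, n+1-n_t-l_t)}^{(l_0-2,…,l_t-2)}` are isomorphic as graphs —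
then the two Nakayama algebras are derived equivalent. -/
theorem nakayama_derivedEquivalent_of_quipu_iso (k : Type) [Field k]
    (n t : ℕ) (ns ls : Fin (t + 1) → ℕ)
    (n' t' : ℕ) (ns' ls' : Fin (t' + 1) → ℕ)
    (hA : IsASNakayama n (t + 1) ns ls) (hB : IsASNakayama n' (t' + 1) ns' ls')
    (h : (∃ ht : t' = t, n' = n ∧ ns' 0 = ns 0 ∧
          (∀ i : Fin (t' + 1), ls' i = ls (Fin.cast (by omega) i)) ∧
          (∀ i : Fin t',
            ns' i.succ + 1 - ns' i.castSucc - ls' i.castSucc =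
              ns (Fin.cast (by omega) i.succ) + 1 - ns (Fin.cast (by omega) i.castSucc) -
                ls (Fin.cast (by omega) i.castSucc))) ∨
        Nonempty (quipuGraph t (nakK n t ns ls) (fun i => ls i - 2) ≃g
          quipuGraph t' (nakK n' t' ns' ls') (fun i => ls' i - 2))) :
    DerivedEquivalent k (NakayamaAlgebra k n (t + 1) ns ls)
      (NakayamaAlgebra k n' (t' + 1) ns' ls') := by
  rcases h with ⟨ht, hn, h0, hl, hd⟩ | e
  · subst ht
    subst hn
    obtain rfl : ls' = ls := funext hl
    obtain rfl : ns' = ns := Stg.same_ns hA hB h0 hd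
    exact DEq.refl _
  · obtain ⟨h1, hV1, hD1⟩ := Stg.nak_quipu (k := k) hA
    obtain ⟨h2, hV2, hD2⟩ := Stg.nak_quipu (k := k) hB
    exact (hD2.trans ((Orient.orient_iso e.some h2 h1 hV2 hV1).trans hD1.symm)).symm
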